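/- Let P1 and P2 be n×n skew-symmetric matrix pencils. Then orbᶜ(P1) covers orbᶜ(P2) if and only if the integer partitions R, L, and J_μ of P2 can be obtained from those of P1 by applying exactly one of the following four rules: Rule I: a minimum rightward coin move from a column j ≥ 1 in R together with the same coin move in L; Rule II: a minimum leftward coin move of a vertical pair of coins in some J_μ; Rule III: if the rightmost column of each of R and L is a single coin, remove these two coins and append them together as a new rightmost column (of height 2) of some J_μ; Rule IV: letting 2k = Σ_i 2k_i, where k_i is the number of coins in each of the two longest (lowest) rows of J_{μ_i}(P1) for each eigenvalue μ_i, remove these 2k coins, add two more coins, distribute k+1 of the 2k+2 coins to columns r_p, p = 0,…,t, of R and l_q, q = 0,…,k−t−1, of L, and the remaining k+1 coins to columns r_p, p = 0,…,k−t−1, of R and l_q, q = 0,…,t, of L, in such a way that every previously nonzero column of each of R(P1) and L(P1) receives 2 coins and |p − q| is the minimum of all possible differences. -/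

import Mathlib

/-!
Basic framework: a complex `m × n` matrix pencil `A - λ B` is formalized as the
pair `(A, B)` of matrices.  We define strict equivalence, congruence,
skew-symmetry, orbits, direct sums, and the cover relations for the orbit
closure hierarchies (in the Euclidean topology).
-/

open Matrix

noncomputable section

/-- An `m × n` complex matrix pencil `A - λ B`, formalized as the pair `(A, B)`. -/
abbrev Pencil (m n : ℕ) : Type :=
  Matrix (Fin m) (Fin n) ℂ × Matrix (Fin m) (Fin n) ℂ

namespace Pencil

/-- Strict equivalence of matrix pencils: `Q⁻¹ * A * R = C` and `Q⁻¹ * B * R = D`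
for some invertible `Q`, `R`. -/
def StrictEquiv {m n : ℕ} (P Q : Pencil m n) : Prop :=
  ∃ (S : Matrix (Fin m) (Fin m) ℂ) (R : Matrix (Fin n) (Fin n) ℂ),
    IsUnit S ∧ IsUnit R ∧ S⁻¹ * P.1 * R = Q.1 ∧ S⁻¹ * P.2 * R = Q.2

/-- The strict-equivalence orbit of a pencil. -/
def orbE {m n : ℕ} (P : Pencil m n) : Set (Pencil m n) :=
  {Q | StrictEquiv P Q}

/-- A pencil `A - λ B` is skew-symmetric if `Aᵀ = -A` and `Bᵀ = -B`. -/
def IsSkew {n : ℕ} (P : Pencil n n) : Prop :=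
  P.1ᵀ = -P.1 ∧ P.2ᵀ = -P.2

/-- Congruence of (square) matrix pencils: `Sᵀ * A * S = C` and `Sᵀ * B * S = D`
for some invertible `S`. -/
def Congruent {n : ℕ} (P Q : Pencil n n) : Prop :=
  ∃ S : Matrix (Fin n) (Fin n) ℂ,
    IsUnit S ∧ Sᵀ * P.1 * S = Q.1 ∧ Sᵀ * P.2 * S = Q.2

/-- The congruence orbit of a pencil. -/
def orbC {n : ℕ} (P : Pencil n n) : Set (Pencil n n) :=
  {Q | Congruent P Q}

/-- Direct (block-diagonal) sum of two pencils. -/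
def dsum {m n p q : ℕ} (P : Pencil m n) (Q : Pencil p q) : Pencil (m + p) (n + q) :=
  ((fromBlocks P.1 0 0 Q.1).submatrix finSumFinEquiv.symm finSumFinEquiv.symm,
   (fromBlocks P.2 0 0 Q.2).submatrix finSumFinEquiv.symm finSumFinEquiv.symm)

/-- Transport a pencil along equalities of its dimensions. -/
def cast {m n m' n' : ℕ} (hm : m = m') (hn : n = n') (P : Pencil m n) : Pencil m' n' :=
  (P.1.submatrix (finCongr hm.symm) (finCongr hn.symm),
   P.2.submatrix (finCongr hm.symm) (finCongr hn.symm))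

/-- `orbE P1` covers `orbE P2` in the closure hierarchy of strict-equivalence
orbits: `P1` is not strictly equivalent to `P2`, `orbE P2 ⊆ closure (orbE P1)`,
and there is no intermediate orbit strictly between them. -/
def CoversE {m n : ℕ} (P1 P2 : Pencil m n) : Prop :=
  ¬ StrictEquiv P1 P2 ∧ orbE P2 ⊆ closure (orbE P1) ∧
    ¬ ∃ P : Pencil m n, ¬ StrictEquiv P P1 ∧ ¬ StrictEquiv P P2 ∧
        orbE P ⊆ closure (orbE P1) ∧ orbE P2 ⊆ closure (orbE P)

/-- `orbC P1` covers `orbC P2` in the closure hierarchy of congruence orbits of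
skew-symmetric pencils: `P1` is not congruent to `P2`,
`orbC P2 ⊆ closure (orbC P1)`, and there is no congruence orbit of a
skew-symmetric pencil strictly between them. -/
def CoversC {n : ℕ} (P1 P2 : Pencil n n) : Prop :=
  ¬ Congruent P1 P2 ∧ orbC P2 ⊆ closure (orbC P1) ∧
    ¬ ∃ P : Pencil n n, IsSkew P ∧ ¬ Congruent P P1 ∧ ¬ Congruent P P2 ∧
        orbC P ⊆ closure (orbC P1) ∧ orbC P2 ⊆ closure (orbC P)

end Pencil

/-! Canonical building blocks. -/

/-- The `k × k` Jordan block `J_k(μ)`. -/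
def Jmat (k : ℕ) (μ : ℂ) : Matrix (Fin k) (Fin k) ℂ :=
  Matrix.of fun i j => if (j : ℕ) = (i : ℕ) then μ else if (j : ℕ) = (i : ℕ) + 1 then 1 else 0

/-- The `k × (k+1)` matrix `F_k` with ones on the superdiagonal. -/
def Fmat (k : ℕ) : Matrix (Fin k) (Fin (k + 1)) ℂ :=
  Matrix.of fun i j => if (j : ℕ) = (i : ℕ) + 1 then 1 else 0

/-- The `k × (k+1)` matrix `G_k` with ones on the diagonal. -/
def Gmat (k : ℕ) : Matrix (Fin k) (Fin (k + 1)) ℂ :=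
  Matrix.of fun i j => if (j : ℕ) = (i : ℕ) then 1 else 0

/-- The Kronecker block `E_k(μ) = J_k(μ) - λ I_k`. -/
def Eblk (k : ℕ) (μ : ℂ) : Pencil k k := (Jmat k μ, 1)

/-- The Kronecker block `E_k(∞) = I_k - λ J_k(0)`. -/
def EInfblk (k : ℕ) : Pencil k k := (1, Jmat k 0)

/-- The Kronecker block `L_k = F_k - λ G_k`. -/
def Lblk (k : ℕ) : Pencil k (k + 1) := (Fmat k, Gmat k)

/-- The Kronecker block `L_kᵀ = F_kᵀ - λ G_kᵀ`. -/
def LTblk (k : ℕ) : Pencil (k + 1) k := ((Fmat k)ᵀ, (Gmat k)ᵀ)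

/-- The skew-symmetric matrix `[[0, X], [-Xᵀ, 0]]`. -/
def skewPair {p q : ℕ} (X : Matrix (Fin p) (Fin q) ℂ) :
    Matrix (Fin (p + q)) (Fin (p + q)) ℂ :=
  (fromBlocks 0 X (-Xᵀ) 0).submatrix finSumFinEquiv.symm finSumFinEquiv.symm

/-- The skew-symmetric canonical block `H_h(μ)` (size `2h × 2h`). -/
def Hblk (h : ℕ) (μ : ℂ) : Pencil (h + h) (h + h) :=
  (skewPair (Jmat h μ), skewPair (1 : Matrix (Fin h) (Fin h) ℂ))

/-- The skew-symmetric canonical block `K_k = H_k(∞)` (size `2k × 2k`). -/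
def Kblk (k : ℕ) : Pencil (k + k) (k + k) :=
  (skewPair (1 : Matrix (Fin k) (Fin k) ℂ), skewPair (Jmat k 0))

/-- The skew-symmetric canonical block `M_m` (size `(2m+1) × (2m+1)`). -/
def Mblk (m : ℕ) : Pencil (m + (m + 1)) (m + (m + 1)) :=
  (skewPair (Fmat m), skewPair (Gmat m))

/-! Skew-symmetric (Thompson) canonical forms as multisets of block
descriptors. -/

/-- Descriptor of a skew-symmetric canonical block. -/
inductive SBlock : Type
  | H : ℕ → ℂ → SBlock    -- `H_h(μ)`, `μ ∈ ℂ`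
  | K : ℕ → SBlock         -- `K_k = H_k(∞)`
  | M : ℕ → SBlock         -- `M_m`

namespace SBlock

/-- Size of a block. -/
def size : SBlock → ℕ
  | H h _ => h + h
  | K k => k + k
  | M m => m + (m + 1)

/-- A block is valid (may occur in a canonical form) if the `H`- and `K`-blocks
have index at least one. -/
def valid : SBlock → Prop
  | H h _ => 1 ≤ h
  | K k => 1 ≤ k
  | M _ => True

/-- The pencil corresponding to a block descriptor. -/
def toPencil : (b : SBlock) → Pencil b.size b.size
  | H h μ => Hblk h μ
  | K k => Kblk k
  | M m => Mblk m

end SBlock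

/-- The block `H_h(μ)` for an eigenvalue `μ ∈ ℂ ∪ {∞}`; `none` encodes `∞`
(so `Hb none h` is the block `K_h`). -/
def Hb : Option ℂ → ℕ → SBlock
  | some μ, h => SBlock.H h μ
  | none, h => SBlock.K h

/-- Total size of a list of blocks. -/
def sizeSum : List SBlock → ℕ
  | [] => 0
  | b :: t => b.size + sizeSum t

/-- The direct sum of the blocks in a list. -/
def spencilOfList : (l : List SBlock) → Pencil (sizeSum l) (sizeSum l)
  | [] => (0, 0)
  | b :: t => Pencil.dsum b.toPencil (spencilOfList t)

/-- `s` is the multiset of blocks of the skew-symmetric canonical form of `P`,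
i.e. `P` is congruent to the direct sum of the blocks of `s`. -/
def RepresentsC {n : ℕ} (P : Pencil n n) (s : Multiset SBlock) : Prop :=
  (∀ b ∈ s, b.valid) ∧
  ∃ (l : List SBlock) (h : sizeSum l = n),
    (l : Multiset SBlock) = s ∧
    Pencil.Congruent (Pencil.cast h h (spencilOfList l)) P

/-- Like `RepresentsC`, but also allowing degenerate (empty) blocks such as
`H_0(μ)` among the summands. -/
def WeakRepresentsC {n : ℕ} (P : Pencil n n) (s : Multiset SBlock) : Prop :=
  ∃ (l : List SBlock) (h : sizeSum l = n),
    (l : Multiset SBlock) = s ∧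
    Pencil.Congruent (Pencil.cast h h (spencilOfList l)) P

/-! Weyr-type characteristics of a skew-symmetric canonical form. -/

open scoped Classical

/-- The number of `M`-blocks with index `≥ i` (this is `r_i = l_i` for a
skew-symmetric pencil). -/
def mWs (s : Multiset SBlock) (i : ℕ) : ℕ :=
  Multiset.card (s.filter fun b => ∃ a, b = SBlock.M a ∧ i ≤ a)

/-- The number of `H`-blocks with eigenvalue `μ ∈ ℂ ∪ {∞}` and index `≥ i`. -/
def jWs (s : Multiset SBlock) (μ : Option ℂ) (i : ℕ) : ℕ :=
  Multiset.card (s.filter fun b => ∃ a, b = Hb μ a ∧ i ≤ a)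

/-! Integer partitions (as finitely supported non-increasing sequences of
column heights of coin diagrams) and coin moves. -/

/-- An integer partition, presented by the sequence of its parts (equivalently,
of the column heights of its coin diagram), indexed from `0`. -/
def IsPartitionFun (p : ℕ → ℕ) : Prop :=
  (∀ i, p (i + 1) ≤ p i) ∧ ∃ N, ∀ i, N ≤ i → p i = 0

/-- Partial sum of the first `m` parts. -/
def psum (p : ℕ → ℕ) (m : ℕ) : ℕ := ∑ i ∈ Finset.range m, p i

/-- Dominance order on partitions (of the same number). -/
def Dominates (p q : ℕ → ℕ) : Prop :=
  (∀ m, psum q m ≤ psum p m) ∧ ∃ N, ∀ m, N ≤ m → psum p m = psum q m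

/-- `p` covers `q` in the dominance order on partitions. -/
def DomCovers (p q : ℕ → ℕ) : Prop :=
  Dominates p q ∧ p ≠ q ∧
    ∀ r, IsPartitionFun r → Dominates p r → Dominates r q → r = p ∨ r = q

/-- `q` is obtained from `p` by moving one coin from column `j` rightward
(one column rightward or one row downward, i.e. to a later column). -/
def CoinMoveRight (p q : ℕ → ℕ) (j : ℕ) : Prop :=
  ∃ k, j < k ∧ q j + 1 = p j ∧ q k = p k + 1 ∧ ∀ i, i ≠ j → i ≠ k → q i = p i

/-- Minimum rightward coin move from column `j`: the result is again a
partition and is covered by the original one in the dominance order. -/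
def MinRightCoinMove (p q : ℕ → ℕ) (j : ℕ) : Prop :=
  CoinMoveRight p q j ∧ IsPartitionFun q ∧ DomCovers p q

/-- Minimum leftward coin move: the inverse of a minimum rightward coin move. -/
def MinLeftCoinMove (p q : ℕ → ℕ) : Prop :=
  ∃ j, MinRightCoinMove q p j

/-- `q` is obtained from `p` by moving a vertical pair of coins (a pair of
coins of the same column lying in rows `2t+1`, `2t+2`) from column `k` to an
earlier column `j`. -/
def VPairMoveLeft (p q : ℕ → ℕ) : Prop :=
  ∃ j k, j < k ∧ Even (p k) ∧ Even (p j) ∧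
    q j = p j + 2 ∧ q k + 2 = p k ∧ ∀ i, i ≠ j → i ≠ k → q i = p i

/-- Minimum leftward coin move of a vertical pair of coins: the result is again
a partition and no partition with even parts lies strictly between the two in
the dominance order. -/
def MinLeftVPairMove (p q : ℕ → ℕ) : Prop :=
  VPairMoveLeft p q ∧ IsPartitionFun q ∧ Dominates q p ∧ q ≠ p ∧
    ∀ r, IsPartitionFun r → (∀ i, Even (r i)) → Dominates q r → Dominates r p →
      r = q ∨ r = p

/-- The partition `R = L = (r_0, r_1, …)` of a skew-symmetric canonical form
(the number of `M`-blocks of index `≥ i`). -/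
def rPartS (s : Multiset SBlock) : ℕ → ℕ := fun i => mWs s i

/-- The partition `J_μ = (j_1^μ, j_2^μ, …)` of a skew-symmetric canonical form,
re-indexed from `0`: each `H_h(μ)` contributes two Jordan blocks `E_h(μ)`, so
`j_i^μ` is twice the number of `H(μ)`-blocks of index `≥ i`. -/
def jPartS (s : Multiset SBlock) (μ : Option ℂ) : ℕ → ℕ := fun i => 2 * jWs s μ (i + 1)

/-- Rule I: a minimum rightward coin move from a column `j ≥ 1` in `R`,
together with the same coin move in `L` (for a skew-symmetric pencil,
`R = L`); the `J_μ` are unchanged. -/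
def RuleI (s1 s2 : Multiset SBlock) : Prop :=
  ∃ j, 1 ≤ j ∧ MinRightCoinMove (rPartS s1) (rPartS s2) j ∧
    ∀ μ, jPartS s2 μ = jPartS s1 μ

/-- Rule II: a minimum leftward coin move of a vertical pair of coins in some
`J_μ`; `R = L` and the other `J_ν` are unchanged. -/
def RuleII (s1 s2 : Multiset SBlock) : Prop :=
  ∃ μ, MinLeftVPairMove (jPartS s1 μ) (jPartS s2 μ) ∧
    (∀ ν, ν ≠ μ → jPartS s2 ν = jPartS s1 ν) ∧
    rPartS s2 = rPartS s1

/-- Rule III: if the rightmost column of each of `R` and `L` is a single coin,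
remove these two coins and append them together as a new rightmost column (of
height `2`) of some `J_μ`. -/
def RuleIII (s1 s2 : Multiset SBlock) : Prop :=
  ∃ (c : ℕ) (μ : Option ℂ) (d : ℕ),
    rPartS s1 c = 1 ∧ (∀ i, c < i → rPartS s1 i = 0) ∧
    rPartS s2 = Function.update (rPartS s1) c 0 ∧
    jPartS s1 μ d = 0 ∧ (∀ i, i < d → 1 ≤ jPartS s1 μ i) ∧
    jPartS s2 μ = Function.update (jPartS s1 μ) d 2 ∧
    (∀ ν, ν ≠ μ → jPartS s2 ν = jPartS s1 ν)

/-- Rule IV: let `2k = Σᵢ 2kᵢ`, where `kᵢ` is the number of coins in each of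
the two longest (= lowest) rows of `J_{μᵢ}(P1)` for each eigenvalue `μᵢ`;
remove these `2k` coins, add two more coins, and distribute `k + 1` of the
`2k + 2` coins to the columns `r_0, …, r_t` of `R` and `l_0, …, l_{k-t-1}` of
`L`, and the remaining `k + 1` coins to the columns `r_0, …, r_{k-t-1}` of `R`
and `l_0, …, l_t` of `L`, in such a way that every previously nonzero column of
each of `R(P1)` and `L(P1)` receives `2` coins and the difference
`|t - (k - t - 1)|` between the two new big columns is the minimum of all
possible such differences (for a skew-symmetric pencil, `R = L`, so the coins
landing in `R` are those landing in columns `0, …, t` and `0, …, k-t-1`). -/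
def RuleIV (s1 s2 : Multiset SBlock) : Prop :=
  ∃ (ek : List (Option ℂ × ℕ)) (t : ℕ),
    (ek.map Prod.fst).Nodup ∧
    (∀ x ∈ ek, 1 ≤ x.2 ∧ jPartS s1 x.1 (x.2 - 1) ≠ 0 ∧ ∀ i, x.2 ≤ i → jPartS s1 x.1 i = 0) ∧
    (∀ ν, jPartS s1 ν 0 ≠ 0 → ν ∈ ek.map Prod.fst) ∧
    (let k := (ek.map Prod.snd).sum
     t < k ∧
     (∀ ν i, jPartS s2 ν i = jPartS s1 ν i - 2) ∧
     (∀ i, rPartS s2 i =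
        rPartS s1 i + (if i ≤ t then 1 else 0) + (if i ≤ k - t - 1 then 1 else 0)) ∧
     (∀ i, rPartS s1 i ≠ 0 → i ≤ t ∧ i ≤ k - t - 1) ∧
     (∀ t' : ℕ, t' < k → (∀ i, rPartS s1 i ≠ 0 → i ≤ t' ∧ i ≤ k - t' - 1) →
        max t (k - t - 1) - min t (k - t - 1) ≤
          max t' (k - t' - 1) - min t' (k - t' - 1)))

/-- A pencil whose rows and columns are indexed by arbitrary types. -/
abbrev GP (κ ι : Type) : Type := Matrix κ ι ℂ × Matrix κ ι ℂ

section GenericPencils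

variable {ι κ τ ι' κ' τ' : Type} [Fintype ι] [Fintype κ] [Fintype τ] [Fintype ι']
  [Fintype κ'] [Fintype τ'] [DecidableEq ι'] [DecidableEq κ'] [DecidableEq τ'] [DecidableEq ι]
  [DecidableEq κ] [DecidableEq τ]

/-- Congruence of square pencils over possibly different index types. -/
def GCong (P : GP ι ι) (Q : GP κ κ) : Prop :=
  ∃ (S : Matrix ι κ ℂ) (T : Matrix κ ι ℂ), S * T = 1 ∧ T * S = 1 ∧
    Sᵀ * P.1 * S = Q.1 ∧ Sᵀ * P.2 * S = Q.2

/-- Strict equivalence of rectangular pencils over possibly different index types. -/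
def REq (X : GP κ ι) (Y : GP κ' ι') : Prop :=
  ∃ (S : Matrix κ' κ ℂ) (S' : Matrix κ κ' ℂ) (R : Matrix ι ι' ℂ) (R' : Matrix ι' ι ℂ),
    S * S' = 1 ∧ S' * S = 1 ∧ R * R' = 1 ∧ R' * R = 1 ∧
    S * X.1 * R = Y.1 ∧ S * X.2 * R = Y.2

/-- `Q` lies in the closure of the congruence orbit of `P`. -/
def GDeg (P : GP ι ι) (Q : GP κ κ) : Prop := Q ∈ closure {R : GP κ κ | GCong P R}

/-- `Y` lies in the closure of the strict equivalence orbit of `X`. -/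
def RDeg (X : GP κ ι) (Y : GP κ' ι') : Prop := Y ∈ closure {Z : GP κ' ι' | REq X Z}

theorem GCong.refl (P : GP ι ι) : GCong P P := ⟨1, 1, by simp⟩

theorem GCong.symm {P : GP ι ι} {Q : GP κ κ} (h : GCong P Q) : GCong Q P := by
  obtain ⟨S, T, h1, h2, h3, h4⟩ := h
  have h1' : Tᵀ * Sᵀ = 1 := by rw [← transpose_mul, h1, transpose_one]
  refine ⟨T, S, h2, h1, ?_, ?_⟩
  · rw [← h3]
    calc Tᵀ * (Sᵀ * P.1 * S) * T = (Tᵀ * Sᵀ) * P.1 * (S * T) := by simp only [Matrix.mul_assoc]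
      _ = P.1 := by rw [h1, h1', Matrix.one_mul, Matrix.mul_one]
  · rw [← h4]
    calc Tᵀ * (Sᵀ * P.2 * S) * T = (Tᵀ * Sᵀ) * P.2 * (S * T) := by simp only [Matrix.mul_assoc]
      _ = P.2 := by rw [h1, h1', Matrix.one_mul, Matrix.mul_one]

theorem GCong.trans {P : GP ι ι} {Q : GP κ κ} {R : GP τ τ} (h : GCong P Q) (h' : GCong Q R) :
    GCong P R := by
  obtain ⟨S, T, h1, h2, h3, h4⟩ := h
  obtain ⟨S', T', h1', h2', h3', h4'⟩ := h'
  refine ⟨S * S', T' * T, ?_, ?_, ?_, ?_⟩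
  · calc S * S' * (T' * T) = S * (S' * T') * T := by simp only [Matrix.mul_assoc]
      _ = 1 := by rw [h1', Matrix.mul_one, h1]
  · calc T' * T * (S * S') = T' * (T * S) * S' := by simp only [Matrix.mul_assoc]
      _ = 1 := by rw [h2, Matrix.mul_one, h2']
  · rw [← h3', ← h3, transpose_mul]; simp only [Matrix.mul_assoc]
  · rw [← h4', ← h4, transpose_mul]; simp only [Matrix.mul_assoc]

theorem GCong.deg {P : GP ι ι} {Q : GP κ κ} (h : GCong P Q) : GDeg P Q := subset_closure h

theorem continuous_congruence (S : Matrix ι κ ℂ) :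
    Continuous fun P : GP ι ι => ((Sᵀ * P.1 * S, Sᵀ * P.2 * S) : GP κ κ) := by
  fun_prop

theorem GDeg.trans {P : GP ι ι} {Q : GP κ κ} {R : GP τ τ} (h : GDeg P Q) (h' : GDeg Q R) :
    GDeg P R := by
  have key : {R' : GP τ τ | GCong Q R'} ⊆ closure {R' : GP τ τ | GCong P R'} := by
    rintro R' ⟨S, T, h1, h2, h3, h4⟩
    have e : ((Sᵀ * Q.1 * S, Sᵀ * Q.2 * S) : GP τ τ) = R' := Prod.ext h3 h4
    rw [← e]
    refine map_mem_closure (f := fun P : GP κ κ => ((Sᵀ * P.1 * S, Sᵀ * P.2 * S) : GP τ τ))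
      (continuous_congruence S) h ?_
    intro Q' hQ'
    exact hQ'.trans ⟨S, T, h1, h2, rfl, rfl⟩
  exact closure_minimal key isClosed_closure h'

theorem GDeg.trans_cong {P : GP ι ι} {Q : GP κ κ} {R : GP τ τ} (h : GDeg P Q) (h' : GCong Q R) :
    GDeg P R := h.trans h'.deg

theorem GCong.trans_deg {P : GP ι ι} {Q : GP κ κ} {R : GP τ τ} (h : GCong P Q) (h' : GDeg Q R) :
    GDeg P R := h.deg.trans h'

theorem REq.trans {X : GP κ ι} {Y : GP κ' ι'} {Z : GP τ τ'} (h : REq X Y) (h' : REq Y Z) :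
    REq X Z := by
  obtain ⟨S, S', R, R', h1, h2, h3, h4, h5, h6⟩ := h
  obtain ⟨U, U', V, V', g1, g2, g3, g4, g5, g6⟩ := h'
  refine ⟨U * S, S' * U', R * V, V' * R', ?_, ?_, ?_, ?_, ?_, ?_⟩
  · calc U * S * (S' * U') = U * (S * S') * U' := by simp only [Matrix.mul_assoc]
      _ = 1 := by rw [h1, Matrix.mul_one, g1]
  · calc S' * U' * (U * S) = S' * (U' * U) * S := by simp only [Matrix.mul_assoc]
      _ = 1 := by rw [g2, Matrix.mul_one, h2]
  · calc R * V * (V' * R') = R * (V * V') * R' := by simp only [Matrix.mul_assoc]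
      _ = 1 := by rw [g3, Matrix.mul_one, h3]
  · calc V' * R' * (R * V) = V' * (R' * R) * V := by simp only [Matrix.mul_assoc]
      _ = 1 := by rw [h4, Matrix.mul_one, g4]
  · rw [← g5, ← h5]; simp only [Matrix.mul_assoc]
  · rw [← g6, ← h6]; simp only [Matrix.mul_assoc]

theorem REq.symm {X : GP κ ι} {Y : GP κ' ι'} (h : REq X Y) : REq Y X := by
  obtain ⟨S, S', R, R', h1, h2, h3, h4, h5, h6⟩ := h
  refine ⟨S', S, R', R, h2, h1, h4, h3, ?_, ?_⟩
  · rw [← h5]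
    calc S' * (S * X.1 * R) * R' = (S' * S) * X.1 * (R * R') := by simp only [Matrix.mul_assoc]
      _ = X.1 := by rw [h2, h3, Matrix.one_mul, Matrix.mul_one]
  · rw [← h6]
    calc S' * (S * X.2 * R) * R' = (S' * S) * X.2 * (R * R') := by simp only [Matrix.mul_assoc]
      _ = X.2 := by rw [h2, h3, Matrix.one_mul, Matrix.mul_one]

/-- Block-diagonal sum of rectangular pencils. -/
def gsum (P : GP κ ι) (Q : GP κ' ι') : GP (κ ⊕ κ') (ι ⊕ ι') :=
  (fromBlocks P.1 0 0 Q.1, fromBlocks P.2 0 0 Q.2)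

/-- The skew-symmetric pencil `[[0, X], [-Xᵀ, 0]]`. -/
def sk (X : GP κ ι) : GP (κ ⊕ ι) (κ ⊕ ι) :=
  (fromBlocks 0 X.1 (-X.1ᵀ) 0, fromBlocks 0 X.2 (-X.2ᵀ) 0)

/-- Exchange of the two matrices of a pencil. -/
def gswap (X : GP κ ι) : GP κ ι := (X.2, X.1)

/-- Reindexing of a pencil. -/
def greidx (e : κ' → κ) (f : ι' → ι) (X : GP κ ι) : GP κ' ι' :=
  (X.1.submatrix e f, X.2.submatrix e f)

theorem greidx_cong (e : κ ≃ ι) (P : GP ι ι) : GCong P (greidx e e P) := by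
  refine ⟨(1 : Matrix ι ι ℂ).submatrix id e, (1 : Matrix ι ι ℂ).submatrix e id, ?_, ?_, ?_, ?_⟩
  · ext i j
    simp [Matrix.mul_apply, Matrix.one_apply]
    rw [Finset.sum_eq_single (e.symm i)] <;> aesop
  · ext i j
    simp [Matrix.mul_apply, Matrix.one_apply]
  · ext i j
    simp [greidx, Matrix.mul_apply, Matrix.one_apply]
  · ext i j
    simp [greidx, Matrix.mul_apply, Matrix.one_apply]

theorem greidx_req (e : κ' ≃ κ) (f : ι' ≃ ι) (X : GP κ ι) : REq X (greidx e f X) := by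
  refine ⟨(1 : Matrix κ κ ℂ).submatrix e id, (1 : Matrix κ κ ℂ).submatrix id e,
    (1 : Matrix ι ι ℂ).submatrix id f, (1 : Matrix ι ι ℂ).submatrix f id, ?_, ?_, ?_, ?_, ?_, ?_⟩
  · ext i j
    simp [Matrix.mul_apply, Matrix.one_apply]
  · ext i j
    simp [Matrix.mul_apply, Matrix.one_apply]
    rw [Finset.sum_eq_single (e.symm i)] <;> aesop
  · ext i j
    simp [Matrix.mul_apply, Matrix.one_apply]
    rw [Finset.sum_eq_single (f.symm i)] <;> aesop
  · ext i j
    simp [Matrix.mul_apply, Matrix.one_apply]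
  · ext i j
    simp [greidx, Matrix.mul_apply, Matrix.one_apply]
  · ext i j
    simp [greidx, Matrix.mul_apply, Matrix.one_apply]

theorem GCong.gsum {P : GP ι ι} {P' : GP ι' ι'} {Q : GP κ κ} {Q' : GP κ' κ'}
    (h : GCong P Q) (h' : GCong P' Q') : GCong (gsum P P') (gsum Q Q') := by
  obtain ⟨S, T, h1, h2, h3, h4⟩ := h
  obtain ⟨S', T', h1', h2', h3', h4'⟩ := h'
  refine ⟨fromBlocks S 0 0 S', fromBlocks T 0 0 T', ?_, ?_, ?_, ?_⟩ <;>
    simp [_root_.gsum, fromBlocks_multiply, fromBlocks_transpose, *]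

theorem GDeg.gsum_left {P : GP ι ι} {Q : GP κ κ} (R : GP τ τ) (h : GDeg P Q) :
    GDeg (gsum P R) (gsum Q R) := by
  have hc : Continuous fun Q' : GP κ κ => _root_.gsum Q' R := by
    unfold _root_.gsum
    refine Continuous.prodMk ?_ ?_ <;>
    exact Continuous.matrix_fromBlocks (by fun_prop) (by fun_prop) (by fun_prop) (by fun_prop)
  refine map_mem_closure (f := fun Q' : GP κ κ => _root_.gsum Q' R) hc h ?_
  intro Q' hQ'
  exact GCong.gsum hQ' (GCong.refl R)

theorem REq.sk {X : GP κ ι} {Y : GP κ' ι'} (h : REq X Y) : GCong (sk X) (sk Y) := by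
  obtain ⟨S, S', R, R', h1, h2, h3, h4, h5, h6⟩ := h
  have h1' : S'ᵀ * Sᵀ = 1 := by rw [← transpose_mul, h1, transpose_one]
  have h2' : Sᵀ * S'ᵀ = 1 := by rw [← transpose_mul, h2, transpose_one]
  refine ⟨fromBlocks Sᵀ 0 0 R, fromBlocks S'ᵀ 0 0 R', ?_, ?_, ?_, ?_⟩
  · simp [fromBlocks_multiply, *]
  · simp [fromBlocks_multiply, *]
  · simp [_root_.sk, fromBlocks_multiply, fromBlocks_transpose, ← h5, Matrix.mul_assoc]
  · simp [_root_.sk, fromBlocks_multiply, fromBlocks_transpose, ← h6, Matrix.mul_assoc]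

theorem RDeg.sk {X : GP κ ι} {Y : GP κ' ι'} (h : RDeg X Y) : GDeg (sk X) (sk Y) := by
  have hc : Continuous fun Q' : GP κ' ι' => _root_.sk Q' := by
    unfold _root_.sk
    refine Continuous.prodMk ?_ ?_ <;>
    exact Continuous.matrix_fromBlocks (by fun_prop) (by fun_prop) (by fun_prop) (by fun_prop)
  refine map_mem_closure hc h ?_
  intro Q' hQ'
  exact REq.sk hQ'

theorem sk_gsum (X : GP κ ι) (Y : GP κ' ι') : GCong (sk (gsum X Y)) (gsum (sk X) (sk Y)) := by
  have h := greidx_cong (Equiv.sumSumSumComm κ ι κ' ι') (sk (gsum X Y))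
  convert h using 1
  refine Prod.ext ?_ ?_ <;>
  · ext i j
    rcases i with (i | i) | (i | i) <;> rcases j with (j | j) | (j | j) <;>
      simp [greidx, gsum, sk]

theorem sk_transpose (X : GP κ ι) : GCong (sk X) (sk ((X.1ᵀ, X.2ᵀ) : GP ι κ)) := by
  refine ⟨fromBlocks 0 1 (-1) 0, fromBlocks 0 (-1) 1 0, ?_, ?_, ?_, ?_⟩ <;>
    simp [sk, fromBlocks_multiply, fromBlocks_transpose]

theorem gsum_comm (P : GP ι ι) (Q : GP κ κ) : GCong (gsum P Q) (gsum Q P) := by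
  convert greidx_cong (Equiv.sumComm κ ι) (gsum P Q) using 1
  refine Prod.ext ?_ ?_ <;>
  · ext i j
    rcases i with i | i <;> rcases j with j | j <;> simp [greidx, gsum]

theorem gsum_assoc (P : GP ι ι) (Q : GP κ κ) (R : GP τ τ) :
    GCong (gsum (gsum P Q) R) (gsum P (gsum Q R)) := by
  convert greidx_cong (Equiv.sumAssoc ι κ τ).symm (gsum (gsum P Q) R) using 1
  refine Prod.ext ?_ ?_ <;>
  · ext i j
    rcases i with i | (i | i) <;> rcases j with j | (j | j) <;> simp [greidx, gsum]

theorem gsum_empty_left [IsEmpty ι] (P : GP ι ι) (Q : GP κ κ) : GCong (gsum P Q) Q := by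
  have h := greidx_cong (Equiv.emptySum ι κ).symm (gsum P Q)
  convert h using 1
  refine Prod.ext ?_ ?_ <;>
  · ext i j
    simp [greidx, gsum]

theorem GCong.card_eq {P : GP ι ι} {Q : GP κ κ} (h : GCong P Q) :
    Fintype.card ι = Fintype.card κ := by
  obtain ⟨S, T, h1, h2, -, -⟩ := h
  have h3 := congrArg Matrix.trace h1
  rw [Matrix.trace_mul_comm, h2, Matrix.trace_one, Matrix.trace_one] at h3
  exact_mod_cast h3.symm

end GenericPencils

theorem gcong_iff_congruent {n : ℕ} (P Q : Pencil n n) : GCong P Q ↔ Pencil.Congruent P Q := by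
  constructor
  · rintro ⟨S, T, h1, h2, h3, h4⟩
    exact ⟨S, ⟨⟨S, T, h1, h2⟩, rfl⟩, h3, h4⟩
  · rintro ⟨S, ⟨⟨S', T, h1, h2⟩, rfl⟩, h3, h4⟩
    exact ⟨S', T, h1, h2, h3, h4⟩

theorem orbC_subset_closure_iff {n : ℕ} (P Q : Pencil n n) :
    Pencil.orbC Q ⊆ closure (Pencil.orbC P) ↔ GDeg P Q := by
  have e : ∀ P : Pencil n n, Pencil.orbC P = {Q' | GCong P Q'} := by
    intro P; ext Q'; exact (gcong_iff_congruent P Q').symm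
  constructor
  · intro h
    have := h (show Q ∈ Pencil.orbC Q by rw [e]; exact GCong.refl Q)
    rwa [e] at this
  · intro h Q' hQ'
    rw [e] at hQ' ⊢
    exact GDeg.trans_cong h (hQ' : _)

/-- The pencil of a list of blocks, on its own index type. -/
abbrev sp (l : List SBlock) : GP (Fin (sizeSum l)) (Fin (sizeSum l)) := spencilOfList l

theorem dsum_cong {m p : ℕ} (P : Pencil m m) (Q : Pencil p p) :
    GCong (Pencil.dsum P Q) (gsum P Q) := by
  have h := greidx_cong (finSumFinEquiv (m := m) (n := p)).symm (gsum P Q)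
  exact h.symm

theorem cast_cong {m n : ℕ} (h : m = n) (P : Pencil m m) : GCong P (Pencil.cast h h P) :=
  greidx_cong (finCongr h.symm) P

theorem sp_cons (b : SBlock) (l : List SBlock) :
    GCong (sp (b :: l)) (gsum b.toPencil (sp l)) := dsum_cong _ _

theorem sp_append (l l' : List SBlock) : GCong (sp (l ++ l')) (gsum (sp l) (sp l')) := by
  induction l with
  | nil => exact (gsum_empty_left (ι := Fin 0) _ _).symm
  | cons b l ih =>
    refine (sp_cons b (l ++ l')).trans ?_
    refine ((GCong.refl _).gsum ih).trans ?_
    refine (gsum_assoc _ _ _).symm.trans ?_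
    exact (sp_cons b l).symm.gsum (GCong.refl _)

theorem sp_perm {l l' : List SBlock} (h : l.Perm l') : GCong (sp l) (sp l') := by
  induction h with
  | nil => exact GCong.refl _
  | cons b _ ih =>
    exact (sp_cons b _).trans (((GCong.refl _).gsum ih).trans (sp_cons b _).symm)
  | swap a b l =>
    refine (sp_cons _ _).trans (((GCong.refl _).gsum (sp_cons _ _)).trans ?_)
    refine (gsum_assoc _ _ _).symm.trans ?_
    refine ((gsum_comm _ _).gsum (GCong.refl _)).trans ?_
    refine (gsum_assoc _ _ _).trans ?_
    exact ((GCong.refl _).gsum (sp_cons _ _).symm).trans (sp_cons _ _).symm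
  | trans _ _ ih ih' => exact ih.trans ih'

theorem sp_filter_valid (l : List SBlock) : GCong (sp l) (sp (l.filter fun b => b.valid)) := by
  induction l with
  | nil => exact GCong.refl _
  | cons b l ih =>
    by_cases hb : b.valid
    · rw [List.filter_cons_of_pos (by simpa using hb)]
      exact (sp_cons b _).trans (((GCong.refl _).gsum ih).trans (sp_cons b _).symm)
    · rw [List.filter_cons_of_neg (by simpa using hb)]
      refine (sp_cons b _).trans (GCong.trans ?_ ih)
      have : b.size = 0 := by
        cases b <;> simp [SBlock.valid] at hb <;> simp [SBlock.size, hb]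
      have : IsEmpty (Fin b.size) := by rw [this]; infer_instance
      exact gsum_empty_left _ _

theorem weakRepresentsC_iff {n : ℕ} (P : Pencil n n) (s : Multiset SBlock) :
    WeakRepresentsC P s ↔ ∃ l : List SBlock, (l : Multiset SBlock) = s ∧ GCong (sp l) P := by
  constructor
  · rintro ⟨l, h, hs, hc⟩
    exact ⟨l, hs, (cast_cong h _).trans ((gcong_iff_congruent _ _).2 hc)⟩
  · rintro ⟨l, hs, hc⟩
    have h : sizeSum l = n := by simpa using hc.card_eq
    exact ⟨l, h, hs, (gcong_iff_congruent _ _).1 ((cast_cong h _).symm.trans hc)⟩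

/-- The rectangular pencil `X` for which a block is `[[0, X], [-Xᵀ, 0]]`. -/
theorem Hblk_cong (h : ℕ) (μ : ℂ) : GCong (Hblk h μ) (sk (Eblk h μ)) := by
  have h := greidx_cong (finSumFinEquiv (m := h) (n := h)).symm (sk (Eblk h μ))
  exact h.symm

theorem Kblk_cong (h : ℕ) : GCong (Kblk h) (sk (EInfblk h)) := by
  have h := greidx_cong (finSumFinEquiv (m := h) (n := h)).symm (sk (EInfblk h))
  exact h.symm

theorem Mblk_cong (m : ℕ) : GCong (Mblk m) (sk (Lblk m)) := by
  have h := greidx_cong (finSumFinEquiv (m := m) (n := m + 1)).symm (sk (Lblk m))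
  exact h.symm

theorem sp_deg_append {l₁ l₂ : List SBlock} (l : List SBlock) (h : GDeg (sp l₁) (sp l₂)) :
    GDeg (sp (l₁ ++ l)) (sp (l₂ ++ l)) :=
  (sp_append l₁ l).trans_deg ((h.gsum_left (sp l)).trans_cong (sp_append l₂ l).symm)

theorem sp_pair (a b : SBlock) : GCong (sp [a, b]) (gsum a.toPencil b.toPencil) := by
  refine (sp_cons _ _).trans ((GCong.refl _).gsum ?_)
  refine (sp_cons _ _).trans ((gsum_comm _ _).trans ?_)
  exact gsum_empty_left (ι := Fin 0) _ _

section CanonicalForm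

/-- The Gram pencil of a family of vectors with respect to two bilinear forms. -/
def gramP {V κ : Type} [AddCommGroup V] [Module ℂ V] (A B : V →ₗ[ℂ] V →ₗ[ℂ] ℂ) (e : κ → V) :
    GP κ κ :=
  (Matrix.of fun i j => A (e i) (e j), Matrix.of fun i j => B (e i) (e j))

variable {V : Type} [AddCommGroup V] [Module ℂ V] {A B : V →ₗ[ℂ] V →ₗ[ℂ] ℂ}

theorem alt_neg (hA : ∀ v, A v v = 0) (v w : V) : A v w = -A w v := by
  have h := hA (v + w)
  simp only [map_add, LinearMap.add_apply, hA, zero_add, add_zero] at h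
  exact eq_neg_of_add_eq_zero_right h

theorem gramP_cong {ι κ : Type} [Fintype ι] [Fintype κ] [DecidableEq ι]
    [DecidableEq κ] (b : Module.Basis ι ℂ V)
    (b' : Module.Basis κ ℂ V) : GCong (gramP A B b) (gramP A B b') := by
  have key : ∀ C : V →ₗ[ℂ] V →ₗ[ℂ] ℂ, (b.toMatrix b')ᵀ * (Matrix.of fun i j => C (b i) (b j)) *
      b.toMatrix b' = Matrix.of fun i j => C (b' i) (b' j) := by
    intro C
    ext i j
    have hi := b.sum_toMatrix_smul_self b' i
    have hj := b.sum_toMatrix_smul_self b' j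
    simp only [of_apply]
    rw [← hi, ← hj]
    simp only [map_sum, LinearMap.sum_apply, map_smul, LinearMap.smul_apply, mul_apply,
      transpose_apply, of_apply, smul_eq_mul, Finset.sum_mul, Finset.mul_sum]
    refine Finset.sum_congr rfl fun k _ => Finset.sum_congr rfl fun k' _ => ?_
    ring
  exact ⟨b.toMatrix b', b'.toMatrix b, by simp, by simp, key A, key B⟩

/-- The forms `A`, `B` admit a canonical basis. -/
def HasCanon {V : Type} [AddCommGroup V] [Module ℂ V] (A B : V →ₗ[ℂ] V →ₗ[ℂ] ℂ) : Prop :=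
  ∃ l : List SBlock, (∀ b ∈ l, b.valid) ∧ ∃ (n : ℕ) (b : Module.Basis (Fin n) ℂ V),
    GCong (sp l) (gramP A B b)

theorem gramP_split {ι κ τ : Type} [Fintype ι] [Fintype κ] [Fintype τ] [DecidableEq κ]
    [DecidableEq τ] [DecidableEq ι] (hA : ∀ v, A v v = 0) (hB : ∀ v, B v v = 0) (e : κ → V) (φ : κ → V →ₗ[ℂ] ℂ)
    (hφ : ∀ i j, φ i (e j) = if i = j then 1 else 0)
    (W : Submodule ℂ V) (hW : ∀ v, v ∈ W ↔ ∀ i, φ i v = 0)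
    (hAe : ∀ i, ∀ v ∈ W, A (e i) v = 0) (hBe : ∀ i, ∀ v ∈ W, B (e i) v = 0)
    (b : Module.Basis ι ℂ V) (bW : Module.Basis τ ℂ W) :
    GCong (gramP A B b)
      (gsum (gramP A B e) (gramP (A.domRestrict₁₂ W W) (B.domRestrict₁₂ W W) bW)) := by
  have hsum : ∀ (c : κ → ℂ) i, φ i (∑ j, c j • e j) = c i := by
    intro c i
    simp [map_sum, hφ]
  have hli : LinearIndependent ℂ (Sum.elim e fun i => (bW i : V)) := by
    rw [Fintype.linearIndependent_iff]
    intro g hg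
    rw [Fintype.sum_sum_type] at hg
    simp only [Sum.elim_inl, Sum.elim_inr] at hg
    have hw : (∑ x, g (Sum.inr x) • (bW x : V)) ∈ W :=
      Submodule.sum_mem _ fun i _ => Submodule.smul_mem _ _ (bW i).2
    have h1 : ∀ i, g (Sum.inl i) = 0 := by
      intro i
      have := congrArg (φ i) hg
      rw [map_add, hsum, (hW _).1 hw i, add_zero, map_zero] at this
      exact this
    have h2 : ∑ x, g (Sum.inr x) • bW x = 0 := by
      apply Subtype.ext
      simpa [h1] using hg
    have h3 := (Fintype.linearIndependent_iff.1 bW.linearIndependent) _ h2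
    rintro (i | i)
    · exact h1 i
    · exact h3 i
  have hsp : ⊤ ≤ Submodule.span ℂ (Set.range (Sum.elim e fun i => (bW i : V))) := by
    intro v _
    have hv : v - ∑ j, φ j v • e j ∈ W := by
      rw [hW]; intro i; rw [map_sub, hsum, sub_self]
    have h1 : (∑ j, φ j v • e j) ∈ Submodule.span ℂ (Set.range (Sum.elim e fun i => (bW i : V))) :=
      Submodule.sum_mem _ fun i _ => Submodule.smul_mem _ _
        (Submodule.subset_span ⟨Sum.inl i, rfl⟩)
    have h2 : v - ∑ j, φ j v • e j ∈
        Submodule.span ℂ (Set.range (Sum.elim e fun i => (bW i : V))) := by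
      have := bW.sum_repr ⟨_, hv⟩
      have h3 := congrArg Subtype.val this
      simp only at h3
      rw [← h3]
      rw [Submodule.coe_sum]
      exact Submodule.sum_mem _ fun i _ => Submodule.smul_mem _ _
        (Submodule.subset_span ⟨Sum.inr i, rfl⟩)
    have := add_mem h2 h1
    simpa using this
  have h := gramP_cong (A := A) (B := B) b (Module.Basis.mk hli hsp)
  have e1 : ∀ i (w : W), A w (e i) = 0 := fun i w => by rw [alt_neg hA, hAe i w w.2, neg_zero]
  have e2 : ∀ i (w : W), B w (e i) = 0 := fun i w => by rw [alt_neg hB, hBe i w w.2, neg_zero]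
  convert h using 1
  refine Prod.ext ?_ ?_ <;>
  · ext i j
    rcases i with i | i <;> rcases j with j | j <;>
      simp [gramP, gsum, hAe _ _ (bW _).2, hBe _ _ (bW _).2, e1, e2, LinearMap.domRestrict₁₂_apply]

theorem hasCanon_of_split [FiniteDimensional ℂ V] {κ : Type} [Fintype κ] [DecidableEq κ]
    [Nonempty κ]
    (hA : ∀ v, A v v = 0) (hB : ∀ v, B v v = 0)
    (IH : ∀ W : Submodule ℂ V, Module.finrank ℂ W < Module.finrank ℂ V →
      HasCanon (A.domRestrict₁₂ W W) (B.domRestrict₁₂ W W))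
    (e : κ → V) (φ : κ → V →ₗ[ℂ] ℂ)
    (hφ : ∀ i j, φ i (e j) = if i = j then 1 else 0)
    (hAe : ∀ i v, (∀ j, φ j v = 0) → A (e i) v = 0)
    (hBe : ∀ i v, (∀ j, φ j v = 0) → B (e i) v = 0)
    (s : SBlock) (hs : s.valid) (hG : GCong s.toPencil (gramP A B e)) : HasCanon A B := by
  let W : Submodule ℂ V := ⨅ i, LinearMap.ker (φ i)
  have hW : ∀ v, v ∈ W ↔ ∀ i, φ i v = 0 := by
    intro v; simp [W]
  have hlt : Module.finrank ℂ W < Module.finrank ℂ V := by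
    apply Submodule.finrank_lt
    intro h
    obtain ⟨i⟩ := ‹Nonempty κ›
    have : e i ∈ W := by rw [h]; trivial
    have := (hW _).1 this i
    simp [hφ] at this
  obtain ⟨l, hl, n, b, hb⟩ := IH W hlt
  refine ⟨s :: l, ?_, _, Module.finBasis ℂ V, ?_⟩
  · intro b hb
    rcases List.mem_cons.1 hb with rfl | hb
    · exact hs
    · exact hl _ hb
  · refine (sp_cons _ _).trans (GCong.trans ?_ (gramP_split hA hB e φ hφ W hW
      (fun i v hv => hAe i v ((hW v).1 hv)) (fun i v hv => hBe i v ((hW v).1 hv)) _ b).symm)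
    exact hG.gsum hb

theorem hasCanon_of_isEmpty [Subsingleton V] : HasCanon A B := by
  refine ⟨[], by simp, 0, Module.Basis.empty V, ?_⟩
  have e : (sp [] : GP (Fin 0) (Fin 0)) = gramP A B (Module.Basis.empty (ι := Fin 0) (R := ℂ) V) :=
    Prod.ext (by ext i; exact i.elim0) (by ext i; exact i.elim0)
  rw [← e]
  exact GCong.refl (sp [])

end CanonicalForm

section CyclicBlocks

variable {V : Type} [AddCommGroup V] [Module ℂ V] {D E : V →ₗ[ℂ] V →ₗ[ℂ] ℂ}

theorem selfAdj_pow {N : V →ₗ[ℂ] V} (hN : ∀ v w, D (N v) w = D v (N w)) (k : ℕ) (v w : V) :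
    D ((N ^ k) v) w = D v ((N ^ k) w) := by
  induction k generalizing v w with
  | zero => simp
  | succ k ih => rw [pow_succ', Module.End.mul_apply, hN, ih, ← Module.End.mul_apply, ← pow_succ, ← pow_succ']

theorem selfAdj_pow_alt (hD : ∀ v, D v v = 0) {N : V →ₗ[ℂ] V}
    (hN : ∀ v w, D (N v) w = D v (N w)) (k : ℕ) (v : V) : D ((N ^ k) v) v = 0 := by
  have h1 := selfAdj_pow hN k v v
  have h2 := alt_neg hD ((N ^ k) v) v
  rw [← h1] at h2
  exact self_eq_neg.1 h2

theorem exists_dual_cyclic {N : V →ₗ[ℂ] V} (hN : ∀ v w, D (N v) w = D v (N w)) {h : ℕ}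
    {K : Submodule ℂ V} (hKN : ∀ v ∈ K, N v ∈ K) (hK : ∀ v ∈ K, (N ^ h) v = 0)
    {x y : V} (hx : x ∈ K) (hy : y ∈ K)
    (hxy : D ((N ^ (h - 1)) x) y ≠ 0) (k : ℕ) (hk : k + 1 ≤ h) :
    ∃ z ∈ K, ∀ i ≤ k, D ((N ^ (h - 1 - i)) x) z = if i = 0 then 1 else 0 := by
  induction k with
  | zero =>
    refine ⟨(D ((N ^ (h - 1)) x) y)⁻¹ • y, K.smul_mem _ hy, ?_⟩
    intro i hi
    obtain rfl : i = 0 := by omega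
    simp [inv_mul_cancel₀ hxy]
  | succ k ih =>
    obtain ⟨z, hz, hzi⟩ := ih (by omega)
    refine ⟨z - D ((N ^ (h - 1 - (k + 1))) x) z • (N ^ (k + 1)) z, ?_, ?_⟩
    · have hpow : ∀ i, (N ^ i) z ∈ K := by
        intro i
        induction i with
        | zero => simpa using hz
        | succ i ihi => rw [pow_succ', Module.End.mul_apply]; exact hKN _ ihi
      exact K.sub_mem hz (K.smul_mem _ (hpow _))
    · intro i hi
      have hcomp : ∀ i, i ≤ k + 1 → D ((N ^ (h - 1 - i)) x) ((N ^ (k + 1)) z) =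
          if i = k + 1 then 1 else 0 := by
        intro i hi
        rw [← selfAdj_pow hN, ← Module.End.mul_apply, ← pow_add]
        split_ifs with hik
        · have : k + 1 + (h - 1 - i) = h - 1 - 0 := by omega
          rw [this, hzi 0 (by omega)]; simp
        · have : k + 1 + (h - 1 - i) = (k - i) + h := by omega
          rw [this, pow_add, Module.End.mul_apply, hK x hx]; simp
      rw [map_sub, map_smul, hcomp i hi]
      by_cases hik : i = k + 1
      · subst hik; simp
      · rw [hzi i (by omega)]; simp [hik]

theorem exists_cyclic_block (hD : ∀ v, D v v = 0)
    {N : V →ₗ[ℂ] V} (hN : ∀ v w, D (N v) w = D v (N w)) {h : ℕ} (h1 : 1 ≤ h)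
    {K : Submodule ℂ V} (hKN : ∀ v ∈ K, N v ∈ K) (hK : ∀ v ∈ K, (N ^ h) v = 0)
    {x y : V} (hxK : x ∈ K) (hyK : y ∈ K)
    (hxy : D ((N ^ (h - 1)) x) y ≠ 0) {μ : ℂ}
    (hE : ∀ v w, v ∈ K → E v w = μ * D v w + D (N v) w) :
    ∃ (e : Fin h ⊕ Fin h → V) (φ : Fin h ⊕ Fin h → V →ₗ[ℂ] ℂ),
      (∀ i j, φ i (e j) = if i = j then 1 else 0) ∧
      (∀ i v, (∀ j, φ j v = 0) → D (e i) v = 0) ∧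
      (∀ i v, (∀ j, φ j v = 0) → E (e i) v = 0) ∧
      (∀ i j, D (e i) (e j) = (fromBlocks 0 1 (-1) 0 : Matrix (Fin h ⊕ Fin h) _ ℂ) i j) ∧
      (∀ i j, E (e i) (e j) =
        (fromBlocks 0 (Jmat h μ) (-(Jmat h μ)ᵀ) 0 : Matrix (Fin h ⊕ Fin h) _ ℂ) i j) := by
  obtain ⟨z, hzK, hzi⟩ := exists_dual_cyclic hN hKN hK hxK hyK hxy (h - 1) (by omega)
  have hx := hK x hxK
  have hz := hK z hzK
  have hxz : ∀ i j, D ((N ^ i) x) ((N ^ j) z) = if i + j = h - 1 then 1 else 0 := by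
    intro i j
    rw [← selfAdj_pow hN, ← Module.End.mul_apply, ← pow_add]
    by_cases hij : i + j < h
    · have := hzi (h - 1 - (i + j)) (by omega)
      have e1 : h - 1 - (h - 1 - (i + j)) = j + i := by omega
      rw [e1] at this
      rw [this]
      split_ifs <;> first | rfl | omega
    · have e1 : j + i = (j + i - h) + h := by omega
      rw [e1, pow_add, Module.End.mul_apply, hx, if_neg (by omega)]; simp
  have hzx : ∀ i j, D ((N ^ j) z) ((N ^ i) x) = if i + j = h - 1 then -1 else 0 := by
    intro i j
    rw [alt_neg hD, hxz]; split_ifs <;> simp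
  have hself : ∀ (u : V) i j, D ((N ^ i) u) ((N ^ j) u) = 0 := by
    intro u i j
    rw [← selfAdj_pow hN, ← Module.End.mul_apply, ← pow_add, selfAdj_pow_alt hD hN]
  have hker : ∀ (u : V) i, u ∈ K → (N ^ i) u ∈ K := by
    intro u i hu
    induction i with
    | zero => simpa using hu
    | succ i ihi => rw [pow_succ', Module.End.mul_apply]; exact hKN _ ihi
  have hNs : ∀ (u : V) i, N ((N ^ i) u) = (N ^ (i + 1)) u := by
    intro u i
    rw [pow_succ', Module.End.mul_apply]
  have hz0 : ∀ v, (∀ i : Fin h, D ((N ^ (i : ℕ)) x) v = 0) → ∀ i, D ((N ^ i) x) v = 0 := by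
    intro v hv i
    by_cases hi : i < h
    · exact hv ⟨i, hi⟩
    · have e1 : i = (i - h) + h := by omega
      rw [e1, pow_add, Module.End.mul_apply, hx]; simp
  have hw0 : ∀ v, (∀ j : Fin h, D v ((N ^ (h - 1 - (j : ℕ))) z) = 0) →
      ∀ i, D ((N ^ i) z) v = 0 := by
    intro v hv i
    by_cases hi : i < h
    · have := hv ⟨h - 1 - i, by omega⟩
      have e1 : h - 1 - (h - 1 - i) = i := by omega
      simp only [e1] at this
      rw [alt_neg hD, this, neg_zero]
    · have e1 : i = (i - h) + h := by omega
      rw [e1, pow_add, Module.End.mul_apply, hz]; simp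
  refine ⟨Sum.elim (fun i => (N ^ (i : ℕ)) x) (fun j => (N ^ (h - 1 - (j : ℕ))) z),
    Sum.elim (fun i => D.flip ((N ^ (h - 1 - (i : ℕ))) z)) (fun j => D ((N ^ (j : ℕ)) x)),
    ?_, ?_, ?_, ?_, ?_⟩
  · rintro (i | i) (j | j)
    · simp only [Sum.elim_inl, LinearMap.flip_apply, hxz, Sum.inl.injEq, Fin.ext_iff]
      split_ifs <;> first | rfl | omega
    · simp [hself]
    · simp [hself]
    · simp only [Sum.elim_inr, hxz, Sum.inr.injEq, Fin.ext_iff]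
      split_ifs <;> first | rfl | omega
  · intro i v hv
    have hv1 := hz0 v fun i => hv (Sum.inr i)
    have hv2 := hw0 v fun i => hv (Sum.inl i)
    rcases i with i | i
    · exact hv1 _
    · exact hv2 _
  · intro i v hv
    have hv1 := hz0 v fun i => hv (Sum.inr i)
    have hv2 := hw0 v fun i => hv (Sum.inl i)
    rcases i with i | i
    · simp only [Sum.elim_inl]
      rw [hE _ _ (hker _ _ hxK), hNs, hv1, hv1]; simp
    · simp only [Sum.elim_inr]
      rw [hE _ _ (hker _ _ hzK), hNs, hv2, hv2]; simp
  · rintro (i | i) (j | j)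
    · simp [hself]
    · simp only [Sum.elim_inl, Sum.elim_inr, hxz, fromBlocks_apply₁₂, Matrix.one_apply, Fin.ext_iff]
      split_ifs <;> first | rfl | omega
    · simp only [Sum.elim_inl, Sum.elim_inr, hzx, fromBlocks_apply₂₁, Matrix.neg_apply,
        Matrix.one_apply, Fin.ext_iff]
      split_ifs <;> first | rfl | omega | simp
    · simp [hself]
  · rintro (i | i) (j | j)
    · simp only [Sum.elim_inl]
      rw [hE _ _ (hker _ _ hxK), hNs, hself, hself]; simp
    · simp only [Sum.elim_inl, Sum.elim_inr]
      rw [hE _ _ (hker _ _ hxK), hNs, hxz, hxz]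
      have e1 : (i : ℕ) + (h - 1 - (j : ℕ)) = h - 1 ↔ (j : ℕ) = i := by omega
      have e2 : (i : ℕ) + 1 + (h - 1 - (j : ℕ)) = h - 1 ↔ (j : ℕ) = i + 1 := by omega
      simp only [e1, e2, fromBlocks_apply₁₂, Jmat, of_apply]
      split_ifs <;> first | omega | simp
    · simp only [Sum.elim_inl, Sum.elim_inr]
      rw [hE _ _ (hker _ _ hzK), hNs, hzx, hzx]
      have e1 : (j : ℕ) + (h - 1 - (i : ℕ)) = h - 1 ↔ (i : ℕ) = j := by omega
      have e2 : (j : ℕ) + (h - 1 - (i : ℕ) + 1) = h - 1 ↔ (i : ℕ) = j + 1 := by omega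
      simp only [e1, e2, fromBlocks_apply₂₁, Jmat, of_apply, Matrix.neg_apply, transpose_apply]
      split_ifs <;> first | omega | simp
    · simp only [Sum.elim_inr]
      rw [hE _ _ (hker _ _ hzK), hNs, hself, hself]; simp

/-- For a self-adjoint operator with nontrivial kernel there is a Jordan chain of maximal length
at zero which pairs nontrivially with the generalized kernel. -/
theorem exists_top_pair [FiniteDimensional ℂ V]
    (hnd : ∀ v, (∀ w, D v w = 0) → v = 0)
    {N : V →ₗ[ℂ] V} (hN : ∀ v w, D (N v) w = D v (N w)) (hk : ∃ v, v ≠ 0 ∧ N v = 0) :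
    ∃ (h : ℕ) (x y : V), 1 ≤ h ∧ (N ^ h) x = 0 ∧ (N ^ h) y = 0 ∧ D ((N ^ (h - 1)) x) y ≠ 0 := by
  have hex : ∃ m : ℕ, ∀ v, (N ^ (m + 1)) v = 0 → (N ^ m) v = 0 := by
    obtain ⟨m, hm⟩ := (monotone_stabilizes_iff_noetherian (R := ℂ) (M := V)).2 inferInstance
      ⟨fun k => LinearMap.ker (N ^ k), N.iterateKer.monotone⟩
    refine ⟨m, fun v hv => ?_⟩
    have : v ∈ LinearMap.ker (N ^ (m + 1)) := hv
    have h2 := hm (m + 1) (by omega)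
    change LinearMap.ker (N ^ m) = LinearMap.ker (N ^ (m + 1)) at h2
    rw [← h2] at this
    exact this
  have hspec := Nat.find_spec hex
  have hmin := fun k => Nat.find_min (m := k) hex
  set h := Nat.find hex with hh
  have h1 : 1 ≤ h := by
    by_contra hlt
    have h0 : h = 0 := by omega
    obtain ⟨v, hv, hNv⟩ := hk
    rw [h0] at hspec
    exact hv (by simpa using hspec v (by simpa using hNv))
  have hx := hmin (h - 1) (by omega)
  push Not at hx
  obtain ⟨x, hx, hx'⟩ := hx
  rw [Nat.sub_add_cancel h1] at hx
  have hiter : ∀ k v, (N ^ (h + k)) v = 0 → (N ^ h) v = 0 := by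
    intro k
    induction k with
    | zero => intro v hv; exact hv
    | succ k ih =>
      intro v hv
      refine ih v ?_
      have e1 : h + (k + 1) = (h + 1) + k := by ring
      rw [e1, pow_add, Module.End.mul_apply] at hv
      have := hspec _ hv
      rwa [← Module.End.mul_apply, ← pow_add] at this
  have hdisj : Disjoint (LinearMap.ker (N ^ h)) (LinearMap.range (N ^ h)) := by
    rw [Submodule.disjoint_def]
    rintro v hv ⟨u, rfl⟩
    refine hiter h u ?_
    rw [pow_add, Module.End.mul_apply]; exact hv
  have htop : LinearMap.ker (N ^ h) ⊔ LinearMap.range (N ^ h) = ⊤ := by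
    apply Submodule.eq_top_of_disjoint _ _ _ hdisj
    rw [add_comm, LinearMap.finrank_range_add_finrank_ker]
  by_contra hcon
  push Not at hcon
  apply hx'
  apply hnd
  intro w
  have hw : w ∈ LinearMap.ker (N ^ h) ⊔ LinearMap.range (N ^ h) := by rw [htop]; trivial
  obtain ⟨y, hy, r, ⟨u, rfl⟩, rfl⟩ := Submodule.mem_sup.1 hw
  rw [map_add, hcon h x y h1 hx hy, zero_add, ← selfAdj_pow hN, ← Module.End.mul_apply, ← pow_add]
  have e1 : h + (h - 1) = (h - 1) + h := by omega
  rw [e1, pow_add, Module.End.mul_apply, hx]; simp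

end CyclicBlocks

section RegularPart

variable {V : Type} [AddCommGroup V] [Module ℂ V] {A B : V →ₗ[ℂ] V →ₗ[ℂ] ℂ}

theorem exists_operator [FiniteDimensional ℂ V] {D E : V →ₗ[ℂ] V →ₗ[ℂ] ℂ}
    (hD : ∀ v, D v v = 0) (hE : ∀ v, E v v = 0)
    (hnd : ∀ v, (∀ w, D v w = 0) → v = 0) :
    ∃ T : V →ₗ[ℂ] V, (∀ v w, D (T v) w = E v w) ∧ ∀ v w, D (T v) w = D v (T w) := by
  have hinj : Function.Injective (D : V →ₗ[ℂ] Module.Dual ℂ V) := by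
    rw [injective_iff_map_eq_zero]
    intro v hv
    exact hnd v fun w => by rw [hv]; rfl
  let e := LinearMap.linearEquivOfInjective (D : V →ₗ[ℂ] Module.Dual ℂ V) hinj
    (Subspace.dual_finrank_eq (K := ℂ) (V := V)).symm
  have h1 : ∀ v w, D (e.symm (E v)) w = E v w := by
    intro v w
    have : e (e.symm (E v)) = E v := e.apply_symm_apply _
    rw [LinearMap.linearEquivOfInjective_apply] at this
    rw [this]
  refine ⟨e.symm.toLinearMap ∘ₗ E, h1, ?_⟩
  intro v w
  change D (e.symm (E v)) w = D v (e.symm (E w))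
  rw [h1, alt_neg hD, h1, alt_neg hE]

theorem hasCanon_of_nondegenerate [FiniteDimensional ℂ V] [Nontrivial V]
    (hA : ∀ v, A v v = 0) (hB : ∀ v, B v v = 0)
    (IH : ∀ W : Submodule ℂ V, Module.finrank ℂ W < Module.finrank ℂ V →
      HasCanon (A.domRestrict₁₂ W W) (B.domRestrict₁₂ W W))
    (hnd : ∀ v, (∀ w, B v w = 0) → v = 0) : HasCanon A B := by
  obtain ⟨T, hT, hTs⟩ := exists_operator hB hA hnd
  obtain ⟨μ, hμ⟩ := Module.End.exists_eigenvalue T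
  obtain ⟨u, hu⟩ := hμ.exists_hasEigenvector
  have hu1 : T u = μ • u := hu.apply_eq_smul
  let N : V →ₗ[ℂ] V := T - μ • LinearMap.id
  have hNa : ∀ v, N v = T v - μ • v := fun v => rfl
  have hN : ∀ v w, B (N v) w = B v (N w) := by
    intro v w
    simp only [hNa, map_sub, LinearMap.sub_apply, hTs, map_smul, LinearMap.smul_apply]
  obtain ⟨h, x, y, h1, hx, hy, hxy⟩ := exists_top_pair hnd hN ⟨u, hu.2, by rw [hNa, hu1, sub_self]⟩
  obtain ⟨e, φ, hφ, hDe, hEe, hD, hE⟩ := exists_cyclic_block (E := A) (μ := μ) hB hN h1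
    (K := LinearMap.ker (N ^ h))
    (fun v hv => by
      rw [LinearMap.mem_ker] at hv ⊢
      rw [← Module.End.mul_apply, ← pow_succ, pow_succ', Module.End.mul_apply, hv, map_zero])
    (fun v hv => hv) hx hy hxy
    (fun v w _ => by
      rw [hNa, map_sub, LinearMap.sub_apply, hT, map_smul, LinearMap.smul_apply, smul_eq_mul]
      ring)
  have : Nonempty (Fin h) := ⟨⟨0, h1⟩⟩
  refine hasCanon_of_split hA hB IH e φ hφ hEe hDe (SBlock.H h μ) h1 ?_
  refine (Hblk_cong h μ).trans ?_
  have : sk (Eblk h μ) = gramP A B e := by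
    refine Prod.ext ?_ ?_
    · ext i j; exact (hE i j).symm
    · ext i j
      have := hD i j
      simp only [sk, Eblk, gramP, of_apply, this, transpose_one]
  rw [this]
  exact GCong.refl _

theorem hasCanon_of_regular [FiniteDimensional ℂ V]
    (hA : ∀ v, A v v = 0) (hB : ∀ v, B v v = 0)
    (IH : ∀ W : Submodule ℂ V, Module.finrank ℂ W < Module.finrank ℂ V →
      HasCanon (A.domRestrict₁₂ W W) (B.domRestrict₁₂ W W))
    {ν : ℂ} (hnd : ∀ v, (∀ w, A v w - ν * B v w = 0) → v = 0)
    (hdeg : ∃ v, v ≠ 0 ∧ ∀ w, B v w = 0) : HasCanon A B := by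
  let C : V →ₗ[ℂ] V →ₗ[ℂ] ℂ := A - ν • B
  have hCa : ∀ v w, C v w = A v w - ν * B v w := fun v w => rfl
  have hC : ∀ v, C v v = 0 := fun v => by rw [hCa, hA, hB]; ring
  have hCnd : ∀ v, (∀ w, C v w = 0) → v = 0 := hnd
  obtain ⟨T, hT, hTs⟩ := exists_operator hC hB hCnd
  obtain ⟨u, hu0, hu⟩ := hdeg
  obtain ⟨h, x, y, h1, hx, hy, hxy⟩ := exists_top_pair hCnd hTs
    ⟨u, hu0, hCnd _ fun w => by rw [hT, hu]⟩
  let X : Module.End ℂ V := (-ν) • T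
  let p : Module.End ℂ V := ∑ i ∈ Finset.range h, X ^ i
  have hXT : Commute X T := (Commute.refl T).smul_left _
  have hpT : Commute p T := Commute.sum_left _ _ _ fun i _ => hXT.pow_left i
  have hup : (1 - X) * p = 1 - X ^ h := mul_neg_geom_sum X h
  have hAC : ∀ v w, A v w = C ((1 - X) v) w := by
    intro v w
    have : (1 - X) v = v + ν • T v := by simp [X]
    rw [this, map_add, LinearMap.add_apply, map_smul, LinearMap.smul_apply, hT, hCa, smul_eq_mul]
    ring
  have hXs : ∀ v w, C (X v) w = C v (X w) := by
    intro v w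
    simp only [X, LinearMap.smul_apply, map_smul, hTs]
  have hps : ∀ v w, C (p v) w = C v (p w) := by
    intro v w
    simp only [p, LinearMap.sum_apply, map_sum]
    exact Finset.sum_congr rfl fun i _ => selfAdj_pow hXs i v w
  let N : Module.End ℂ V := T * p
  have hNs : ∀ v w, C (N v) w = C v (N w) := by
    intro v w
    have : N w = p (T w) := by
      simp only [N]; rw [← hpT.eq, Module.End.mul_apply]
    rw [this, ← hps, ← hTs]; rfl
  have hXN : Commute X N :=
    hXT.mul_right (Commute.sum_right _ _ _ fun i _ => (Commute.refl X).pow_right i)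
  have hN : ∀ v w, A (N v) w = A v (N w) := by
    intro v w
    rw [hAC, hAC, ← hNs]
    have : (1 - X) * N = N * (1 - X) := ((Commute.one_left N).sub_left hXN).eq
    rw [← Module.End.mul_apply, this]; rfl
  have hNk : ∀ k, N ^ k = p ^ k * T ^ k := by
    intro k
    rw [show N = p * T from hpT.eq.symm, hpT.mul_pow]
  have hXk : ∀ k v, (T ^ k) v = 0 → (X ^ k) v = 0 := by
    intro k v hv
    simp only [X]
    rw [smul_pow, LinearMap.smul_apply, hv, smul_zero]
  have hKN : ∀ v ∈ LinearMap.ker (T ^ h), N v ∈ LinearMap.ker (T ^ h) := by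
    intro v hv
    rw [LinearMap.mem_ker] at hv ⊢
    have : T ^ h * N = N * T ^ h :=
      ((((Commute.refl T).mul_right hpT.symm)).pow_left h).eq
    rw [← Module.End.mul_apply, this, Module.End.mul_apply, hv, map_zero]
  have hxy' : A ((N ^ (h - 1)) x) y ≠ 0 := by
    have hTx : T ((T ^ (h - 1)) x) = 0 := by
      rw [← Module.End.mul_apply, ← pow_succ', Nat.sub_add_cancel h1, hx]
    have hXx : X ((T ^ (h - 1)) x) = 0 := by simp [X, hTx]
    have hpx : p ((T ^ (h - 1)) x) = (T ^ (h - 1)) x := by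
      have e1 : ((1 - X) * p) ((T ^ (h - 1)) x) = (T ^ (h - 1)) x := by
        rw [hup, LinearMap.sub_apply, hXk h, sub_zero]; · rfl
        rw [← Module.End.mul_apply, ← pow_add, add_comm, pow_add, Module.End.mul_apply, hx, map_zero]
      have e2 : (1 - X) * p = p * (1 - X) := ((Commute.one_left p).sub_left
        (Commute.sum_right _ _ _ fun i _ => (Commute.refl X).pow_right i)).eq
      rw [e2, Module.End.mul_apply, LinearMap.sub_apply, hXx, sub_zero] at e1
      exact e1
    have hpk : ∀ k, (p ^ k) ((T ^ (h - 1)) x) = (T ^ (h - 1)) x := by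
      intro k
      induction k with
      | zero => simp
      | succ k ih => rw [pow_succ, Module.End.mul_apply, hpx, ih]
    have e3 : (1 - X) ((T ^ (h - 1)) x) = (T ^ (h - 1)) x := by
      rw [LinearMap.sub_apply, hXx, sub_zero]; rfl
    rw [hNk, Module.End.mul_apply, hpk, hAC, e3]
    exact hxy
  obtain ⟨e, φ, hφ, hDe, hEe, hD, hE⟩ := exists_cyclic_block (E := B) (μ := 0) hA hN h1
    (K := LinearMap.ker (T ^ h)) hKN
    (fun v hv => by rw [hNk, Module.End.mul_apply, hv, map_zero]) hx hy hxy'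
    (fun v w hv => by
      have e1 : (1 - X) (N v) = T v := by
        have e2 : (1 - X) * N = T * ((1 - X) * p) := by
          have : (1 - X) * T = T * (1 - X) := ((Commute.one_left T).sub_left hXT).eq
          simp only [N]
          rw [← mul_assoc, this, mul_assoc]
        rw [← Module.End.mul_apply, e2, hup, Module.End.mul_apply, LinearMap.sub_apply, hXk h v hv,
          sub_zero]
        rfl
      rw [hAC (N v), e1, hT, zero_mul, zero_add])
  have : Nonempty (Fin h) := ⟨⟨0, h1⟩⟩
  refine hasCanon_of_split hA hB IH e φ hφ hDe hEe (SBlock.K h) h1 ?_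
  refine (Kblk_cong h).trans ?_
  have : sk (EInfblk h) = gramP A B e := by
    refine Prod.ext ?_ ?_
    · ext i j
      have := hD i j
      simp only [sk, EInfblk, gramP, of_apply, this, transpose_one]
    · ext i j; exact (hE i j).symm
  rw [this]
  exact GCong.refl _

end RegularPart

section SingularPart

variable {V : Type} [AddCommGroup V] [Module ℂ V] {A B : V →ₗ[ℂ] V →ₗ[ℂ] ℂ}

/-- A singular pair of forms has a polynomial kernel vector. -/
theorem exists_chain [FiniteDimensional ℂ V]
    (h : ∀ ν : ℂ, ∃ v, v ≠ 0 ∧ ∀ w, A v w - ν * B v w = 0) :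
    ∃ (m : ℕ) (x : ℕ → V), x ≠ 0 ∧ (∀ i, m < i → x i = 0) ∧ A (x 0) = 0 ∧
      ∀ i, A (x (i + 1)) = B (x i) := by
  let b := Module.finBasis ℂ V
  let P : Matrix (Fin (Module.finrank ℂ V)) (Fin (Module.finrank ℂ V)) (Polynomial ℂ) :=
    Matrix.of fun i j => Polynomial.C (A (b j) (b i)) - Polynomial.X * Polynomial.C (B (b j) (b i))
  have hdet : P.det = 0 := by
    apply Polynomial.funext
    intro ν
    rw [Polynomial.eval_zero, ← Polynomial.coe_evalRingHom, RingHom.map_det]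
    obtain ⟨v, hv, hvw⟩ := h ν
    rw [← Matrix.exists_mulVec_eq_zero_iff]
    refine ⟨b.repr v, ?_, ?_⟩
    · intro h0
      apply hv
      apply b.repr.injective
      ext i
      simpa using congrFun h0 i
    · ext i
      have h1 := hvw (b i)
      nth_rewrite 1 2 [← b.sum_repr v] at h1
      simp only [map_sum, map_smul, LinearMap.sum_apply, LinearMap.smul_apply, smul_eq_mul,
        Finset.mul_sum, ← Finset.sum_sub_distrib] at h1
      simp only [mulVec, dotProduct, P, Pi.zero_apply, RingHom.mapMatrix_apply, map_apply, of_apply,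
        Polynomial.coe_evalRingHom, Polynomial.eval_sub, Polynomial.eval_mul, Polynomial.eval_C,
        Polynomial.eval_X]
      rw [← h1]
      refine Finset.sum_congr rfl fun j _ => ?_
      ring
  obtain ⟨v, hv, hPv⟩ := Matrix.exists_mulVec_eq_zero_iff.2 hdet
  have hPi : ∀ i, ∑ j, (Polynomial.C (A (b j) (b i)) * v j -
      Polynomial.X * (Polynomial.C (B (b j) (b i)) * v j)) = 0 := by
    intro i
    have := congrFun hPv i
    simp only [mulVec, dotProduct, P, Pi.zero_apply, of_apply] at this
    rw [← this]
    refine Finset.sum_congr rfl fun j _ => ?_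
    ring
  refine ⟨Finset.univ.sup fun j => (v j).natDegree, fun k => ∑ j, (v j).coeff k • b j,
    ?_, ?_, ?_, ?_⟩
  · intro h0
    apply hv
    ext j k
    have h1 := congrArg (fun u => b.repr u j) (congrFun h0 k)
    simpa [Finsupp.single_apply] using h1
  · intro i hi
    refine Finset.sum_eq_zero fun j _ => ?_
    rw [Polynomial.coeff_eq_zero_of_natDegree_lt, zero_smul]
    exact lt_of_le_of_lt (Finset.le_sup (f := fun j => (v j).natDegree) (Finset.mem_univ j)) hi
  · refine b.ext fun i => ?_
    have := congrArg (fun q => Polynomial.coeff q 0) (hPi i)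
    simp only [Polynomial.finsetSum_coeff, Polynomial.coeff_sub, Polynomial.coeff_C_mul,
      Polynomial.coeff_X_mul_zero, Polynomial.coeff_zero, sub_zero] at this
    simp only [map_sum, map_smul, LinearMap.sum_apply, LinearMap.smul_apply, smul_eq_mul,
      LinearMap.zero_apply]
    rw [← this]
    exact Finset.sum_congr rfl fun j _ => mul_comm _ _
  · intro k
    refine b.ext fun i => ?_
    have := congrArg (fun q => Polynomial.coeff q (k + 1)) (hPi i)
    simp only [Polynomial.finsetSum_coeff, Polynomial.coeff_sub, Polynomial.coeff_C_mul,
      Polynomial.coeff_X_mul, Polynomial.coeff_zero, Finset.sum_sub_distrib] at this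
    simp only [map_sum, map_smul, LinearMap.sum_apply, LinearMap.smul_apply, smul_eq_mul]
    rw [sub_eq_zero] at this
    convert this using 1 <;> exact Finset.sum_congr rfl fun j _ => mul_comm _ _

/-- The vectors dual to a kernel chain of minimal length. -/
theorem exists_dual_chain [FiniteDimensional ℂ V] (hA : ∀ v, A v v = 0) {k : ℕ}
    {xm : V} (hxm : xm ≠ 0) (hBx : B xm = 0)
    (hmin : ∀ z : ℕ → V, (∀ i, k < i → z i = 0) → A (z 0) = 0 →
      (∀ i, A (z (i + 1)) = B (z i)) → z = 0) (hB : ∀ v, B v v = 0) :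
    ∃ y : Fin (k + 1) → V, (∀ i : Fin k, A (y i.castSucc) = B (y i.succ)) ∧
      A (y (Fin.last k)) xm = 1 := by
  let Φ : (Fin (k + 1) → V) →ₗ[ℂ] ((Fin k → Module.Dual ℂ V) × ℂ) :=
    LinearMap.prod
      (LinearMap.pi fun i => A ∘ₗ LinearMap.proj i.castSucc - B ∘ₗ LinearMap.proj i.succ)
      (A.flip xm ∘ₗ LinearMap.proj (Fin.last k))
  suffices h : ((0, 1) : (Fin k → Module.Dual ℂ V) × ℂ) ∈ LinearMap.range Φ by
    obtain ⟨y, hy⟩ := h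
    have h1 : (fun i : Fin k => A (y i.castSucc) - B (y i.succ)) = 0 := congrArg Prod.fst hy
    exact ⟨y, fun i => sub_eq_zero.1 (congrFun h1 i), congrArg Prod.snd hy⟩
  by_contra hnot
  obtain ⟨g, hg2, hg1⟩ := Submodule.exists_le_ker_of_notMem hnot
  have hgz : ∀ i : Fin k, ∃ z : V, ∀ f : Module.Dual ℂ V, g (Pi.single i f, 0) = f z := by
    intro i
    obtain ⟨z, hz⟩ := (Module.evalEquiv ℂ V).surjective
      (g ∘ₗ LinearMap.inl ℂ _ _ ∘ₗ LinearMap.single ℂ (fun _ : Fin k => Module.Dual ℂ V) i)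
    refine ⟨z, fun f => ?_⟩
    have := congrArg (fun t => t f) hz
    simpa using this.symm
  choose z hz using hgz
  let c := g (0, 1)
  have hgen : ∀ (f : Fin k → Module.Dual ℂ V) (a : ℂ), g (f, a) = ∑ i, f i (z i) + a * c := by
    intro f a
    have e1 : ((f, a) : (Fin k → Module.Dual ℂ V) × ℂ) = ∑ i, ((Pi.single i (f i), 0) : (Fin k → Module.Dual ℂ V) × ℂ) + a • ((0, 1) : (Fin k → Module.Dual ℂ V) × ℂ) := by
      refine Prod.ext ?_ ?_
      · simp only [Prod.fst_add, Prod.fst_sum, Prod.smul_fst, smul_zero, add_zero]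
        exact (Finset.univ_sum_single f).symm
      · simp [Prod.snd_sum]
    rw [e1, map_add, map_sum, map_smul, smul_eq_mul]
    simp [hz, c]
  have hrel : ∀ y : Fin (k + 1) → V,
      ∑ i : Fin k, (A (y i.castSucc) (z i) - B (y i.succ) (z i)) + A (y (Fin.last k)) xm * c = 0 := by
    intro y
    have h1 : g (Φ y) = 0 := hg1 ⟨y, rfl⟩
    have h2 := hgen (fun i => A (y i.castSucc) - B (y i.succ)) (A (y (Fin.last k)) xm)
    rw [← h1]
    exact h2.symm
  let Z : ℕ → V := fun i => if h : i < k then z ⟨i, h⟩ else if i = k then c • xm else 0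
  have hrel' : ∀ y : ℕ → V,
      ∑ i ∈ Finset.range k, (A (y i) (Z i) - B (y (i + 1)) (Z i)) + A (y k) (Z k) = 0 := by
    intro y
    have h1 := hrel fun i => y i
    rw [Finset.sum_range]
    have h2 : Z k = c • xm := by simp [Z]
    rw [h2, map_smul, smul_eq_mul, mul_comm, ← h1]
    congr 1
    refine Finset.sum_congr rfl fun i _ => ?_
    have : Z i = z i := by simp [Z]
    rw [this]; rfl
  have hZ0 : ∀ j, j ≤ k → ∀ u, A u (Z j) = if j = 0 then 0 else B u (Z (j - 1)) := by
    intro j hj u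
    have h1 := hrel' fun i => if i = j then u else 0
    have h2 : ∀ i, A (if i = j then u else 0) (Z i) = if i = j then A u (Z i) else 0 := by
      intro i; split_ifs <;> simp
    have h3 : ∀ i, B (if i + 1 = j then u else 0) (Z i) = if i + 1 = j then B u (Z i) else 0 := by
      intro i; split_ifs <;> simp
    simp only [h2, h3, Finset.sum_sub_distrib] at h1
    rw [sub_add_eq_add_sub, ← Finset.sum_range_succ] at h1
    rw [Finset.sum_ite_eq' (Finset.range (k + 1)) j, if_pos (by simp; omega)] at h1
    rw [sub_eq_zero.1 h1]
    split_ifs with hj0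
    · subst hj0; simp
    · obtain ⟨j, rfl⟩ := Nat.exists_eq_succ_of_ne_zero hj0
      simp only [Nat.succ_eq_add_one, add_left_inj, Nat.add_sub_cancel]
      rw [Finset.sum_ite_eq' (Finset.range k) j, if_pos (by simp; omega)]
  have hZ : Z = 0 := by
    refine hmin Z ?_ ?_ ?_
    · intro i hi
      simp only [Z]; rw [dif_neg (by omega), if_neg (by omega)]
    · ext u
      rw [alt_neg hA, hZ0 0 (by omega), if_pos rfl]; simp
    · intro i
      ext u
      by_cases hi : i + 1 ≤ k
      · rw [alt_neg hA, hZ0 _ hi, if_neg (by omega), Nat.add_sub_cancel, alt_neg hB, neg_neg]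
      · have e1 : Z (i + 1) = 0 := by
          simp only [Z]; rw [dif_neg (by omega), if_neg (by omega)]
        rw [e1]
        by_cases hik : i = k
        · subst hik
          have e2 : Z i = c • xm := by simp [Z]
          rw [e2]; simp [hBx]
        · have e2 : Z i = 0 := by simp only [Z]; rw [dif_neg (by omega), if_neg hik]
          rw [e2]; simp
  have hc : c • xm = 0 := by
    have := congrFun hZ k
    simpa [Z] using this
  rcases smul_eq_zero.1 hc with hc | hc
  · exact hg2 hc
  · exact hxm hc

end SingularPart

section Existence

variable {V : Type} [AddCommGroup V] [Module ℂ V] {A B : V →ₗ[ℂ] V →ₗ[ℂ] ℂ}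

theorem hasCanon_of_common_kernel [FiniteDimensional ℂ V]
    (hA : ∀ v, A v v = 0) (hB : ∀ v, B v v = 0)
    (IH : ∀ W : Submodule ℂ V, Module.finrank ℂ W < Module.finrank ℂ V →
      HasCanon (A.domRestrict₁₂ W W) (B.domRestrict₁₂ W W))
    {x : V} (hx : x ≠ 0) (hAx : A x = 0) (hBx : B x = 0) : HasCanon A B := by
  obtain ⟨f, hf⟩ : ∃ f : Module.Dual ℂ V, f x ≠ 0 := by
    by_contra hcon
    push Not at hcon
    exact hx ((Module.forall_dual_apply_eq_zero_iff ℂ x).1 hcon)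
  refine hasCanon_of_split (κ := Fin 0 ⊕ Fin 1) hA hB IH (fun _ => x) (fun _ => (f x)⁻¹ • f)
    ?_ (fun _ v _ => by rw [hAx]; rfl) (fun _ v _ => by rw [hBx]; rfl) (SBlock.M 0) trivial ?_
  · rintro (i | i) (j | j)
    · exact i.elim0
    · exact i.elim0
    · exact j.elim0
    · rw [Subsingleton.elim i j]; simp [hf]
  · refine (Mblk_cong 0).trans ?_
    have : sk (Lblk 0) = gramP A B fun _ => x := by
      refine Prod.ext ?_ ?_ <;>
      · ext i j
        rcases i with i | i
        · exact i.elim0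
        · rcases j with j | j
          · exact j.elim0
          · simp [sk, gramP, hAx, hBx]
    rw [this]
    exact GCong.refl _

theorem hasCanon_of_minimal_chain [FiniteDimensional ℂ V]
    (hA : ∀ v, A v v = 0) (hB : ∀ v, B v v = 0)
    (IH : ∀ W : Submodule ℂ V, Module.finrank ℂ W < Module.finrank ℂ V →
      HasCanon (A.domRestrict₁₂ W W) (B.domRestrict₁₂ W W))
    {k : ℕ} {x : ℕ → V} (hx0 : A (x 0) = 0) (hx : ∀ i, A (x (i + 1)) = B (x i))
    (hxk : ∀ i, k + 1 < i → x i = 0) (hne : x (k + 1) ≠ 0)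
    (hmin : ∀ z : ℕ → V, (∀ i, k < i → z i = 0) → A (z 0) = 0 →
      (∀ i, A (z (i + 1)) = B (z i)) → z = 0) : HasCanon A B := by
  have hBx : B (x (k + 1)) = 0 := by rw [← hx, hxk _ (by omega), map_zero]
  obtain ⟨y, hy, hyx⟩ := exists_dual_chain hA hne hBx hmin hB
  obtain ⟨Y, hYy⟩ : ∃ Y : ℕ → V, ∀ i : Fin (k + 1), Y i = y i :=
    ⟨fun i => if h : i < k + 1 then y ⟨i, h⟩ else 0, fun i => by simp only [dif_pos i.2]⟩
  have hY : ∀ i, i < k → A (Y i) = B (Y (i + 1)) := by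
    intro i hi
    have h1 := hy ⟨i, hi⟩
    rw [← hYy, ← hYy] at h1
    exact h1
  have hYx1 : A (Y k) (x (k + 1)) = 1 := by
    rw [← hyx, ← hYy]; rfl
  have hxx : ∀ i j, A (x i) (x j) = 0 := by
    intro i
    induction i with
    | zero => intro j; rw [hx0]; rfl
    | succ i ih => intro j; rw [hx, alt_neg hB, ← hx, alt_neg hA, neg_neg, ih]
  have hxx' : ∀ i j, B (x i) (x j) = 0 := fun i j => by rw [← hx, hxx]
  have hstep : ∀ i j, i < k → A (Y i) (x j) = A (Y (i + 1)) (x (j + 1)) := by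
    intro i j hi
    rw [hY i hi, alt_neg hB, ← hx, alt_neg hA, neg_neg]
  have hYxle : ∀ j i, i ≤ k → j ≤ i → A (Y i) (x j) = 0 := by
    intro j
    induction j with
    | zero => intro i _ _; rw [alt_neg hA, hx0]; simp
    | succ j ih =>
      intro i hi hji
      obtain ⟨i, rfl⟩ : ∃ i', i = i' + 1 := ⟨i - 1, by omega⟩
      rw [← hstep i j (by omega), ih i (by omega) (by omega)]
  have hYxd : ∀ d i j, i + d = k → A (Y i) (x j) = A (Y k) (x (j + d)) := by
    intro d
    induction d with
    | zero => intro i j hi; rw [← hi]; rfl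
    | succ d ih =>
      intro i j hi
      rw [hstep i j (by omega), ih (i + 1) (j + 1) (by omega)]
      congr 2; ring
  have hYx : ∀ i j, i ≤ k → A (Y i) (x j) = if j = i + 1 then 1 else 0 := by
    intro i j hi
    split_ifs with hij
    · rw [hYxd (k - i) i j (by omega), ← hYx1]
      congr 2; omega
    · by_cases hji : j ≤ i
      · exact hYxle j i hi hji
      · rw [hYxd (k - i) i j (by omega), hxk _ (by omega), map_zero]
  have hYx' : ∀ i j, i ≤ k → B (Y i) (x j) = if j = i then 1 else 0 := by
    intro i j hi
    rw [alt_neg hB, ← hx, alt_neg hA, neg_neg, hYx i _ hi]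
    simp
  have hYYd : ∀ d i j, i + d ≤ k → j + d ≤ k → A (Y i) (Y (j + d)) = A (Y (i + d)) (Y j) := by
    intro d
    induction d with
    | zero => intro i j _ _; rfl
    | succ d ih =>
      intro i j hid hjd
      rw [hY i (by omega), alt_neg hB, ← add_assoc, ← hY (j + d) (by omega), alt_neg hA, neg_neg,
        ih (i + 1) j (by omega) (by omega)]
      congr 3; ring
  have hYYle : ∀ i j, i ≤ j → j ≤ k → A (Y i) (Y j) = 0 := by
    intro i j hij hj
    have h1 := hYYd (j - i) i i (by omega) (by omega)
    rw [Nat.add_sub_cancel' hij] at h1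
    rw [alt_neg hA (Y j)] at h1
    exact self_eq_neg.1 h1
  have hYY : ∀ i j, i ≤ k → j ≤ k → A (Y i) (Y j) = 0 := by
    intro i j hi hj
    rcases le_total i j with h | h
    · exact hYYle i j h hj
    · rw [alt_neg hA, hYYle j i h hi, neg_zero]
  have hYY' : ∀ i j, i ≤ k → j ≤ k → B (Y i) (Y j) = 0 := by
    intro i j hi hj
    rcases Nat.eq_zero_or_pos i with h | h
    · rcases Nat.eq_zero_or_pos j with h' | h'
      · rw [h, h', hB]
      · rw [alt_neg hB]
        obtain ⟨j, rfl⟩ : ∃ j', j = j' + 1 := ⟨j - 1, by omega⟩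
        rw [← hY j (by omega), hYY j i (by omega) hi, neg_zero]
    · obtain ⟨i, rfl⟩ : ∃ i', i = i' + 1 := ⟨i - 1, by omega⟩
      rw [← hY i (by omega), hYY i j (by omega) hj]
  let φ : Fin (k + 1) ⊕ Fin (k + 1 + 1) → V →ₗ[ℂ] ℂ :=
    Sum.elim (fun i => A.flip (x ((i : ℕ) + 1)))
      (fun j => if (j : ℕ) ≤ k then B (Y j) else A (Y k))
  have hφx : ∀ v, (∀ i, φ i v = 0) → ∀ j, A (x j) v = 0 := by
    intro v hv j
    rcases Nat.eq_zero_or_pos j with h | h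
    · rw [h, hx0]; rfl
    · by_cases hj : j ≤ k + 1
      · have h1 : A v (x (j - 1 + 1)) = 0 := hv (Sum.inl ⟨j - 1, by omega⟩)
        rw [alt_neg hA]
        rw [Nat.sub_add_cancel h] at h1
        rw [h1, neg_zero]
      · rw [hxk j (by omega)]; simp
  have hφY : ∀ v, (∀ i, φ i v = 0) → ∀ j, j ≤ k → B (Y j) v = 0 := by
    intro v hv j hj
    have h1 := hv (Sum.inr ⟨j, by omega⟩)
    simpa [φ, hj] using h1
  have hφYk : ∀ v, (∀ i, φ i v = 0) → A (Y k) v = 0 := by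
    intro v hv
    have h1 := hv (Sum.inr ⟨k + 1, by omega⟩)
    simpa [φ] using h1
  refine hasCanon_of_split (κ := Fin (k + 1) ⊕ Fin (k + 1 + 1)) hA hB IH
    (Sum.elim (fun i => Y i) (fun j => x j)) φ ?_ ?_ ?_ (SBlock.M (k + 1)) trivial ?_
  · rintro (i | i) (j | j)
    · simp only [φ, Sum.elim_inl, LinearMap.flip_apply, Sum.inl.injEq, Fin.ext_iff]
      rw [hYx _ _ (by omega)]
      simp
    · simp [φ, hxx]
    · simp only [φ, Sum.elim_inl, Sum.elim_inr, reduceCtorEq, if_false]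
      split_ifs with h
      · exact hYY' _ _ h (by omega)
      · exact hYY _ _ le_rfl (by omega)
    · simp only [φ, Sum.elim_inr, Sum.inr.injEq, Fin.ext_iff]
      split_ifs with h h' h'
      · rw [hYx' _ _ h, if_pos h'.symm]
      · rw [hYx' _ _ h, if_neg (Ne.symm h')]
      · rw [hYx _ _ le_rfl, if_pos (by omega)]
      · rw [hYx _ _ le_rfl, if_neg (by omega)]
  · rintro (i | i) v hv
    · simp only [Sum.elim_inl]
      by_cases hi : (i : ℕ) < k
      · rw [hY _ hi, hφY v hv _ (by omega)]
      · rw [show (i : ℕ) = k by omega, hφYk v hv]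
    · exact hφx v hv _
  · rintro (i | i) v hv
    · exact hφY v hv _ (by omega)
    · simp only [Sum.elim_inr]
      rw [← hx, hφx v hv]
  · refine (Mblk_cong (k + 1)).trans ?_
    have : sk (Lblk (k + 1)) = gramP A B (Sum.elim (fun i : Fin (k + 1) => Y i)
        (fun j : Fin (k + 1 + 1) => x j)) := by
      refine Prod.ext ?_ ?_
      · ext i j
        rcases i with i | i <;> rcases j with j | j
        · simp [sk, gramP, hYY i j (by omega) (by omega)]
        · simp [sk, gramP, Lblk, Fmat, hYx i j (by omega)]
        · simp only [sk, gramP, Lblk, Fmat, of_apply, Sum.elim_inl, Sum.elim_inr, fromBlocks_apply₂₁,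
            Matrix.neg_apply, transpose_apply]
          rw [alt_neg hA, hYx j i (by omega)]
        · simp [sk, gramP, hxx]
      · ext i j
        rcases i with i | i <;> rcases j with j | j
        · simp [sk, gramP, hYY' i j (by omega) (by omega)]
        · simp [sk, gramP, Lblk, Gmat, hYx' i j (by omega)]
        · simp only [sk, gramP, Lblk, Gmat, of_apply, Sum.elim_inl, Sum.elim_inr, fromBlocks_apply₂₁,
            Matrix.neg_apply, transpose_apply]
          rw [alt_neg hB, hYx' j i (by omega)]
        · simp [sk, gramP, hxx']
    rw [this]
    exact GCong.refl _

theorem hasCanon_of_alt [FiniteDimensional ℂ V]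
    (hA : ∀ v, A v v = 0) (hB : ∀ v, B v v = 0)
    (IH : ∀ W : Submodule ℂ V, Module.finrank ℂ W < Module.finrank ℂ V →
      HasCanon (A.domRestrict₁₂ W W) (B.domRestrict₁₂ W W)) : HasCanon A B := by
  rcases subsingleton_or_nontrivial V with hV | hV
  · exact hasCanon_of_isEmpty
  by_cases hsing : ∀ ν : ℂ, ∃ v, v ≠ 0 ∧ ∀ w, A v w - ν * B v w = 0
  · have hex : ∃ (m : ℕ) (x : ℕ → V), x ≠ 0 ∧ (∀ i, m < i → x i = 0) ∧ A (x 0) = 0 ∧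
      ∀ i, A (x (i + 1)) = B (x i) := exists_chain hsing
    obtain ⟨x, hx, hxm, hx0, hxs⟩ := Nat.find_spec hex
    have hmin := fun j => Nat.find_min (m := j) hex
    generalize Nat.find hex = m at hxm hmin
    rcases m with _ | k
    · refine hasCanon_of_common_kernel (x := x 0) hA hB IH ?_ hx0 ?_
      · intro h0
        apply hx
        funext i
        rcases Nat.eq_zero_or_pos i with h | h
        · rw [h, h0]; rfl
        · exact hxm i h
      · rw [← hxs, hxm _ (by omega), map_zero]
    · have hm : ∀ z : ℕ → V, (∀ i, k < i → z i = 0) → A (z 0) = 0 →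
          (∀ i, A (z (i + 1)) = B (z i)) → z = 0 := by
        intro z h1 h2 h3
        by_contra hz
        exact hmin k (by omega) ⟨z, hz, h1, h2, h3⟩
      refine hasCanon_of_minimal_chain hA hB IH hx0 hxs hxm ?_ hm
      intro h0
      apply hx
      refine hm x ?_ hx0 hxs
      intro i hi
      by_cases hik : i = k + 1
      · rw [hik, h0]
      · exact hxm i (by omega)
  · push Not at hsing
    obtain ⟨ν, hν⟩ := hsing
    have hν' : ∀ v, (∀ w, A v w - ν * B v w = 0) → v = 0 := by
      intro v hv
      by_contra h0
      obtain ⟨w, hw⟩ := hν v h0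
      exact hw (hv w)
    by_cases hnd : ∃ v, v ≠ 0 ∧ ∀ w, B v w = 0
    · exact hasCanon_of_regular hA hB IH hν' hnd
    · push Not at hnd
      refine hasCanon_of_nondegenerate hA hB IH ?_
      intro v hv
      by_contra h0
      obtain ⟨w, hw⟩ := hnd v h0
      exact hw (hv w)

end Existence

theorem hasCanon (n : ℕ) : ∀ (V : Type) [AddCommGroup V] [Module ℂ V] [FiniteDimensional ℂ V]
    (A B : V →ₗ[ℂ] V →ₗ[ℂ] ℂ), (∀ v, A v v = 0) → (∀ v, B v v = 0) → Module.finrank ℂ V = n →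
    HasCanon A B := by
  induction n using Nat.strong_induction_on with
  | _ n ih =>
    intro V _ _ _ A B hA hB hn
    refine hasCanon_of_alt hA hB fun W hW => ?_
    exact ih _ (hn ▸ hW) W _ _ (fun v => hA v) (fun v => hB v) rfl

/-- The bilinear form of a square matrix. -/
def matForm {n : ℕ} (M : Matrix (Fin n) (Fin n) ℂ) : (Fin n → ℂ) →ₗ[ℂ] (Fin n → ℂ) →ₗ[ℂ] ℂ :=
  LinearMap.mk₂ ℂ (fun v w => v ⬝ᵥ M *ᵥ w) (fun _ _ _ => by simp [add_dotProduct])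
    (fun _ _ _ => by simp) (fun _ _ _ => by simp [mulVec_add])
    (fun _ _ _ => by simp [mulVec_smul])

theorem matForm_self {n : ℕ} {M : Matrix (Fin n) (Fin n) ℂ} (hM : Mᵀ = -M) (v : Fin n → ℂ) :
    matForm M v v = 0 := by
  have h1 : v ⬝ᵥ M *ᵥ v = -(v ⬝ᵥ M *ᵥ v) := by
    calc v ⬝ᵥ M *ᵥ v = Mᵀ *ᵥ v ⬝ᵥ v := by rw [mulVec_transpose, dotProduct_mulVec]
      _ = -(v ⬝ᵥ M *ᵥ v) := by rw [hM, neg_mulVec, neg_dotProduct, dotProduct_comm]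
  exact self_eq_neg.1 h1

/-- Every skew-symmetric pencil is congruent to a direct sum of canonical blocks. -/
theorem exists_canonical {n : ℕ} {P : Pencil n n} (h : Pencil.IsSkew P) :
    ∃ l : List SBlock, (∀ b ∈ l, b.valid) ∧ GCong (sp l) P := by
  obtain ⟨l, hl, m, b, hb⟩ := hasCanon n (Fin n → ℂ) (matForm P.1) (matForm P.2)
    (matForm_self h.1) (matForm_self h.2) (by simp)
  refine ⟨l, hl, hb.trans ((gramP_cong b (Pi.basisFun ℂ (Fin n))).trans ?_)⟩
  have : gramP (matForm P.1) (matForm P.2) (Pi.basisFun ℂ (Fin n)) = P := by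
    refine Prod.ext ?_ ?_ <;>
    · ext i j
      simp [gramP, matForm]
  rw [this]
  exact GCong.refl _

section Solutions

variable {ι κ τ ι' κ' τ' : Type} [Fintype ι] [Fintype κ] [Fintype τ] [Fintype ι']
  [Fintype κ'] [Fintype τ'] [DecidableEq ι'] [DecidableEq κ'] [DecidableEq τ'] [DecidableEq ι]
  [DecidableEq κ] [DecidableEq τ]

/-- The linear map `Z ↦ A Z α - B Z β` for pencils `(A, B)` and `(α, β)`. -/
def solMap (X : GP κ ι) (T : GP τ τ') : Matrix ι τ ℂ →ₗ[ℂ] Matrix κ τ' ℂ where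
  toFun Z := X.1 * Z * T.1 - X.2 * Z * T.2
  map_add' Z W := by simp only [Matrix.mul_add, Matrix.add_mul]; abel
  map_smul' c Z := by simp [smul_sub]

theorem solMap_apply (X : GP κ ι) (T : GP τ τ') (Z : Matrix ι τ ℂ) :
    solMap X T Z = X.1 * Z * T.1 - X.2 * Z * T.2 := rfl

/-- The dimension of the space of solutions of `A Z α = B Z β`. -/
def solDim (X : GP κ ι) (T : GP τ τ') : ℕ := Module.finrank ℂ (LinearMap.ker (solMap X T))

theorem mem_ker_solMap {X : GP κ ι} {T : GP τ τ'} {Z : Matrix ι τ ℂ} :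
    Z ∈ LinearMap.ker (solMap X T) ↔ X.1 * Z * T.1 = X.2 * Z * T.2 := by
  rw [LinearMap.mem_ker, solMap_apply, sub_eq_zero]

theorem REq.solDim_le {X : GP κ ι} {Y : GP κ' ι'} (T : GP τ τ') (h : REq X Y) :
    solDim X T ≤ solDim Y T := by
  obtain ⟨S, S', R, R', h1, h2, h3, h4, h5, h6⟩ := h
  have hmem : ∀ Z : LinearMap.ker (solMap X T), R' * Z.1 ∈ LinearMap.ker (solMap Y T) := by
    intro Z
    have hZ := mem_ker_solMap.1 Z.2
    rw [mem_ker_solMap, ← h5, ← h6]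
    calc S * X.1 * R * (R' * Z.1) * T.1 = S * (X.1 * ((R * R') * Z.1) * T.1) := by
          simp only [Matrix.mul_assoc]
      _ = S * (X.2 * ((R * R') * Z.1) * T.2) := by rw [h3, Matrix.one_mul, hZ]
      _ = _ := by simp only [Matrix.mul_assoc]
  let f : LinearMap.ker (solMap X T) →ₗ[ℂ] LinearMap.ker (solMap Y T) :=
    { toFun := fun Z => ⟨R' * Z.1, hmem Z⟩
      map_add' := fun Z W => Subtype.ext (Matrix.mul_add _ _ _)
      map_smul' := fun c Z => Subtype.ext (Matrix.mul_smul _ _ _) }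
  refine LinearMap.finrank_le_finrank_of_injective (f := f) ?_
  intro Z W hZW
  have : R' * Z.1 = R' * W.1 := congrArg Subtype.val hZW
  apply Subtype.ext
  calc Z.1 = R * (R' * Z.1) := by rw [← Matrix.mul_assoc, h3, Matrix.one_mul]
    _ = R * (R' * W.1) := by rw [this]
    _ = W.1 := by rw [← Matrix.mul_assoc, h3, Matrix.one_mul]

theorem REq.solDim_eq {X : GP κ ι} {Y : GP κ' ι'} (T : GP τ τ') (h : REq X Y) :
    solDim X T = solDim Y T := le_antisymm (h.solDim_le T) (h.symm.solDim_le T)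

theorem GCong.req {P : GP ι ι} {Q : GP κ κ} (h : GCong P Q) : REq P Q := by
  obtain ⟨S, T, h1, h2, h3, h4⟩ := h
  exact ⟨Sᵀ, Tᵀ, S, T, by rw [← transpose_mul, h2, transpose_one],
    by rw [← transpose_mul, h1, transpose_one], h1, h2, h3, h4⟩

theorem GCong.solDim_eq {P : GP ι ι} {Q : GP κ κ} (T : GP τ τ') (h : GCong P Q) :
    solDim P T = solDim Q T := h.req.solDim_eq T

theorem solDim_gsum (X : GP κ ι) (Y : GP κ' ι') (T : GP τ τ') :
    solDim (gsum X Y) T = solDim X T + solDim Y T := by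
  have key : ∀ Z : Matrix (ι ⊕ ι') τ ℂ, Z ∈ LinearMap.ker (solMap (gsum X Y) T) ↔
      Z.toRows₁ ∈ LinearMap.ker (solMap X T) ∧ Z.toRows₂ ∈ LinearMap.ker (solMap Y T) := by
    intro Z
    obtain ⟨Z1, Z2, rfl⟩ : ∃ Z1 Z2, Z = fromRows Z1 Z2 := ⟨_, _, (fromRows_toRows Z).symm⟩
    simp only [mem_ker_solMap, gsum, toRows₁_fromRows, toRows₂_fromRows, fromBlocks_mul_fromRows,
      fromRows_mul, Matrix.zero_mul, add_zero, zero_add, fromRows_ext_iff]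
  let e : LinearMap.ker (solMap (gsum X Y) T) ≃ₗ[ℂ]
      LinearMap.ker (solMap X T) × LinearMap.ker (solMap Y T) :=
    { toFun := fun Z => (⟨Z.1.toRows₁, ((key _).1 Z.2).1⟩, ⟨Z.1.toRows₂, ((key _).1 Z.2).2⟩)
      invFun := fun W => ⟨fromRows W.1.1 W.2.1, (key _).2 (by
        rw [toRows₁_fromRows, toRows₂_fromRows]; exact ⟨W.1.2, W.2.2⟩)⟩
      map_add' := fun Z W => rfl
      map_smul' := fun c Z => rfl
      left_inv := fun Z => Subtype.ext (fromRows_toRows _)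
      right_inv := fun W => Prod.ext (Subtype.ext (toRows₁_fromRows _ _))
        (Subtype.ext (toRows₂_fromRows _ _)) }
  rw [solDim, e.finrank_eq, Module.finrank_prod]
  rfl

theorem sk_req (X : GP κ ι) : REq (sk X) (gsum X ((X.1ᵀ, X.2ᵀ) : GP ι κ)) := by
  refine ⟨fromBlocks 1 0 0 (-1), fromBlocks 1 0 0 (-1), fromBlocks 0 1 1 0, fromBlocks 0 1 1 0,
    ?_, ?_, ?_, ?_, ?_, ?_⟩ <;> simp [fromBlocks_multiply, sk, gsum]

theorem solDim_sk (X : GP κ ι) (T : GP τ τ') :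
    solDim (sk X) T = solDim X T + solDim ((X.1ᵀ, X.2ᵀ) : GP ι κ) T := by
  rw [(sk_req X).solDim_eq T, solDim_gsum]

theorem solDim_gswap (X : GP κ ι) (T : GP τ τ') : solDim (gswap X) (gswap T) = solDim X T := by
  have : LinearMap.ker (solMap (gswap X) (gswap T)) = LinearMap.ker (solMap X T) := by
    ext Z
    rw [mem_ker_solMap, mem_ker_solMap]
    exact eq_comm
  rw [solDim, this, solDim]

/-- Lower semicontinuity of the rank: the solution dimension cannot drop in a limit. -/
theorem isClosed_setOf_le_solDim (T : GP τ τ') (d : ℕ) :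
    IsClosed {X : GP κ ι | d ≤ solDim X T} := by
  rw [← isOpen_compl_iff]
  rw [isOpen_iff_mem_nhds]
  intro X hX
  have hlt : solDim X T < d := by simpa using hX
  set N := Module.finrank ℂ (Matrix ι τ ℂ)
  have hrn : ∀ Y : GP κ ι, Module.finrank ℂ (LinearMap.range (solMap Y T)) + solDim Y T = N :=
    fun Y => (solMap Y T).finrank_range_add_finrank_ker
  set r := Module.finrank ℂ (LinearMap.range (solMap X T)) with hr
  let b := Module.finBasis ℂ (LinearMap.range (solMap X T))
  have hb : ∀ i, ∃ z, solMap X T z = (b i : Matrix κ τ' ℂ) := fun i => (b i).2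
  choose z hz using hb
  have hli : LinearIndependent ℂ fun i => solMap X T (z i) := by
    have := b.linearIndependent.map' (LinearMap.range (solMap X T)).subtype
      (Submodule.ker_subtype _)
    rw [show (fun i => solMap X T (z i)) = (LinearMap.range (solMap X T)).subtype ∘ b from
      funext hz]
    exact this
  have hcont : Continuous fun Y : GP κ ι => fun i => (solMap Y T (z i) : κ → τ' → ℂ) := by
    refine continuous_pi fun i => ?_
    show Continuous fun Y : GP κ ι => (Y.1 * z i * T.1 - Y.2 * z i * T.2 : Matrix κ τ' ℂ)
    fun_prop
  have hopen : IsOpen {f : Fin (Module.finrank ℂ (LinearMap.range (solMap X T))) → (κ → τ' → ℂ) |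
    LinearIndependent ℂ f} := isOpen_setOfPred_linearIndependent
  have hmem := hcont.continuousAt.preimage_mem_nhds (hopen.mem_nhds (x := fun i =>
    (solMap X T (z i) : κ → τ' → ℂ)) hli)
  refine Filter.mem_of_superset hmem ?_
  intro Y hY
  have hY' : LinearIndependent ℂ fun i => solMap Y T (z i) := hY
  have h1 : r ≤ Module.finrank ℂ (LinearMap.range (solMap Y T)) := by
    have h2 : LinearIndependent ℂ fun i =>
        (⟨solMap Y T (z i), LinearMap.mem_range_self _ _⟩ : LinearMap.range (solMap Y T)) :=
      LinearIndependent.of_comp (LinearMap.range (solMap Y T)).subtype hY'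
    simpa using h2.fintype_card_le_finrank
  have h3 := hrn X
  have h4 := hrn Y
  simp only [Set.mem_compl_iff, Set.mem_ofPred_eq, not_le]
  omega

theorem GDeg.solDim_le {P : GP ι ι} {Q : GP κ κ} (T : GP τ τ') (h : GDeg P Q) :
    solDim P T ≤ solDim Q T := by
  have : closure {Q' : GP κ κ | GCong P Q'} ⊆ {X : GP κ κ | solDim P T ≤ solDim X T} :=
    closure_minimal (fun Q' hQ' => (hQ'.solDim_eq T).le) (isClosed_setOf_le_solDim T _)
  exact this h

end Solutions

section BlockSolutions

/-- Extension of a matrix by zero, with indices starting at one. -/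
def mext {p q : ℕ} (Z : Matrix (Fin p) (Fin q) ℂ) (i j : ℕ) : ℂ :=
  if h : (1 ≤ i ∧ i ≤ p) ∧ (1 ≤ j ∧ j ≤ q) then
    Z ⟨i - 1, by omega⟩ ⟨j - 1, by omega⟩ else 0

theorem mext_succ {p q : ℕ} (Z : Matrix (Fin p) (Fin q) ℂ) (i : Fin p) (j : Fin q) :
    mext Z (i + 1) (j + 1) = Z i j := by
  have := i.2
  have := j.2
  rw [mext, dif_pos ⟨⟨by omega, by omega⟩, by omega, by omega⟩]
  rfl

theorem mext_of {p q : ℕ} (Z : Matrix (Fin p) (Fin q) ℂ) {i j : ℕ} (hi : i < p) (hj : j < q) :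
    mext Z (i + 1) (j + 1) = Z ⟨i, hi⟩ ⟨j, hj⟩ := mext_succ Z ⟨i, hi⟩ ⟨j, hj⟩

theorem mext_zero_left {p q : ℕ} (Z : Matrix (Fin p) (Fin q) ℂ) (j : ℕ) : mext Z 0 j = 0 :=
  dif_neg (by omega)

theorem mext_zero_right {p q : ℕ} (Z : Matrix (Fin p) (Fin q) ℂ) (i : ℕ) : mext Z i 0 = 0 :=
  dif_neg (by omega)

theorem mext_left {p q : ℕ} (Z : Matrix (Fin p) (Fin q) ℂ) {i : ℕ} (j : ℕ) (h : p < i) :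
    mext Z i j = 0 := dif_neg (by omega)

theorem mext_right {p q : ℕ} (Z : Matrix (Fin p) (Fin q) ℂ) (i : ℕ) {j : ℕ} (h : q < j) :
    mext Z i j = 0 := dif_neg (by omega)

theorem eq_zero_of_mext {p q : ℕ} {Z : Matrix (Fin p) (Fin q) ℂ}
    (h : ∀ i j, i < p → j < q → mext Z (i + 1) (j + 1) = 0) : Z = 0 := by
  ext i j
  rw [← mext_succ Z]
  exact h _ _ i.2 j.2

theorem sum_ite_val {p : ℕ} (k : ℕ) (f : Fin p → ℂ) :
    (∑ x : Fin p, if (x : ℕ) = k then f x else 0) = if h : k < p then f ⟨k, h⟩ else 0 := by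
  split_ifs with h
  · rw [Finset.sum_eq_single ⟨k, h⟩]
    · simp
    · intro b _ hb
      rw [if_neg]
      intro h'
      exact hb (Fin.ext h')
    · simp
  · refine Finset.sum_eq_zero fun x _ => if_neg ?_
    have := x.2
    omega

theorem mul_ite_aux {p q r : ℕ} (Z : Matrix (Fin p) (Fin q) ℂ) (B : Matrix (Fin q) (Fin r) ℂ)
    (c : ℂ) (k : ℕ) (i : Fin p) (j : Fin r)
    (hB : ∀ x : Fin q, B x j = if (x : ℕ) + 1 = k then c else 0) :
    (Z * B) i j = c * mext Z (i + 1) k := by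
  have hi := i.2
  rw [Matrix.mul_apply]
  rcases Nat.eq_zero_or_pos k with rfl | hk
  · rw [mext_zero_right, mul_zero]
    refine Finset.sum_eq_zero fun x _ => ?_
    rw [hB, if_neg (by omega), mul_zero]
  · obtain ⟨k, rfl⟩ : ∃ m, k = m + 1 := ⟨k - 1, by omega⟩
    have : ∀ x, Z i x * B x j = if (x : ℕ) = k then Z i x * c else 0 := by
      intro x
      rw [hB]
      by_cases hx : (x : ℕ) = k <;> simp [hx]
    simp only [this]
    rw [sum_ite_val]
    split_ifs with h
    · rw [mext_of Z hi h, mul_comm]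
    · rw [mext_right Z _ (by omega), mul_zero]

theorem ite_mul_aux {p q r : ℕ} (Z : Matrix (Fin q) (Fin p) ℂ) (B : Matrix (Fin r) (Fin q) ℂ)
    (c : ℂ) (k : ℕ) (i : Fin p) (j : Fin r)
    (hB : ∀ x : Fin q, B j x = if (x : ℕ) + 1 = k then c else 0) :
    (B * Z) j i = c * mext Z k (i + 1) := by
  have h := mul_ite_aux Zᵀ Bᵀ c k i j (fun x => by rw [transpose_apply, hB])
  rw [← transpose_mul, transpose_apply] at h
  rw [h]
  congr 1
  simp only [mext, transpose_apply]
  by_cases hh : (1 ≤ (i : ℕ) + 1 ∧ (i : ℕ) + 1 ≤ p) ∧ (1 ≤ k ∧ k ≤ q)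
  · rw [dif_pos hh, dif_pos hh.symm]
  · rw [dif_neg hh, dif_neg (fun h' => hh h'.symm)]

variable {p q : ℕ}

theorem mul_Fmat (Z : Matrix (Fin p) (Fin q) ℂ) (i : Fin p) (j : Fin (q + 1)) :
    (Z * Fmat q) i j = mext Z (i + 1) j := by
  rw [mul_ite_aux Z (Fmat q) 1 j i j, one_mul]
  intro x
  simp [Fmat, eq_comm]

theorem mul_Gmat (Z : Matrix (Fin p) (Fin q) ℂ) (i : Fin p) (j : Fin (q + 1)) :
    (Z * Gmat q) i j = mext Z (i + 1) (j + 1) := by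
  rw [mul_ite_aux Z (Gmat q) 1 (j + 1) i j, one_mul]
  intro x
  simp [Gmat, eq_comm]

theorem Fmat_mul (Z : Matrix (Fin (p + 1)) (Fin q) ℂ) (i : Fin p) (j : Fin q) :
    (Fmat p * Z) i j = mext Z (i + 2) (j + 1) := by
  rw [ite_mul_aux Z (Fmat p) 1 (i + 2) j i, one_mul]
  intro x
  simp [Fmat]

theorem Gmat_mul (Z : Matrix (Fin (p + 1)) (Fin q) ℂ) (i : Fin p) (j : Fin q) :
    (Gmat p * Z) i j = mext Z (i + 1) (j + 1) := by
  rw [ite_mul_aux Z (Gmat p) 1 (i + 1) j i, one_mul]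
  intro x
  simp [Gmat]

theorem FmatT_mul (Z : Matrix (Fin p) (Fin q) ℂ) (i : Fin (p + 1)) (j : Fin q) :
    ((Fmat p)ᵀ * Z) i j = mext Z i (j + 1) := by
  rw [ite_mul_aux Z (Fmat p)ᵀ 1 i j i, one_mul]
  intro x
  simp [Fmat, eq_comm]

theorem GmatT_mul (Z : Matrix (Fin p) (Fin q) ℂ) (i : Fin (p + 1)) (j : Fin q) :
    ((Gmat p)ᵀ * Z) i j = mext Z (i + 1) (j + 1) := by
  rw [ite_mul_aux Z (Gmat p)ᵀ 1 (i + 1) j i, one_mul]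
  intro x
  simp [Gmat, eq_comm]

theorem Jmat_eq (k : ℕ) (μ : ℂ) : Jmat k μ = μ • 1 + Jmat k 0 := by
  ext i j
  simp only [Jmat, Matrix.add_apply, Matrix.smul_apply, Matrix.of_apply, Matrix.one_apply,
    Fin.ext_iff, smul_eq_mul]
  split_ifs <;> first | omega | simp

theorem Jmat_mul (μ : ℂ) (Z : Matrix (Fin p) (Fin q) ℂ) (i : Fin p) (j : Fin q) :
    (Jmat p μ * Z) i j = μ * mext Z (i + 1) (j + 1) + mext Z (i + 2) (j + 1) := by
  rw [Jmat_eq, Matrix.add_mul, Matrix.add_apply, Matrix.smul_mul, Matrix.one_mul,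
    ite_mul_aux Z (Jmat p 0) 1 (i + 2) j i, one_mul, Matrix.smul_apply, mext_succ, smul_eq_mul]
  intro x
  simp only [Jmat, Matrix.of_apply]
  split_ifs <;> first | omega | rfl

theorem mul_Jmat (μ : ℂ) (Z : Matrix (Fin p) (Fin q) ℂ) (i : Fin p) (j : Fin q) :
    (Z * Jmat q μ) i j = μ * mext Z (i + 1) (j + 1) + mext Z (i + 1) j := by
  rw [Jmat_eq, Matrix.mul_add, Matrix.add_apply, Matrix.mul_smul, Matrix.mul_one,
    mul_ite_aux Z (Jmat q 0) 1 j i j, one_mul, Matrix.smul_apply, mext_succ, smul_eq_mul]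
  intro x
  simp only [Jmat, Matrix.of_apply]
  split_ifs <;> first | omega | rfl

theorem mext_rows {r : ℕ} {W : Matrix (Fin r) (Fin q) ℂ} {f : ℕ → ℂ} {i : ℕ} (hi : i < r)
    (hf : ∀ j, (j = 0 ∨ q < j) → f j = 0)
    (h : ∀ j : Fin q, W ⟨i, hi⟩ j = f (j + 1)) (j : ℕ) : mext W (i + 1) j = f j := by
  by_cases hj : j = 0 ∨ q < j
  · rw [hf j hj]
    rcases hj with rfl | hj
    · exact mext_zero_right _ _
    · exact mext_right _ _ hj
  · obtain ⟨k, rfl⟩ : ∃ k, j = k + 1 := ⟨j - 1, by omega⟩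
    rw [mext_of W hi (show k < q by omega), h]

theorem mext_out (Z : Matrix (Fin p) (Fin q) ℂ) (i : ℕ) {j : ℕ} (h : j = 0 ∨ q < j) :
    mext Z i j = 0 := by
  rcases h with rfl | h
  · exact mext_zero_right _ _
  · exact mext_right _ _ h

theorem mext_Jmat_mul (μ : ℂ) (Z : Matrix (Fin p) (Fin q) ℂ) {i : ℕ} (hi : i < p) (j : ℕ) :
    mext (Jmat p μ * Z) (i + 1) j = μ * mext Z (i + 1) j + mext Z (i + 2) j :=
  mext_rows (f := fun j => μ * mext Z (i + 1) j + mext Z (i + 2) j) hi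
    (fun j hj => by simp [mext_out Z _ hj]) (fun _ => Jmat_mul μ Z _ _) j

theorem mext_Fmat_mul (Z : Matrix (Fin (p + 1)) (Fin q) ℂ) {i : ℕ} (hi : i < p) (j : ℕ) :
    mext (Fmat p * Z) (i + 1) j = mext Z (i + 2) j :=
  mext_rows (f := fun j => mext Z (i + 2) j) hi (fun j hj => mext_out Z _ hj)
    (fun _ => Fmat_mul Z _ _) j

theorem mext_Gmat_mul (Z : Matrix (Fin (p + 1)) (Fin q) ℂ) {i : ℕ} (hi : i < p) (j : ℕ) :
    mext (Gmat p * Z) (i + 1) j = mext Z (i + 1) j :=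
  mext_rows (f := fun j => mext Z (i + 1) j) hi (fun j hj => mext_out Z _ hj)
    (fun _ => Gmat_mul Z _ _) j

theorem mext_FmatT_mul (Z : Matrix (Fin p) (Fin q) ℂ) {i : ℕ} (hi : i < p + 1) (j : ℕ) :
    mext ((Fmat p)ᵀ * Z) (i + 1) j = mext Z i j :=
  mext_rows (f := fun j => mext Z i j) hi (fun j hj => mext_out Z _ hj)
    (fun _ => FmatT_mul Z _ _) j

theorem mext_GmatT_mul (Z : Matrix (Fin p) (Fin q) ℂ) {i : ℕ} (hi : i < p + 1) (j : ℕ) :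
    mext ((Gmat p)ᵀ * Z) (i + 1) j = mext Z (i + 1) j :=
  mext_rows (f := fun j => mext Z (i + 1) j) hi (fun j hj => mext_out Z _ hj)
    (fun _ => GmatT_mul Z _ _) j

theorem matrix_eq_iff_nat {r s : ℕ} {X Y : Matrix (Fin r) (Fin s) ℂ} :
    X = Y ↔ ∀ i j (hi : i < r) (hj : j < s), X ⟨i, hi⟩ ⟨j, hj⟩ = Y ⟨i, hi⟩ ⟨j, hj⟩ := by
  constructor
  · rintro rfl i j hi hj
    rfl
  · intro h
    ext i j
    exact h _ _ i.2 j.2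

/-- The test pencil detecting minimal indices. -/
def gTest (m : ℕ) : GP (Fin m) (Fin (m + 1)) := (Gmat m, Fmat m)

/-- The test pencil detecting Jordan blocks for a finite or infinite eigenvalue. -/
def jTest (μ : Option ℂ) (m : ℕ) : GP (Fin m) (Fin m) :=
  match μ with
  | some μ => (1, Jmat m μ)
  | none => (Jmat m 0, 1)

theorem solDim_eq_zero {ι κ τ τ' : Type} [Fintype ι] [Fintype τ] [Fintype κ] [Fintype τ']
    [DecidableEq ι] [DecidableEq τ] [DecidableEq κ] [DecidableEq τ'] {X : GP κ ι} {T : GP τ τ'}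
    (h : ∀ Z : Matrix ι τ ℂ, X.1 * Z * T.1 = X.2 * Z * T.2 → Z = 0) : solDim X T = 0 := by
  rw [solDim, Submodule.finrank_eq_zero, Submodule.eq_bot_iff]
  intro Z hZ
  exact h Z (mem_ker_solMap.1 hZ)

/-- A solution space computed through coordinates. -/
theorem solDim_eq_of_equiv {ι κ τ τ' : Type} [Fintype ι] [Fintype τ] [Fintype κ] [Fintype τ']
    [DecidableEq ι] [DecidableEq τ] [DecidableEq κ] [DecidableEq τ'] {X : GP κ ι} {T : GP τ τ'}
    {d : ℕ} (f : Matrix ι τ ℂ →ₗ[ℂ] (Fin d → ℂ)) (g : (Fin d → ℂ) → Matrix ι τ ℂ)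
    (hg : ∀ c, X.1 * g c * T.1 = X.2 * g c * T.2) (hfg : ∀ c, f (g c) = c)
    (hinj : ∀ Z : Matrix ι τ ℂ, X.1 * Z * T.1 = X.2 * Z * T.2 → f Z = 0 → Z = 0) : solDim X T = d := by
  have h1 : Function.Bijective (f.domRestrict (LinearMap.ker (solMap X T))) := by
    constructor
    · rw [← LinearMap.ker_eq_bot, LinearMap.ker_eq_bot']
      intro Z hZ
      exact Subtype.ext (hinj _ (mem_ker_solMap.1 Z.2) hZ)
    · intro c
      exact ⟨⟨g c, mem_ker_solMap.2 (hg c)⟩, hfg c⟩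
  rw [solDim, (LinearEquiv.ofBijective _ h1).finrank_eq]
  simp

end BlockSolutions

section BlockValues

variable {a m h : ℕ}

theorem solDim_LT_gTest : solDim (LTblk a) (gTest m) = 0 := by
  refine solDim_eq_zero fun Z hZ => eq_zero_of_mext ?_
  have key : ∀ i j, i < a + 1 → j < m + 1 → mext Z i (j + 1) = mext Z (i + 1) j := by
    intro i j hi hj
    have := matrix_eq_iff_nat.1 hZ i j hi hj
    simpa only [LTblk, gTest, mul_Gmat, mul_Fmat, mext_FmatT_mul Z hi, mext_GmatT_mul Z hi]
      using this
  intro i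
  induction i with
  | zero =>
    intro j hi hj
    rw [← key 0 (j + 1) (by omega) (by omega), mext_zero_left]
  | succ i ih =>
    intro j hi hj
    rw [← key (i + 1) (j + 1) (by omega) (by omega)]
    by_cases hjm : j + 1 < m
    · exact ih _ (by omega) hjm
    · exact mext_right _ _ (by omega)

theorem solDim_LT_jTest (μ : Option ℂ) : solDim (LTblk a) (jTest μ m) = 0 := by
  refine solDim_eq_zero fun Z hZ => eq_zero_of_mext ?_
  cases μ with
  | some μ =>
    have key : ∀ i j, i < a + 1 → j < m →
        mext Z i (j + 1) = μ * mext Z (i + 1) (j + 1) + mext Z (i + 1) j := by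
      intro i j hi hj
      have := matrix_eq_iff_nat.1 hZ i j hi hj
      simp only [LTblk, jTest, Matrix.mul_one, FmatT_mul, mul_Jmat, mext_GmatT_mul Z hi] at this
      exact this
    have : ∀ k i, i + k = a + 1 → ∀ j, j ≤ m → mext Z i j = 0 := by
      intro k
      induction k with
      | zero =>
        intro i hi j hj
        exact mext_left _ _ (by omega)
      | succ k ih =>
        intro i hi j hj
        cases j with
        | zero => exact mext_zero_right _ _
        | succ j =>
          rw [key i j (by omega) (by omega), ih _ (by omega) _ hj, ih _ (by omega) _ (by omega)]
          simp
    intro i j hi hj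
    exact this (a - i) (i + 1) (by omega) _ hj
  | none =>
    have key : ∀ i j, i < a + 1 → j < m → mext Z i j = mext Z (i + 1) (j + 1) := by
      intro i j hi hj
      have := matrix_eq_iff_nat.1 hZ i j hi hj
      simpa only [LTblk, jTest, Matrix.mul_one, GmatT_mul, mul_Jmat, mext_FmatT_mul Z hi,
        zero_mul, zero_add] using this
    intro i
    induction i with
    | zero =>
      intro j hi hj
      rw [← key 0 j (by omega) hj, mext_zero_left]
    | succ i ih =>
      intro j hi hj
      rw [← key (i + 1) j (by omega) (by omega)]
      cases j with
      | zero => exact mext_zero_right _ _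
      | succ j => exact ih j (by omega) (by omega)

theorem solDim_E_gTest (μ : ℂ) : solDim (Eblk h μ) (gTest m) = 0 := by
  refine solDim_eq_zero fun Z hZ => eq_zero_of_mext ?_
  have key : ∀ i j, i < h → j < m + 1 →
      μ * mext Z (i + 1) (j + 1) + mext Z (i + 2) (j + 1) = mext Z (i + 1) j := by
    intro i j hi hj
    have := matrix_eq_iff_nat.1 hZ i j hi hj
    simpa only [Eblk, gTest, mul_Gmat, mul_Fmat, mext_Jmat_mul _ Z hi, Matrix.one_mul] using this
  have : ∀ k j, j + k = m + 1 → ∀ i, i ≤ h → mext Z (i + 1) j = 0 := by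
    intro k
    induction k with
    | zero =>
      intro j hj i hi
      exact mext_right _ _ (by omega)
    | succ k ih =>
      intro j hj i hi
      by_cases hih : i < h
      · rw [← key i j hih (by omega), ih (j + 1) (by omega) i hi, ih (j + 1) (by omega) (i + 1) hih]
        simp
      · exact mext_left _ _ (by omega)
  intro i j hi hj
  exact this (m - j) (j + 1) (by omega) i hi.le

theorem solDim_EInf_gTest : solDim (EInfblk h) (gTest m) = 0 := by
  refine solDim_eq_zero fun Z hZ => eq_zero_of_mext ?_
  have key : ∀ i j, i < h → j < m + 1 → mext Z (i + 1) (j + 1) = mext Z (i + 2) j := by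
    intro i j hi hj
    have := matrix_eq_iff_nat.1 hZ i j hi hj
    simpa only [EInfblk, gTest, mul_Gmat, mul_Fmat, mext_Jmat_mul _ Z hi, Matrix.one_mul,
      zero_mul, zero_add] using this
  intro i j
  induction j generalizing i with
  | zero =>
    intro hi hj
    rw [key i 0 hi (by omega), mext_zero_right]
  | succ j ih =>
    intro hi hj
    rw [key i (j + 1) hi (by omega)]
    by_cases hih : i + 1 < h
    · exact ih (i + 1) hih (by omega)
    · exact mext_left _ _ (by omega)

theorem solDim_E_jTest_none (μ : ℂ) : solDim (Eblk h μ) (jTest none m) = 0 := by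
  refine solDim_eq_zero fun Z hZ => eq_zero_of_mext ?_
  have key : ∀ i j, i < h → j < m →
      μ * mext Z (i + 1) j + mext Z (i + 2) j = mext Z (i + 1) (j + 1) := by
    intro i j hi hj
    have := matrix_eq_iff_nat.1 hZ i j hi hj
    simp only [Eblk, jTest, mul_Jmat, mext_Jmat_mul _ Z hi, Matrix.one_mul, Matrix.mul_one,
      zero_mul, zero_add] at this
    rw [this, mext_of Z hi hj]
  intro i j
  induction j generalizing i with
  | zero =>
    intro hi hj
    rw [← key i 0 hi (by omega), mext_zero_right, mext_zero_right]
    simp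
  | succ j ih =>
    intro hi hj
    rw [← key i (j + 1) hi (by omega), ih i hi (by omega)]
    by_cases hih : i + 1 < h
    · rw [ih (i + 1) hih (by omega)]
      simp
    · rw [mext_left Z (i := i + 2) _ (by omega)]
      simp

theorem solDim_EInf_jTest_some (μ : ℂ) : solDim (EInfblk h) (jTest (some μ) m) = 0 := by
  refine solDim_eq_zero fun Z hZ => eq_zero_of_mext ?_
  have key : ∀ i j, i < h → j < m →
      mext Z (i + 1) (j + 1) = μ * mext Z (i + 2) (j + 1) + mext Z (i + 2) j := by
    intro i j hi hj
    have := matrix_eq_iff_nat.1 hZ i j hi hj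
    simp only [EInfblk, jTest, mul_Jmat, mext_Jmat_mul _ Z hi, Matrix.one_mul, Matrix.mul_one,
      zero_mul, zero_add] at this
    rw [← this, mext_of Z hi hj]
  have : ∀ k i, i + k = h → ∀ j, j ≤ m → mext Z (i + 1) j = 0 := by
    intro k
    induction k with
    | zero =>
      intro i hi j hj
      exact mext_left _ _ (by omega)
    | succ k ih =>
      intro i hi j hj
      cases j with
      | zero => exact mext_zero_right _ _
      | succ j =>
        rw [key i j (by omega) (by omega), ih (i + 1) (by omega) _ hj,
          ih (i + 1) (by omega) _ (by omega)]
        simp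
  intro i j hi hj
  exact this (h - i) i (by omega) _ hj

theorem solDim_E_jTest_ne {μ ν : ℂ} (hμν : μ ≠ ν) :
    solDim (Eblk h μ) (jTest (some ν) m) = 0 := by
  refine solDim_eq_zero fun Z hZ => eq_zero_of_mext ?_
  have key : ∀ i j, i < h → j < m → μ * mext Z (i + 1) (j + 1) + mext Z (i + 2) (j + 1) =
      ν * mext Z (i + 1) (j + 1) + mext Z (i + 1) j := by
    intro i j hi hj
    have := matrix_eq_iff_nat.1 hZ i j hi hj
    simpa only [Eblk, jTest, mul_Jmat, Jmat_mul, Matrix.one_mul, Matrix.mul_one] using this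
  have : ∀ k i, i + k = h → ∀ j, j ≤ m → mext Z (i + 1) j = 0 := by
    intro k
    induction k with
    | zero =>
      intro i hi j hj
      exact mext_left _ _ (by omega)
    | succ k ih =>
      intro i hi j
      induction j with
      | zero => intro _; exact mext_zero_right _ _
      | succ j ihj =>
        intro hj
        have h1 := key i j (by omega) (by omega)
        rw [ih (i + 1) (by omega) _ hj, ihj (by omega), add_zero, add_zero, ← sub_eq_zero,
          ← sub_mul] at h1
        exact (mul_eq_zero.1 h1).resolve_left (sub_ne_zero.2 hμν)
  intro i j hi hj
  exact this (h - i) i (by omega) _ hj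

theorem solDim_L_gTest : solDim (Lblk a) (gTest m) = m - a := by
  let f : Matrix (Fin (a + 1)) (Fin m) ℂ →ₗ[ℂ] (Fin (m - a) → ℂ) :=
    { toFun := fun Z d => Z 0 ⟨d, by omega⟩
      map_add' := fun _ _ => rfl
      map_smul' := fun _ _ => rfl }
  have hfa : ∀ Z d, f Z d = Z 0 ⟨d, by omega⟩ := fun _ _ => rfl
  refine solDim_eq_of_equiv f (fun c => Matrix.of fun i j =>
    if hij : (i : ℕ) ≤ j ∧ (j : ℕ) - i < m - a then c ⟨j - i, hij.2⟩ else 0) ?_ ?_ ?_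
  · intro c
    set g : Matrix (Fin (a + 1)) (Fin m) ℂ := Matrix.of fun i j =>
      if hij : (i : ℕ) ≤ j ∧ (j : ℕ) - i < m - a then c ⟨j - i, hij.2⟩ else 0 with hg
    rw [matrix_eq_iff_nat]
    intro i j hi hj
    simp only [Lblk, gTest, mul_Gmat, mul_Fmat, mext_Fmat_mul g hi, mext_Gmat_mul g hi]
    rcases j with _ | j
    · rw [mext_zero_right]
      by_cases hm : 0 < m
      · rw [mext_of g (show i + 1 < a + 1 by omega) hm, hg]
        simp
      · exact mext_right _ _ (by omega)
    · rw [mext_of g (show i < a + 1 by omega) (show j < m by omega)]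
      by_cases hjm : j + 1 < m
      · rw [mext_of g (show i + 1 < a + 1 by omega) hjm, hg]
        simp
      · rw [mext_right g _ (by omega), hg]
        simp only [of_apply]
        rw [dif_neg]
        omega
  · intro c
    ext d
    have := d.2
    rw [hfa]
    simp
  · intro Z hZ hf
    apply eq_zero_of_mext
    have key : ∀ i j, i < a → j < m + 1 → mext Z (i + 2) (j + 1) = mext Z (i + 1) j := by
      intro i j hi hj
      have := matrix_eq_iff_nat.1 hZ i j hi hj
      simpa only [Lblk, gTest, mul_Gmat, mul_Fmat, mext_Fmat_mul Z hi, mext_Gmat_mul Z hi]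
        using this
    have diag : ∀ k i j, i + k ≤ a → j + k ≤ m + 1 →
        mext Z (i + 1 + k) (j + k) = mext Z (i + 1) j := by
      intro k
      induction k with
      | zero => intros; rfl
      | succ k ih =>
        intro i j hi hj
        rw [← ih i j (by omega) (by omega), show i + 1 + k = i + k + 1 by omega,
          ← key (i + k) (j + k) (by omega) (by omega), show i + 1 + (k + 1) = i + k + 2 by omega]
        rfl
    have row0 : ∀ d, mext Z 1 d = 0 := by
      intro d
      rcases d with _ | d
      · exact mext_zero_right _ _
      · by_cases hd : d < m
        · by_cases hd' : d < m - a
          · rw [mext_of Z (Nat.succ_pos a) hd]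
            exact congrFun hf ⟨d, hd'⟩
          · rw [← diag (m - d) 0 (d + 1) (by omega) (by omega)]
            exact mext_right _ _ (by omega)
        · exact mext_right _ _ (by omega)
    intro i j hi hj
    by_cases hij : i ≤ j
    · rw [show i + 1 = 0 + 1 + i by omega, show j + 1 = (j + 1 - i) + i by omega,
        diag i 0 _ (by omega) (by omega), row0]
    · rw [show i + 1 = (i - (j + 1)) + 1 + (j + 1) by omega,
        show j + 1 = 0 + (j + 1) by omega]
      conv_lhs => rw [show i - (0 + (j + 1)) + 1 + (0 + (j + 1)) = i - (j + 1) + 1 + (j + 1) by omega]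
      rw [diag (j + 1) _ 0 (by omega) (by omega), mext_zero_right]

theorem solDim_L_jTest_some (μ : ℂ) : solDim (Lblk a) (jTest (some μ) m) = m := by
  let f : Matrix (Fin (a + 1)) (Fin m) ℂ →ₗ[ℂ] (Fin m → ℂ) :=
    { toFun := fun Z d => Z 0 d
      map_add' := fun _ _ => rfl
      map_smul' := fun _ _ => rfl }
  have hfa : ∀ Z d, f Z d = Z 0 d := fun _ _ => rfl
  have hrow : ∀ (Z : Matrix (Fin (a + 1)) (Fin m) ℂ) (i : Fin a),
      (Fmat a * Z) i = Z i.succ ∧ (Gmat a * Z) i = Z i.castSucc := by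
    intro Z i
    constructor
    · ext j
      rw [Fmat_mul, ← mext_succ Z]
      rfl
    · ext j
      rw [Gmat_mul, ← mext_succ Z]
      rfl
  refine solDim_eq_of_equiv f (fun c => Matrix.of fun i => c ᵥ* (Jmat m μ) ^ (i : ℕ)) ?_ ?_ ?_
  · intro c
    simp only [Lblk, jTest, Matrix.mul_one]
    set g : Matrix (Fin (a + 1)) (Fin m) ℂ := Matrix.of fun i => c ᵥ* (Jmat m μ) ^ (i : ℕ) with hg
    have hgi : ∀ i, g i = c ᵥ* (Jmat m μ) ^ (i : ℕ) := fun _ => rfl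
    have : ∀ i, (Fmat a * g) i = (Gmat a * g * Jmat m μ) i := by
      intro i
      rw [(hrow g i).1, Matrix.mul_apply_eq_vecMul, (hrow g i).2, hgi, hgi, vecMul_vecMul,
        Fin.val_succ, pow_succ, Fin.val_castSucc]
    exact funext this
  · intro c
    ext d
    rw [hfa]
    simp
  · intro Z hZ hf
    simp only [Lblk, jTest, Matrix.mul_one] at hZ
    have : ∀ i : Fin (a + 1), Z i = 0 := by
      intro i
      induction i using Fin.induction with
      | zero => exact hf
      | succ i ih =>
        rw [← (hrow Z i).1, hZ, Matrix.mul_apply_eq_vecMul, (hrow Z i).2, ih, zero_vecMul]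
    exact funext this

theorem solDim_E_jTest_self (μ : ℂ) : solDim (Eblk h μ) (jTest (some μ) m) = min h m := by
  let f : Matrix (Fin h) (Fin m) ℂ →ₗ[ℂ] (Fin (min h m) → ℂ) :=
    { toFun := fun Z d => Z ⟨0, by have := d.2; omega⟩ ⟨d + (m - min h m), by
        have := d.2; omega⟩
      map_add' := fun _ _ => rfl
      map_smul' := fun _ _ => rfl }
  have hfa : ∀ Z (d : Fin (min h m)), f Z d = Z ⟨0, by have := d.2; omega⟩
      ⟨d + (m - min h m), by have := d.2; omega⟩ := fun _ _ => rfl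
  have key : ∀ Z : Matrix (Fin h) (Fin m) ℂ, (Eblk h μ).1 * Z * (jTest (some μ) m).1 =
      (Eblk h μ).2 * Z * (jTest (some μ) m).2 ↔
      ∀ i j, i < h → j < m → mext Z (i + 2) (j + 1) = mext Z (i + 1) j := by
    intro Z
    rw [matrix_eq_iff_nat]
    simp only [Eblk, jTest, mul_Jmat, Jmat_mul, Matrix.one_mul, Matrix.mul_one]
    constructor
    · intro H i j hi hj
      exact add_left_cancel (H i j hi hj)
    · intro H i j hi hj
      rw [H i j hi hj]
  refine solDim_eq_of_equiv f (fun c => Matrix.of fun i j =>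
    if hij : (i : ℕ) + (m - min h m) ≤ j ∧ (j : ℕ) - (i + (m - min h m)) < min h m then
      c ⟨j - (i + (m - min h m)), hij.2⟩ else 0) ?_ ?_ ?_
  · intro c
    set g : Matrix (Fin h) (Fin m) ℂ := Matrix.of fun i j =>
      if hij : (i : ℕ) + (m - min h m) ≤ j ∧ (j : ℕ) - (i + (m - min h m)) < min h m then
        c ⟨j - (i + (m - min h m)), hij.2⟩ else 0 with hg
    rw [key]
    intro i j hi hj
    rcases j with _ | j
    · rw [mext_zero_right]
      by_cases hih : i + 1 < h
      · rw [mext_of g hih hj, hg]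
        simp
      · exact mext_left _ _ (by omega)
    · rw [mext_of g hi (show j < m by omega)]
      by_cases hih : i + 1 < h
      · rw [mext_of g hih hj, hg]
        simp only [of_apply]
        by_cases hc : i + (m - min h m) ≤ j ∧ j - (i + (m - min h m)) < min h m
        · rw [dif_pos hc, dif_pos (by omega)]
          congr 2
          omega
        · rw [dif_neg hc, dif_neg (by omega)]
      · rw [mext_left g _ (by omega), hg]
        simp only [of_apply]
        rw [dif_neg]
        omega
  · intro c
    ext d
    have := d.2
    rw [hfa]
    simp only [of_apply, zero_add]
    rw [dif_pos ⟨by omega, by omega⟩]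
    congr 1
    ext
    simp
  · intro Z hZ hf
    apply eq_zero_of_mext
    have hk := (key Z).1 hZ
    have diag : ∀ k i j, i + k ≤ h → j + k ≤ m →
        mext Z (i + 1 + k) (j + k) = mext Z (i + 1) j := by
      intro k
      induction k with
      | zero => intros; rfl
      | succ k ih =>
        intro i j hi hj
        rw [← ih i j (by omega) (by omega), show i + 1 + k = i + k + 1 by omega,
          ← hk (i + k) (j + k) (by omega) (by omega), show i + 1 + (k + 1) = i + k + 2 by omega]
        rfl
    have row0 : ∀ d, mext Z 1 d = 0 := by
      intro d
      rcases d with _ | d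
      · exact mext_zero_right _ _
      · by_cases hd : d < m
        · by_cases hh : 0 < h
          · by_cases hd' : d < m - min h m
            · rw [← diag h 0 (d + 1) (by omega) (by omega)]
              exact mext_left _ _ (by omega)
            · rw [mext_of Z hh hd]
              have := congrFun hf ⟨d - (m - min h m), by omega⟩
              rw [hfa, Pi.zero_apply] at this
              rw [← this]
              congr 2
              show d = d - (m - min h m) + (m - min h m)
              omega
          · exact mext_left _ _ (by omega)
        · exact mext_right _ _ (by omega)
    intro i j hi hj
    by_cases hij : i ≤ j
    · rw [show i + 1 = 0 + 1 + i by omega, show j + 1 = (j + 1 - i) + i by omega,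
        diag i 0 _ (by omega) (by omega), row0]
    · have := diag (j + 1) (i - (j + 1)) 0 (by omega) (by omega)
      rw [mext_zero_right, show i - (j + 1) + 1 + (j + 1) = i + 1 by omega, zero_add] at this
      exact this

end BlockValues

section BlockValues

variable {a m h : ℕ}

theorem gswap_Lblk_req (a : ℕ) : REq (gswap (Lblk a)) (Lblk a) := by
  have h := greidx_req (Fin.revPerm (n := a)) (Fin.revPerm (n := a + 1)) (gswap (Lblk a))
  convert h using 1
  refine Prod.ext ?_ ?_ <;> ext i j <;> have hi := i.2 <;> have hj := j.2 <;>
    simp only [greidx, gswap, Lblk, Gmat, Fmat, Matrix.submatrix_apply, Matrix.of_apply,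
      Fin.revPerm_apply, Fin.val_rev] <;> refine if_congr ?_ rfl rfl <;> omega

theorem solDim_L_jTest (μ : Option ℂ) : solDim (Lblk a) (jTest μ m) = m := by
  cases μ with
  | some μ => exact solDim_L_jTest_some μ
  | none =>
    rw [← (gswap_Lblk_req a).solDim_eq, ← solDim_gswap (gswap (Lblk a))]
    exact solDim_L_jTest_some (a := a) (m := m) 0

theorem solDim_EInf_jTest_none : solDim (EInfblk h) (jTest none m) = min h m := by
  rw [← solDim_gswap (EInfblk h)]
  exact solDim_E_jTest_self (h := h) (m := m) 0

theorem transpose_req_of_symm {X : GP (Fin h) (Fin h)}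
    (h1 : X.1ᵀ = X.1.submatrix Fin.rev Fin.rev) (h2 : X.2ᵀ = X.2.submatrix Fin.rev Fin.rev) :
    REq (X.1ᵀ, X.2ᵀ) X := by
  have h := (greidx_req (Fin.revPerm (n := h)) (Fin.revPerm (n := h)) X).symm
  rw [h1, h2]
  exact h

theorem one_transpose_rev : (1 : Matrix (Fin h) (Fin h) ℂ)ᵀ =
    (1 : Matrix (Fin h) (Fin h) ℂ).submatrix Fin.rev Fin.rev := by
  ext i j
  simp [Matrix.one_apply, eq_comm]

theorem Jmat_transpose_rev (μ : ℂ) : (Jmat h μ)ᵀ = (Jmat h μ).submatrix Fin.rev Fin.rev := by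
  ext i j
  have hi := i.2
  have hj := j.2
  simp only [Jmat, Matrix.transpose_apply, Matrix.of_apply, Matrix.submatrix_apply, Fin.val_rev]
  refine if_congr (by omega) rfl (if_congr (by omega) rfl rfl)

theorem Eblk_transpose_req (μ : ℂ) : REq (((Eblk h μ).1ᵀ, (Eblk h μ).2ᵀ) : GP _ _) (Eblk h μ) :=
  transpose_req_of_symm (Jmat_transpose_rev μ) one_transpose_rev

theorem EInfblk_transpose_req :
    REq (((EInfblk h).1ᵀ, (EInfblk h).2ᵀ) : GP _ _) (EInfblk h) :=
  transpose_req_of_symm one_transpose_rev (Jmat_transpose_rev 0)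

theorem toPencil_M_cong (a : ℕ) : GCong (SBlock.M a).toPencil (sk (Lblk a)) := Mblk_cong a

theorem toPencil_Hb_some_cong (h : ℕ) (μ : ℂ) : GCong (Hb (some μ) h).toPencil (sk (Eblk h μ)) :=
  Hblk_cong h μ

theorem toPencil_Hb_none_cong (h : ℕ) : GCong (Hb none h).toPencil (sk (EInfblk h)) :=
  Kblk_cong h

theorem solDim_M_gTest : solDim (SBlock.M a).toPencil (gTest m) = m - a := by
  rw [(toPencil_M_cong a).solDim_eq, solDim_sk,
    solDim_L_gTest]
  exact congrArg (m - a + ·) solDim_LT_gTest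

theorem solDim_M_jTest (μ : Option ℂ) : solDim (SBlock.M a).toPencil (jTest μ m) = m := by
  rw [(toPencil_M_cong a).solDim_eq, solDim_sk,
    solDim_L_jTest]
  exact congrArg (m + ·) (solDim_LT_jTest μ)

theorem solDim_Hb {κ τ : Type} [Fintype κ] [Fintype τ] (T : GP κ τ) (μ : Option ℂ) :
    solDim (Hb μ h).toPencil T =
      2 * (match μ with
        | some μ => solDim (Eblk h μ) T
        | none => solDim (EInfblk h) T) := by
  cases μ with
  | some μ =>
    rw [(toPencil_Hb_some_cong h μ).solDim_eq, solDim_sk,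
      (Eblk_transpose_req μ).solDim_eq, two_mul]
  | none =>
    rw [(toPencil_Hb_none_cong h).solDim_eq, solDim_sk,
      EInfblk_transpose_req.solDim_eq, two_mul]

theorem solDim_Hb_gTest (μ : Option ℂ) : solDim (Hb μ h).toPencil (gTest m) = 0 := by
  rw [solDim_Hb]
  cases μ with
  | some μ => simp [solDim_E_gTest]
  | none => simp [solDim_EInf_gTest]

theorem solDim_Hb_jTest (μ ν : Option ℂ) :
    solDim (Hb ν h).toPencil (jTest μ m) = if ν = μ then 2 * min h m else 0 := by
  rw [solDim_Hb]
  cases ν with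
  | some ν =>
    cases μ with
    | some μ =>
      by_cases e : ν = μ
      · simp [e, solDim_E_jTest_self]
      · simp [e, solDim_E_jTest_ne e]
    | none => simp [solDim_E_jTest_none]
  | none =>
    cases μ with
    | some μ => simp [solDim_EInf_jTest_some]
    | none => simp [solDim_EInf_jTest_none]

end BlockValues

theorem Hb_inj {μ ν : Option ℂ} {h k : ℕ} : Hb μ h = Hb ν k ↔ μ = ν ∧ h = k := by
  cases μ <;> cases ν <;> simp [Hb, and_comm]

theorem Hb_ne_M {μ : Option ℂ} {h a : ℕ} : Hb μ h ≠ SBlock.M a := by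
  cases μ <;> simp [Hb]

theorem SBlock.exists_eq (b : SBlock) : (∃ a, b = SBlock.M a) ∨ ∃ μ h, b = Hb μ h := by
  cases b with
  | H h μ => exact .inr ⟨some μ, h, rfl⟩
  | K h => exact .inr ⟨none, h, rfl⟩
  | M a => exact .inl ⟨a, rfl⟩

theorem size_Hb (μ : Option ℂ) (h : ℕ) : (Hb μ h).size = 2 * h := by
  cases μ <;> simp [Hb, SBlock.size, two_mul]

theorem valid_Hb {μ : Option ℂ} {h : ℕ} : (Hb μ h).valid ↔ 1 ≤ h := by
  cases μ <;> simp [Hb, SBlock.valid]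

theorem mWs_cons_M (a : ℕ) (s : Multiset SBlock) (i : ℕ) :
    mWs (SBlock.M a ::ₘ s) i = (if i ≤ a then 1 else 0) + mWs s i := by
  simp only [mWs, ← Multiset.countP_eq_card_filter, Multiset.countP_cons]
  rw [add_comm]
  simp

theorem mWs_cons_Hb (μ : Option ℂ) (h : ℕ) (s : Multiset SBlock) (i : ℕ) :
    mWs (Hb μ h ::ₘ s) i = mWs s i := by
  simp only [mWs, ← Multiset.countP_eq_card_filter, Multiset.countP_cons]
  rw [if_neg (fun ⟨a, h1, _⟩ => Hb_ne_M h1), add_zero]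

theorem jWs_cons_M (a : ℕ) (s : Multiset SBlock) (μ : Option ℂ) (i : ℕ) :
    jWs (SBlock.M a ::ₘ s) μ i = jWs s μ i := by
  simp only [jWs, ← Multiset.countP_eq_card_filter, Multiset.countP_cons]
  rw [if_neg (fun ⟨a, h1, _⟩ => Hb_ne_M h1.symm), add_zero]

theorem jWs_cons_Hb (ν : Option ℂ) (h : ℕ) (s : Multiset SBlock) (μ : Option ℂ) (i : ℕ) :
    jWs (Hb ν h ::ₘ s) μ i = (if ν = μ ∧ i ≤ h then 1 else 0) + jWs s μ i := by
  simp only [jWs, ← Multiset.countP_eq_card_filter, Multiset.countP_cons]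
  rw [add_comm]
  congr 1
  refine if_congr ⟨?_, ?_⟩ rfl rfl
  · rintro ⟨a, h1, h2⟩
    obtain ⟨rfl, rfl⟩ := Hb_inj.1 h1
    exact ⟨rfl, h2⟩
  · rintro ⟨rfl, h2⟩
    exact ⟨h, rfl, h2⟩

theorem psum_add (p q : ℕ → ℕ) (m : ℕ) : psum (fun i => p i + q i) m = psum p m + psum q m :=
  Finset.sum_add_distrib

theorem psum_succ (p : ℕ → ℕ) (m : ℕ) : psum p (m + 1) = psum p m + p m :=
  Finset.sum_range_succ _ _

theorem psum_zero (p : ℕ → ℕ) : psum p 0 = 0 := rfl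

theorem psum_ite_lt (a m : ℕ) : psum (fun i => if i < a then 1 else 0) m = min a m := by
  induction m with
  | zero => simp [psum_zero]
  | succ m ih => rw [psum_succ, ih]; split_ifs <;> omega

/-- The partition of `H`-block indices at the eigenvalue `μ`, indexed from `0`. -/
def hPart (s : Multiset SBlock) (μ : Option ℂ) : ℕ → ℕ := fun i => jWs s μ (i + 1)

theorem rPartS_cons_M (a : ℕ) (s : Multiset SBlock) :
    rPartS (SBlock.M a ::ₘ s) = fun i => (if i < a + 1 then 1 else 0) + rPartS s i := by
  funext i
  simp only [rPartS, mWs_cons_M, Nat.lt_succ_iff]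

theorem rPartS_cons_Hb (μ : Option ℂ) (h : ℕ) (s : Multiset SBlock) :
    rPartS (Hb μ h ::ₘ s) = rPartS s := funext fun i => mWs_cons_Hb μ h s i

theorem hPart_cons_M (a : ℕ) (s : Multiset SBlock) (μ : Option ℂ) :
    hPart (SBlock.M a ::ₘ s) μ = hPart s μ := funext fun i => jWs_cons_M a s μ (i + 1)

theorem hPart_cons_Hb (ν : Option ℂ) (h : ℕ) (s : Multiset SBlock) (μ : Option ℂ) :
    hPart (Hb ν h ::ₘ s) μ = fun i => (if ν = μ ∧ i < h then 1 else 0) + hPart s μ i :=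
  funext fun i => jWs_cons_Hb ν h s μ (i + 1)

theorem hPart_cons_Hb_ne {ν μ : Option ℂ} (hne : ν ≠ μ) (h : ℕ) (s : Multiset SBlock) :
    hPart (Hb ν h ::ₘ s) μ = hPart s μ := by
  rw [hPart_cons_Hb]
  simp [hne]

theorem hPart_cons_Hb_self (μ : Option ℂ) (h : ℕ) (s : Multiset SBlock) :
    hPart (Hb μ h ::ₘ s) μ = fun i => (if i < h then 1 else 0) + hPart s μ i := by
  rw [hPart_cons_Hb]
  simp

theorem rPartS_nil : rPartS 0 = fun _ => 0 := rfl

theorem hPart_nil (μ : Option ℂ) : hPart 0 μ = fun _ => 0 := rfl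

theorem psum_const_zero (m : ℕ) : psum (fun _ => 0) m = 0 := Finset.sum_const_zero

theorem jPartS_eq (s : Multiset SBlock) (μ : Option ℂ) (i : ℕ) :
    jPartS s μ i = 2 * hPart s μ i := rfl

theorem solDim_sp_cons {κ τ : Type} [Fintype κ] [Fintype τ] (T : GP κ τ)
    (b : SBlock) (l : List SBlock) :
    solDim (sp (b :: l)) T = solDim b.toPencil T + solDim (sp l) T := by
  rw [(sp_cons b l).solDim_eq, solDim_gsum]

theorem solDim_sp_nil {κ τ : Type} [Fintype κ] [Fintype τ] (T : GP κ τ) :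
    solDim (sp []) T = 0 := by
  refine solDim_eq_zero fun Z _ => ?_
  ext i
  exact i.elim0

theorem solDim_sp_gTest (l : List SBlock) (m : ℕ) :
    solDim (sp l) (gTest m) + psum (rPartS l) (m + 1) = (m + 1) * rPartS l 0 := by
  induction l with
  | nil => simp [solDim_sp_nil, rPartS_nil, hPart_nil, psum_const_zero]
  | cons b l ih =>
    rw [solDim_sp_cons, ← Multiset.cons_coe]
    rcases b.exists_eq with ⟨a, rfl⟩ | ⟨μ, h, rfl⟩
    · rw [rPartS_cons_M, psum_add, psum_ite_lt, solDim_M_gTest]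
      beta_reduce
      rw [if_pos (by omega), mul_add, ← ih]
      omega
    · rw [rPartS_cons_Hb, solDim_Hb_gTest, ← ih, zero_add]

theorem solDim_sp_jTest (l : List SBlock) (μ : Option ℂ) (m : ℕ) :
    solDim (sp l) (jTest μ m) = m * rPartS l 0 + 2 * psum (hPart l μ) m := by
  induction l with
  | nil => simp [solDim_sp_nil, rPartS_nil, hPart_nil, psum_const_zero]
  | cons b l ih =>
    rw [solDim_sp_cons, ← Multiset.cons_coe]
    rcases b.exists_eq with ⟨a, rfl⟩ | ⟨ν, h, rfl⟩
    · rw [rPartS_cons_M, hPart_cons_M, solDim_M_jTest]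
      beta_reduce
      rw [if_pos (by omega), mul_add, ih]
      ring
    · rw [rPartS_cons_Hb, solDim_Hb_jTest, ih]
      by_cases e : ν = μ
      · subst e
        rw [hPart_cons_Hb_self, psum_add, psum_ite_lt, if_pos rfl]
        ring
      · rw [hPart_cons_Hb_ne e, if_neg e, zero_add]

theorem isPartitionFun_ite (a : ℕ) : IsPartitionFun fun i => if i < a then 1 else 0 :=
  ⟨fun i => by dsimp only; split_ifs <;> omega, a, fun i hi => if_neg (by omega)⟩

theorem IsPartitionFun.add {p q : ℕ → ℕ} (hp : IsPartitionFun p) (hq : IsPartitionFun q) :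
    IsPartitionFun fun i => p i + q i := by
  obtain ⟨hp1, N, hN⟩ := hp
  obtain ⟨hq1, M, hM⟩ := hq
  exact ⟨fun i => Nat.add_le_add (hp1 i) (hq1 i), max N M, fun i hi => by
    beta_reduce
    rw [hN i (le_trans (le_max_left _ _) hi), hM i (le_trans (le_max_right _ _) hi)]⟩

theorem isPartitionFun_zero : IsPartitionFun fun _ => 0 := ⟨fun _ => le_rfl, 0, fun _ _ => rfl⟩

theorem IsPartitionFun.anti {p : ℕ → ℕ} (hp : IsPartitionFun p) {i j : ℕ} (h : i ≤ j) :
    p j ≤ p i := antitone_nat_of_succ_le hp.1 h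

theorem isPartitionFun_rPartS (s : Multiset SBlock) : IsPartitionFun (rPartS s) := by
  induction s using Multiset.induction_on with
  | empty => exact isPartitionFun_zero
  | cons b s ih =>
    rcases b.exists_eq with ⟨a, rfl⟩ | ⟨ν, h, rfl⟩
    · rw [rPartS_cons_M]
      exact (isPartitionFun_ite (a + 1)).add ih
    · rwa [rPartS_cons_Hb]

theorem isPartitionFun_hPart (s : Multiset SBlock) (μ : Option ℂ) :
    IsPartitionFun (hPart s μ) := by
  induction s using Multiset.induction_on with
  | empty => exact isPartitionFun_zero
  | cons b s ih =>
    rcases b.exists_eq with ⟨a, rfl⟩ | ⟨ν, h, rfl⟩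
    · rwa [hPart_cons_M]
    · by_cases e : ν = μ
      · subst e
        rw [hPart_cons_Hb_self]
        exact (isPartitionFun_ite h).add ih
      · rwa [hPart_cons_Hb_ne e]

/-- Eigenvalues lie in `E` and all block indices are below `N`. -/
def Bounded (s : Multiset SBlock) (E : Finset (Option ℂ)) (N : ℕ) : Prop :=
  (∀ b ∈ s, ∀ a, b = SBlock.M a → a < N) ∧ ∀ b ∈ s, ∀ μ h, b = Hb μ h → h ≤ N ∧ μ ∈ E

theorem exists_bounded (s : Multiset SBlock) : ∃ E N, Bounded s E N := by
  induction s using Multiset.induction_on with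
  | empty => exact ⟨∅, 0, by simp [Bounded]⟩
  | cons b s ih =>
    obtain ⟨E, N, h1, h2⟩ := ih
    rcases b.exists_eq with ⟨a, rfl⟩ | ⟨ν, h, rfl⟩
    · refine ⟨E, N + a + 1, fun b hb c hc => ?_, fun b hb μ h hc => ?_⟩
      · rcases Multiset.mem_cons.1 hb with e | hb
        · cases hc.symm.trans e; omega
        · have := h1 b hb c hc; omega
      · rcases Multiset.mem_cons.1 hb with e | hb
        · exact (Hb_ne_M (hc.symm.trans e)).elim
        · have := h2 b hb μ h hc; exact ⟨by omega, this.2⟩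
    · refine ⟨insert ν E, N + h, fun b hb c hc => ?_, fun b hb μ k hc => ?_⟩
      · rcases Multiset.mem_cons.1 hb with e | hb
        · exact (Hb_ne_M (e.symm.trans hc)).elim
        · have := h1 b hb c hc; omega
      · rcases Multiset.mem_cons.1 hb with e | hb
        · obtain ⟨rfl, rfl⟩ := Hb_inj.1 (hc.symm.trans e)
          exact ⟨by omega, Finset.mem_insert_self _ _⟩
        · have := h2 b hb μ k hc
          exact ⟨by omega, Finset.mem_insert_of_mem this.2⟩

theorem Bounded.mono {s : Multiset SBlock} {E E' : Finset (Option ℂ)} {N N' : ℕ}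
    (h : Bounded s E N) (hE : E ⊆ E') (hN : N ≤ N') : Bounded s E' N' :=
  ⟨fun b hb a e => lt_of_lt_of_le (h.1 b hb a e) hN,
    fun b hb μ k e => ⟨(h.2 b hb μ k e).1.trans hN, hE (h.2 b hb μ k e).2⟩⟩

theorem sizeSum_eq (l : List SBlock) (E : Finset (Option ℂ)) (N : ℕ) (h : Bounded l E N) :
    sizeSum l + rPartS l 0 = 2 * psum (rPartS l) N + 2 * ∑ μ ∈ E, psum (hPart l μ) N := by
  induction l with
  | nil => simp [sizeSum, rPartS_nil, hPart_nil, psum_const_zero]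
  | cons b l ih =>
    have ih := ih ⟨fun b hb => h.1 b (by simpa using Or.inr hb),
      fun b hb => h.2 b (by simpa using Or.inr hb)⟩
    rw [← Multiset.cons_coe, sizeSum]
    rcases b.exists_eq with ⟨a, rfl⟩ | ⟨ν, k, rfl⟩
    · have ha : a < N := h.1 _ (by simp) a rfl
      rw [rPartS_cons_M, psum_add, psum_ite_lt]
      beta_reduce
      rw [if_pos (by omega)]
      simp only [hPart_cons_M, SBlock.size]
      omega
    · obtain ⟨hk, hν⟩ := h.2 _ (by simp) ν k rfl
      rw [rPartS_cons_Hb, size_Hb]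
      have e : ∀ μ, psum (hPart (Hb ν k ::ₘ (l : Multiset SBlock)) μ) N =
          (if ν = μ then k else 0) + psum (hPart l μ) N := by
        intro μ
        by_cases e : ν = μ
        · subst e
          rw [hPart_cons_Hb_self, psum_add, psum_ite_lt, if_pos rfl, min_eq_left hk]
        · rw [hPart_cons_Hb_ne e, if_neg e, zero_add]
      simp only [e, Finset.sum_add_distrib, Finset.sum_ite_eq, if_pos hν]
      omega

theorem count_M (s : Multiset SBlock) (a : ℕ) :
    s.count (SBlock.M a) + rPartS s (a + 1) = rPartS s a := by
  induction s using Multiset.induction_on with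
  | empty => rfl
  | cons b s ih =>
    rcases b.exists_eq with ⟨c, rfl⟩ | ⟨ν, h, rfl⟩
    · rw [rPartS_cons_M, Multiset.count_cons]
      simp only [SBlock.M.injEq]
      split_ifs <;> omega
    · rw [rPartS_cons_Hb, Multiset.count_cons_of_ne (fun e => Hb_ne_M e.symm), ih]

theorem count_Hb (s : Multiset SBlock) (μ : Option ℂ) (i : ℕ) :
    s.count (Hb μ (i + 1)) + hPart s μ (i + 1) = hPart s μ i := by
  induction s using Multiset.induction_on with
  | empty => rfl
  | cons b s ih =>
    rcases b.exists_eq with ⟨c, rfl⟩ | ⟨ν, h, rfl⟩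
    · rw [hPart_cons_M, Multiset.count_cons_of_ne Hb_ne_M, ih]
    · by_cases e : ν = μ
      · subst e
        rw [hPart_cons_Hb_self, Multiset.count_cons]
        simp only [Hb_inj, true_and]
        split_ifs <;> omega
      · rw [hPart_cons_Hb_ne e, Multiset.count_cons_of_ne (fun h => e (Hb_inj.1 h).1.symm), ih]

/-- Two multisets have the same block structure, up to empty blocks. -/
def SameSt (s t : Multiset SBlock) : Prop := rPartS s = rPartS t ∧ ∀ μ, hPart s μ = hPart t μ

theorem SameSt.filter_eq {s t : Multiset SBlock} (h : SameSt s t) :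
    s.filter (fun b => b.valid) = t.filter (fun b => b.valid) := by
  ext b
  rw [Multiset.count_filter, Multiset.count_filter]
  rcases b.exists_eq with ⟨a, rfl⟩ | ⟨ν, k, rfl⟩
  · have h1 := count_M s a
    have h2 := count_M t a
    rw [h.1] at h1
    split_ifs <;> omega
  · cases k with
    | zero => simp [valid_Hb]
    | succ k =>
      have h1 := count_Hb s ν k
      have h2 := count_Hb t ν k
      rw [h.2] at h1
      split_ifs <;> omega

theorem SameSt.gcong {l l' : List SBlock} (h : SameSt l l') : GCong (sp l) (sp l') := by
  refine (sp_filter_valid l).trans (GCong.trans (sp_perm ?_) (sp_filter_valid l').symm)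
  have := h.filter_eq
  rw [← Multiset.coe_eq_coe]
  simpa [Multiset.filter_coe] using this

theorem GDeg.rank_le {l l' : List SBlock} (h : GDeg (sp l) (sp l')) (m : ℕ) :
    (∀ μ, m * rPartS l 0 + 2 * psum (hPart l μ) m ≤ m * rPartS l' 0 + 2 * psum (hPart l' μ) m) ∧
    m * rPartS l 0 + psum (rPartS l') m ≤ m * rPartS l' 0 + psum (rPartS l) m := by
  refine ⟨fun μ => ?_, ?_⟩
  · rw [← solDim_sp_jTest, ← solDim_sp_jTest]
    exact h.solDim_le _
  · cases m with
    | zero => simp [psum_zero]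
    | succ m =>
      have h1 := solDim_sp_gTest l m
      have h2 := solDim_sp_gTest l' m
      have h3 := h.solDim_le (gTest m)
      omega

/-- The numerical order on block structures induced by orbit closures. -/
structure BlockLe (l l' : List SBlock) : Prop where
  size : sizeSum l = sizeSum l'
  A : ∀ m, m * rPartS l 0 + psum (rPartS l') m ≤ m * rPartS l' 0 + psum (rPartS l) m
  B : ∀ μ m, m * rPartS l 0 + 2 * psum (hPart l μ) m ≤
    m * rPartS l' 0 + 2 * psum (hPart l' μ) m

theorem GDeg.blockLe {l l' : List SBlock} (hs : sizeSum l = sizeSum l') (h : GDeg (sp l) (sp l')) :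
    BlockLe l l' :=
  ⟨hs, fun m => (GDeg.rank_le h m).2, fun μ m => (GDeg.rank_le h m).1 μ⟩

section ShortExact

/-- A split short exact sequence of coordinate spaces. -/
structure SES (ι₁ ι ι₂ : Type) [Fintype ι₁] [Fintype ι] [Fintype ι₂]
    [DecidableEq ι₁] [DecidableEq ι₂] where
  i : Matrix ι ι₁ ℂ
  r : Matrix ι₁ ι ℂ
  p : Matrix ι₂ ι ℂ
  s : Matrix ι ι₂ ℂ
  ri : r * i = 1
  ps : p * s = 1
  pi : p * i = 0
  card : Fintype.card ι = Fintype.card ι₁ + Fintype.card ι₂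

variable {ι₁ ι ι₂ κ₁ κ κ₂ : Type} [Fintype ι₁] [Fintype ι] [Fintype ι₂]
  [Fintype κ₁] [Fintype κ] [Fintype κ₂] [DecidableEq ι₁] [DecidableEq ι] [DecidableEq ι₂]
  [DecidableEq κ₁] [DecidableEq κ] [DecidableEq κ₂]

theorem SES.exists_inverse (u : SES ι₁ ι ι₂) : ∃ r' : Matrix ι₁ ι ℂ,
    r' * u.i = 1 ∧ fromRows r' u.p * fromCols u.i u.s = 1 ∧
      fromCols u.i u.s * fromRows r' u.p = 1 := by
  have h1 : (u.r - u.r * u.s * u.p) * u.i = 1 := by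
    rw [Matrix.sub_mul, u.ri, Matrix.mul_assoc, u.pi, Matrix.mul_zero, sub_zero]
  have h2 : fromRows (u.r - u.r * u.s * u.p) u.p * fromCols u.i u.s = 1 := by
    rw [fromRows_mul_fromCols, h1, u.ps, u.pi, Matrix.sub_mul, Matrix.mul_assoc (u.r * u.s),
      u.ps, Matrix.mul_one, sub_self, fromBlocks_one]
  refine ⟨_, h1, h2, ?_⟩
  exact (Matrix.mul_eq_one_comm_of_card_eq _ _ _ (by rw [u.card, Fintype.card_sum])).1 h2

theorem rdeg_blockTriangular (X₁ : GP κ₁ ι₁) (X₂ : GP κ₂ ι₂) (N M : Matrix κ₁ ι₂ ℂ) :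
    RDeg ((fromBlocks X₁.1 N 0 X₂.1, fromBlocks X₁.2 M 0 X₂.2) : GP (κ₁ ⊕ κ₂) (ι₁ ⊕ ι₂))
      (gsum X₁ X₂) := by
  let g : ℂ → GP (κ₁ ⊕ κ₂) (ι₁ ⊕ ι₂) := fun ε =>
    (fromBlocks X₁.1 (ε • N) 0 X₂.1, fromBlocks X₁.2 (ε • M) 0 X₂.2)
  have hg : Continuous g := by
    refine Continuous.prodMk ?_ ?_ <;> refine Continuous.matrix_fromBlocks ?_ ?_ ?_ ?_ <;> fun_prop
  have h0 : gsum X₁ X₂ = g 0 := by simp [g, gsum]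
  have hmem : (0 : ℂ) ∈ closure {ε : ℂ | ε ≠ 0} := by
    have : Dense ({0}ᶜ : Set ℂ) := dense_compl_singleton 0
    exact this 0
  rw [h0]
  refine map_mem_closure hg hmem fun ε hε => ?_
  have e1 : ε * ε⁻¹ = 1 := mul_inv_cancel₀ hε
  have e2 : ε⁻¹ * ε = 1 := inv_mul_cancel₀ hε
  refine ⟨fromBlocks 1 0 0 (ε⁻¹ • 1), fromBlocks 1 0 0 (ε • 1), fromBlocks 1 0 0 (ε • 1),
    fromBlocks 1 0 0 (ε⁻¹ • 1), ?_⟩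
  simp [g, fromBlocks_multiply, smul_smul, e1, e2, fromBlocks_one]

theorem rdeg_of_exact {X₁ : GP κ₁ ι₁} {X : GP κ ι} {X₂ : GP κ₂ ι₂} (u : SES ι₁ ι ι₂)
    (v : SES κ₁ κ κ₂) (h1 : X.1 * u.i = v.i * X₁.1) (h2 : X.2 * u.i = v.i * X₁.2)
    (h3 : v.p * X.1 = X₂.1 * u.p) (h4 : v.p * X.2 = X₂.2 * u.p) : RDeg X (gsum X₁ X₂) := by
  obtain ⟨ru, hru, hu1, hu2⟩ := u.exists_inverse
  obtain ⟨rv, hrv, hv1, hv2⟩ := v.exists_inverse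
  have key : ∀ (A : Matrix κ ι ℂ) (A₁ : Matrix κ₁ ι₁ ℂ) (A₂ : Matrix κ₂ ι₂ ℂ),
      A * u.i = v.i * A₁ → v.p * A = A₂ * u.p →
      fromRows rv v.p * A * fromCols u.i u.s = fromBlocks A₁ (rv * A * u.s) 0 A₂ := by
    intro A A₁ A₂ ha hb
    rw [fromRows_mul, fromRows_mul_fromCols, hb, Matrix.mul_assoc A₂, Matrix.mul_assoc A₂,
      u.pi, u.ps, Matrix.mul_one, Matrix.mul_zero, Matrix.mul_assoc rv, ha, ← Matrix.mul_assoc,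
      hrv, Matrix.one_mul]
  have hreq : REq X ((fromBlocks X₁.1 (rv * X.1 * u.s) 0 X₂.1,
      fromBlocks X₁.2 (rv * X.2 * u.s) 0 X₂.2) : GP (κ₁ ⊕ κ₂) (ι₁ ⊕ ι₂)) :=
    ⟨fromRows rv v.p, fromCols v.i v.s, fromCols u.i u.s, fromRows ru u.p, hv1, hv2, hu2, hu1,
      key _ _ _ h1 h3, key _ _ _ h2 h4⟩
  have := rdeg_blockTriangular X₁ X₂ (rv * X.1 * u.s) (rv * X.2 * u.s)
  refine closure_mono ?_ this
  intro Y hY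
  exact hreq.trans hY

end ShortExact

/-- The zero-one matrix of a relation between indices. -/
def relMat (n m : ℕ) (P : ℕ → ℕ → Prop) : Matrix (Fin n) (Fin m) ℂ :=
  Matrix.of fun i j => if P i j then 1 else 0

theorem relMat_congr {n m : ℕ} {P Q : ℕ → ℕ → Prop}
    (h : ∀ i j, i < n → j < m → (P i j ↔ Q i j)) : relMat n m P = relMat n m Q := by
  ext i j
  exact if_congr (h i j i.2 j.2) rfl rfl

theorem relMat_one (n : ℕ) : relMat n n (fun i j => i = j) = 1 := by
  ext i j
  simp [relMat, Matrix.one_apply, Fin.ext_iff]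

theorem relMat_add {n m : ℕ} {P Q : ℕ → ℕ → Prop}
    (h : ∀ i j, i < n → j < m → ¬ (P i j ∧ Q i j)) :
    relMat n m P + relMat n m Q = relMat n m fun i j => P i j ∨ Q i j := by
  ext i j
  have := h i j i.2 j.2
  simp only [relMat, Matrix.add_apply, Matrix.of_apply]
  by_cases h1 : P i j <;> by_cases h2 : Q i j <;> simp_all

theorem relMat_mul {n m k : ℕ} (P Q : ℕ → ℕ → Prop) (g : ℕ → Prop) (f : ℕ → ℕ)
    (hQ : ∀ x j, x < m → j < k → (Q x j ↔ g j ∧ x = f j)) :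
    relMat n m P * relMat m k Q = relMat n k fun i j => g j ∧ f j < m ∧ P i (f j) := by
  ext i j
  rw [Matrix.mul_apply]
  have : ∀ x : Fin m, relMat n m P i x * relMat m k Q x j =
      if (x : ℕ) = f j then (if P i (f j) ∧ g j then 1 else 0) else 0 := by
    intro x
    have hx := hQ x j x.2 j.2
    simp only [relMat, Matrix.of_apply, hx]
    by_cases h1 : (x : ℕ) = f j
    · rw [h1]
      by_cases h2 : P i (f j) <;> by_cases h3 : g j <;> simp_all
    · simp [h1]
  rw [Finset.sum_congr rfl fun x _ => this x, sum_ite_val]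
  simp only [relMat, Matrix.of_apply]
  by_cases h1 : f j < m <;> by_cases h2 : P i (f j) <;> by_cases h3 : g j <;> simp [h1, h2, h3]

theorem relMat_mul_shift {n m k : ℕ} (P : ℕ → ℕ → Prop) (δ : ℕ) :
    relMat n m P * relMat m k (fun x j => x = j + δ) =
      relMat n k fun i j => j + δ < m ∧ P i (j + δ) := by
  rw [relMat_mul P _ (fun _ => True) (fun j => j + δ) (by simp)]
  simp

theorem relMat_mul_eq {n m k : ℕ} (P : ℕ → ℕ → Prop) :
    relMat n m P * relMat m k (fun x j => x = j) = relMat n k fun i j => j < m ∧ P i j :=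
  relMat_mul_shift P 0

theorem LTblk_eq (a : ℕ) :
    LTblk a = (relMat (a + 1) a fun i j => i = j + 1, relMat (a + 1) a fun i j => i = j + 0) := by
  refine Prod.ext ?_ ?_ <;> ext i j <;> simp [LTblk, relMat, Fmat, Gmat]

/-- Multiplication by `X` on `ℂ[X] / X ^ h`. -/
def nilBlk (h : ℕ) : GP (Fin h) (Fin h) :=
  (relMat h h fun i j => i = j + 1, relMat h h fun i j => i = j + 0)


/-- Multiplication of truncated polynomials, as a short exact sequence. -/
def sesI (a b : ℕ) (hab : a < b) : SES (Fin a) (Fin (a + 1) ⊕ Fin b) (Fin (b + 1)) where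
  i := fromRows (relMat (a + 1) a fun i j => i = j + 0) (-relMat b a fun i j => i = j + (b - a))
  r := fromCols (relMat a (a + 1) fun i j => j = i + 0) 0
  p := fromCols (relMat (b + 1) (a + 1) fun i j => i = j + (b - a))
    (relMat (b + 1) b fun i j => i = j + 0)
  s := fromRows (relMat (a + 1) (b + 1) fun i j => j = b ∧ i = a)
    (relMat b (b + 1) fun i j => j < b ∧ i = j)
  ri := by
    rw [fromCols_mul_fromRows, Matrix.zero_mul, add_zero, relMat_mul_shift, ← relMat_one]
    exact relMat_congr fun i j hi hj => by omega
  ps := by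
    rw [fromCols_mul_fromRows,
      relMat_mul _ _ (fun j => j = b) (fun _ => a) (by intros; rfl),
      relMat_mul _ _ (fun j => j < b) (fun j => j) (by intros; rfl), relMat_add, ← relMat_one]
    · exact relMat_congr fun i j hi hj => by omega
    · intros; omega
  pi := by
    rw [fromCols_mul_fromRows, Matrix.mul_neg, relMat_mul_shift, relMat_mul_shift,
      ← sub_eq_add_neg, sub_eq_zero]
    exact relMat_congr fun i j hi hj => by omega
  card := by simp only [Fintype.card_sum, Fintype.card_fin]; omega

/-- Multiplication and reduction of polynomials modulo powers of `X`, as a short exact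
sequence. -/
def sesII (c b : ℕ) (hbc : b < c) : SES (Fin (b + 1)) (Fin (c + 1) ⊕ Fin b) (Fin c) where
  i := fromRows (relMat (c + 1) (b + 1) fun i j => i = j + (c - b))
    (-relMat b (b + 1) fun i j => i = j + 0)
  r := fromCols (relMat (b + 1) (c + 1) fun i j => j = i + (c - b)) 0
  p := fromCols (relMat c (c + 1) fun i j => i = j + 0) (relMat c b fun i j => i = j + (c - b))
  s := fromRows (relMat (c + 1) c fun i j => i = j + 0) 0
  ri := by
    rw [fromCols_mul_fromRows, Matrix.zero_mul, add_zero, relMat_mul_shift, ← relMat_one]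
    exact relMat_congr fun i j hi hj => by omega
  ps := by
    rw [fromCols_mul_fromRows, Matrix.mul_zero, add_zero, relMat_mul_shift, ← relMat_one]
    exact relMat_congr fun i j hi hj => by omega
  pi := by
    rw [fromCols_mul_fromRows, Matrix.mul_neg, relMat_mul_shift, relMat_mul_shift,
      ← sub_eq_add_neg, sub_eq_zero]
    exact relMat_congr fun i j hi hj => by omega
  card := by simp only [Fintype.card_sum, Fintype.card_fin]; omega

/-- Multiplication by `X` and reduction modulo powers of `X`, as a short exact sequence. -/
def sesIII (c d : ℕ) : SES (Fin c) (Fin (c + 1) ⊕ Fin d) (Fin (d + 1)) where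
  i := fromRows (relMat (c + 1) c fun i j => i = j + 1) (-relMat d c fun i j => i = j + 0)
  r := fromCols (relMat c (c + 1) fun i j => j = i + 1) 0
  p := fromCols (relMat (d + 1) (c + 1) fun i j => i = j + 0)
    (relMat (d + 1) d fun i j => i = j + 1)
  s := fromRows (relMat (c + 1) (d + 1) fun i j => j = 0 ∧ i = 0)
    (relMat d (d + 1) fun i j => 1 ≤ j ∧ i = j - 1)
  ri := by
    rw [fromCols_mul_fromRows, Matrix.zero_mul, add_zero, relMat_mul_shift, ← relMat_one]
    exact relMat_congr fun i j hi hj => by omega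
  ps := by
    rw [fromCols_mul_fromRows,
      relMat_mul _ _ (fun j => j = 0) (fun _ => 0) (by intros; rfl),
      relMat_mul _ _ (fun j => 1 ≤ j) (fun j => j - 1) (by intros; rfl), relMat_add,
      ← relMat_one]
    · exact relMat_congr fun i j hi hj => by omega
    · intros; omega
  pi := by
    rw [fromCols_mul_fromRows, Matrix.mul_neg, relMat_mul_shift, relMat_mul_shift,
      ← sub_eq_add_neg, sub_eq_zero]
    exact relMat_congr fun i j hi hj => by omega
  card := by simp only [Fintype.card_sum, Fintype.card_fin]; omega

theorem rdegI (a b : ℕ) (hab : a < b) :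
    RDeg (gsum (LTblk (a + 1)) (LTblk b)) (gsum (LTblk a) (LTblk (b + 1))) := by
  refine rdeg_of_exact (sesI a b hab) (sesI (a + 1) (b + 1) (by omega)) ?_ ?_ ?_ ?_ <;>
    simp only [gsum, sesI, LTblk_eq, fromBlocks_mul_fromRows, fromRows_mul,
      fromCols_mul_fromBlocks, mul_fromCols, Matrix.zero_mul, Matrix.mul_zero, add_zero, zero_add,
      Matrix.neg_mul, Matrix.mul_neg, relMat_mul_shift,
      relMat_mul_eq, neg_zero]
  · exact congrArg₂ fromRows (relMat_congr fun i j hi hj => by omega)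
      (congrArg Neg.neg (relMat_congr fun i j hi hj => by omega))
  · exact congrArg₂ fromRows (relMat_congr fun i j hi hj => by omega)
      (congrArg Neg.neg (relMat_congr fun i j hi hj => by omega))
  · exact congrArg₂ fromCols (relMat_congr fun i j hi hj => by omega)
      (relMat_congr fun i j hi hj => by omega)
  · exact congrArg₂ fromCols (relMat_congr fun i j hi hj => by omega)
      (relMat_congr fun i j hi hj => by omega)

theorem rdegII (c b : ℕ) (hbc : b < c) :
    RDeg (gsum (nilBlk (c + 1)) (nilBlk b)) (gsum (nilBlk (b + 1)) (nilBlk c)) := by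
  refine rdeg_of_exact (sesII c b hbc) (sesII c b hbc) ?_ ?_ ?_ ?_ <;>
    simp only [gsum, sesII, nilBlk, fromBlocks_mul_fromRows, fromRows_mul,
      fromCols_mul_fromBlocks, mul_fromCols, Matrix.zero_mul, Matrix.mul_zero, add_zero, zero_add,
      Matrix.neg_mul, Matrix.mul_neg, relMat_mul_shift,
      relMat_mul_eq, neg_zero]
  · exact congrArg₂ fromRows (relMat_congr fun i j hi hj => by omega)
      (congrArg Neg.neg (relMat_congr fun i j hi hj => by omega))
  · exact congrArg₂ fromRows (relMat_congr fun i j hi hj => by omega)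
      (congrArg Neg.neg (relMat_congr fun i j hi hj => by omega))
  · exact congrArg₂ fromCols (relMat_congr fun i j hi hj => by omega)
      (relMat_congr fun i j hi hj => by omega)
  · exact congrArg₂ fromCols (relMat_congr fun i j hi hj => by omega)
      (relMat_congr fun i j hi hj => by omega)

theorem rdegIII (c d : ℕ) :
    RDeg (gsum (LTblk (c + 1)) (nilBlk d)) (gsum (LTblk c) (nilBlk (d + 1))) := by
  refine rdeg_of_exact (sesIII c d) (sesIII (c + 1) d) ?_ ?_ ?_ ?_ <;>
    simp only [gsum, sesIII, LTblk_eq, nilBlk, fromBlocks_mul_fromRows, fromRows_mul,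
      fromCols_mul_fromBlocks, mul_fromCols, Matrix.zero_mul, Matrix.mul_zero, add_zero, zero_add,
      Matrix.neg_mul, Matrix.mul_neg, relMat_mul_shift,
      relMat_mul_eq, neg_zero]
  · exact congrArg₂ fromRows (relMat_congr fun i j hi hj => by omega)
      (congrArg Neg.neg (relMat_congr fun i j hi hj => by omega))
  · exact congrArg₂ fromRows (relMat_congr fun i j hi hj => by omega)
      (congrArg Neg.neg (relMat_congr fun i j hi hj => by omega))
  · exact congrArg₂ fromCols (relMat_congr fun i j hi hj => by omega)
      (relMat_congr fun i j hi hj => by omega)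
  · exact congrArg₂ fromCols (relMat_congr fun i j hi hj => by omega)
      (relMat_congr fun i j hi hj => by omega)

section PointRank

variable {ι κ ι' κ' : Type} [Fintype ι'] [Fintype κ'] [DecidableEq ι'] [DecidableEq κ']
  [Fintype ι] [Fintype κ] [DecidableEq ι] [DecidableEq κ]

/-- The value of a pencil at a finite or infinite point. -/
def pt (μ : Option ℂ) (X : GP κ ι) : Matrix κ ι ℂ :=
  match μ with
  | some μ => X.1 - μ • X.2
  | none => X.2

theorem solDim_jTest_one (X : GP κ ι) (μ : Option ℂ) :
    solDim X (jTest μ 1) + (pt μ X).rank = Fintype.card ι := by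
  have hJ : ∀ c : ℂ, Jmat 1 c = c • 1 := by
    intro c
    ext i j
    fin_cases i
    fin_cases j
    simp [Jmat]
  have key : ∀ Z : Matrix ι (Fin 1) ℂ, Z ∈ LinearMap.ker (solMap X (jTest μ 1)) ↔
      pt μ X * Z = 0 := by
    intro Z
    rw [mem_ker_solMap]
    cases μ with
    | some μ =>
      simp only [jTest, hJ, pt, Matrix.mul_one, Matrix.mul_smul, Matrix.sub_mul, Matrix.smul_mul,
        sub_eq_zero]
    | none =>
      simp only [jTest, hJ, pt, Matrix.mul_one, zero_smul, Matrix.mul_zero, eq_comm]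
  have h2 : ∀ v : ι → ℂ, pt μ X * replicateCol (Fin 1) v = replicateCol (Fin 1) (pt μ X *ᵥ v) := by
    intro v
    ext i j
    rfl
  let e : LinearMap.ker (pt μ X).mulVecLin ≃ₗ[ℂ] LinearMap.ker (solMap X (jTest μ 1)) :=
    { toFun := fun v => ⟨replicateCol (Fin 1) v.1, by
        rw [key, h2]
        have := v.2
        rw [LinearMap.mem_ker, mulVecLin_apply] at this
        rw [this]
        rfl⟩
      invFun := fun Z => ⟨fun i => Z.1 i 0, by
        rw [LinearMap.mem_ker, mulVecLin_apply]
        have := (key Z.1).1 Z.2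
        ext i
        exact congrFun (congrFun this i) 0⟩
      map_add' := fun _ _ => rfl
      map_smul' := fun _ _ => rfl
      left_inv := fun _ => rfl
      right_inv := fun Z => by
        ext i j
        fin_cases j
        rfl }
  rw [solDim, ← e.finrank_eq, add_comm, Matrix.rank, LinearMap.finrank_range_add_finrank_ker,
    Module.finrank_fintype_fun_eq_card]

theorem pt_transpose (X : GP κ ι) (μ : Option ℂ) :
    pt μ ((X.1ᵀ, X.2ᵀ) : GP ι κ) = (pt μ X)ᵀ := by
  cases μ <;> simp [pt]

theorem solDim_sk_jTest_one (X : GP κ ι) (μ : Option ℂ) :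
    solDim (sk X) (jTest μ 1) + 2 * (pt μ X).rank = Fintype.card ι + Fintype.card κ := by
  have h1 := solDim_jTest_one X μ
  have h2 := solDim_jTest_one ((X.1ᵀ, X.2ᵀ) : GP ι κ) μ
  rw [pt_transpose, Matrix.rank_transpose] at h2
  rw [solDim_sk]
  omega

theorem exists_canonical_sk (X : GP κ ι) :
    ∃ l : List SBlock, (∀ b ∈ l, b.valid) ∧ GCong (sp l) (sk X) := by
  let e := (Fintype.equivFin (κ ⊕ ι)).symm
  have h := greidx_cong e (sk X)
  obtain ⟨l, hl, hc⟩ := exists_canonical (P := greidx e e (sk X)) (by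
    have h1 : (sk X).1ᵀ = -(sk X).1 := by simp [sk, fromBlocks_transpose, fromBlocks_neg]
    have h2 : (sk X).2ᵀ = -(sk X).2 := by simp [sk, fromBlocks_transpose, fromBlocks_neg]
    constructor
    · simp only [greidx, transpose_submatrix, h1]; rfl
    · simp only [greidx, transpose_submatrix, h2]; rfl)
  exact ⟨l, hl, hc.trans h.symm⟩

theorem GCong.sizeSum_eq {l : List SBlock} {P : GP ι ι} (h : GCong (sp l) P) :
    sizeSum l = Fintype.card ι := by
  simpa using h.card_eq

end PointRank

theorem eq_nil_of_parts {l : List SBlock} (hl : ∀ b ∈ l, b.valid) (hr : rPartS l 0 = 0)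
    (hh : ∀ μ, hPart l μ 0 = 0) : l = [] := by
  cases l with
  | nil => rfl
  | cons b l =>
    exfalso
    rcases b.exists_eq with ⟨a, rfl⟩ | ⟨μ, h, rfl⟩
    · rw [← Multiset.cons_coe, rPartS_cons_M] at hr
      simp at hr
    · have h1 := valid_Hb.1 (hl _ List.mem_cons_self)
      have := hh μ
      rw [← Multiset.cons_coe, hPart_cons_Hb_self] at this
      beta_reduce at this
      rw [if_pos (by omega)] at this
      omega

/-- A pencil of size `(q + 1) × q` without rank drops represents the block `M q`. -/
theorem sk_cong_M {κ ι : Type} [Fintype ι] [Fintype κ] [DecidableEq ι] [DecidableEq κ] {q : ℕ}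
    (Y : GP κ ι) (hι : Fintype.card ι = q) (hκ : Fintype.card κ = q + 1)
    (h : ∀ μ, (pt μ Y).rank = q) : GCong (sk Y) (SBlock.M q).toPencil := by
  obtain ⟨l, hl, hc⟩ := exists_canonical_sk Y
  have hsize := hc.sizeSum_eq
  rw [Fintype.card_sum, hι, hκ] at hsize
  have key : ∀ μ, rPartS l 0 + 2 * hPart l μ 0 = 1 := by
    intro μ
    have h1 := solDim_sk_jTest_one Y μ
    rw [← hc.solDim_eq, solDim_sp_jTest, hι, hκ, h μ, psum_succ, psum_zero] at h1
    omega
  have hr : rPartS l 0 = 1 := by have := key none; omega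
  have hh : ∀ μ, hPart l μ 0 = 0 := fun μ => by have := key μ; omega
  cases l with
  | nil => simp [rPartS_nil] at hr
  | cons b l =>
    rcases b.exists_eq with ⟨a, rfl⟩ | ⟨μ, h, rfl⟩
    · have hl' : l = [] := by
        refine eq_nil_of_parts (fun b hb => hl b (List.mem_cons_of_mem _ hb)) ?_ ?_
        · rw [← Multiset.cons_coe, rPartS_cons_M] at hr
          beta_reduce at hr
          rw [if_pos (by omega)] at hr
          omega
        · intro μ
          have := hh μ
          rwa [← Multiset.cons_coe, hPart_cons_M] at this
      subst hl'
      have ha : a = q := by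
        simp only [sizeSum, SBlock.size] at hsize
        omega
      subst ha
      refine hc.symm.trans ((sp_cons _ _).trans ((gsum_comm _ _).trans ?_))
      exact gsum_empty_left (ι := Fin 0) _ _
    · exfalso
      have h1 := valid_Hb.1 (hl _ List.mem_cons_self)
      have := hh μ
      rw [← Multiset.cons_coe, hPart_cons_Hb_self] at this
      beta_reduce at this
      rw [if_pos (by omega)] at this
      omega

section Mobius

variable {ι κ ι' κ' : Type} [Fintype ι'] [Fintype κ'] [DecidableEq ι'] [DecidableEq κ']
  [Fintype ι] [Fintype κ] [DecidableEq ι] [DecidableEq κ]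

/-- The change of parameter moving the eigenvalue zero to `μ`. -/
def mob (μ : Option ℂ) (X : GP κ ι) : GP κ ι :=
  match μ with
  | some μ => (X.1 + μ • X.2, X.2)
  | none => gswap X

theorem REq.mob {X : GP κ ι} {Y : GP κ' ι'} (h : REq X Y) (μ : Option ℂ) :
    REq (mob μ X) (mob μ Y) := by
  obtain ⟨S, S', R, R', h1, h2, h3, h4, h5, h6⟩ := h
  refine ⟨S, S', R, R', h1, h2, h3, h4, ?_, ?_⟩ <;> cases μ <;>
    simp [_root_.mob, gswap, Matrix.mul_add, Matrix.add_mul, h5, h6]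

theorem RDeg.mob {X : GP κ ι} {Y : GP κ' ι'} (h : RDeg X Y) (μ : Option ℂ) :
    RDeg (mob μ X) (mob μ Y) := by
  have hc : Continuous fun Q' : GP κ' ι' => _root_.mob μ Q' := by
    cases μ <;> simp only [_root_.mob, gswap] <;> fun_prop
  exact map_mem_closure hc h fun Q' hQ' => REq.mob hQ' μ

theorem mob_gsum (μ : Option ℂ) (X : GP κ ι) (Y : GP κ' ι') :
    mob μ (gsum X Y) = gsum (mob μ X) (mob μ Y) := by
  cases μ <;> simp [mob, gswap, gsum, fromBlocks_add, fromBlocks_smul]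

theorem exists_rank_pt_mob (X : GP κ ι) (μ ν : Option ℂ) :
    ∃ ν', (pt ν (mob μ X)).rank = (pt ν' X).rank := by
  cases μ with
  | some μ =>
    cases ν with
    | some ν =>
      refine ⟨some (ν - μ), congrArg _ ?_⟩
      simp only [pt, mob, sub_smul]
      abel
    | none => exact ⟨none, rfl⟩
  | none =>
    cases ν with
    | some ν =>
      by_cases h : ν = 0
      · exact ⟨none, congrArg _ (by simp [pt, mob, gswap, h])⟩
      · refine ⟨some ν⁻¹, ?_⟩
        rw [← Matrix.rank_smul_of_mem_nonZeroDivisors (c := -ν) (pt (some ν⁻¹) X)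
          (mem_nonZeroDivisors_of_ne_zero (by simpa using h))]
        refine congrArg _ ?_
        simp [pt, mob, gswap, smul_sub, smul_smul, h]
        abel
    | none => exact ⟨some 0, congrArg _ (by simp [pt, mob, gswap])⟩

end Mobius

theorem sk_mob_nilBlk_cong (μ : Option ℂ) (h : ℕ) :
    GCong (sk (mob μ (nilBlk h))) (Hb μ h).toPencil := by
  refine (sk_transpose _).trans ?_
  cases μ with
  | some μ =>
    refine GCong.trans ?_ (toPencil_Hb_some_cong h μ).symm
    suffices e : (((mob (some μ) (nilBlk h)).1ᵀ, (mob (some μ) (nilBlk h)).2ᵀ) : GP _ _) =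
        Eblk h μ by rw [e]; exact GCong.refl _
    refine Prod.ext ?_ ?_ <;> ext i j
    · simp only [Eblk, Jmat, mob, nilBlk, relMat, Matrix.transpose_apply, Matrix.add_apply,
        Matrix.smul_apply, Matrix.of_apply, smul_eq_mul]
      split_ifs <;> first | omega | simp
    · simp [Eblk, mob, nilBlk, relMat, Matrix.one_apply, Fin.ext_iff, eq_comm]
  | none =>
    refine GCong.trans ?_ (toPencil_Hb_none_cong h).symm
    suffices e : (((mob none (nilBlk h)).1ᵀ, (mob none (nilBlk h)).2ᵀ) : GP _ _) =
        EInfblk h by rw [e]; exact GCong.refl _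
    refine Prod.ext ?_ ?_ <;> ext i j
    · simp [EInfblk, mob, nilBlk, relMat, gswap, Matrix.one_apply, Fin.ext_iff, eq_comm]
    · simp only [EInfblk, Jmat, mob, nilBlk, relMat, gswap, Matrix.transpose_apply,
        Matrix.of_apply]
      split_ifs <;> first | omega | simp

theorem rank_pt_LTblk (c : ℕ) (μ : Option ℂ) : (pt μ (LTblk c)).rank = c := by
  have h := solDim_jTest_one (LTblk c) μ
  rw [solDim_LT_jTest, Fintype.card_fin] at h
  omega

theorem sk_mob_LTblk_cong (μ : Option ℂ) (c : ℕ) :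
    GCong (sk (mob μ (LTblk c))) (SBlock.M c).toPencil := by
  refine sk_cong_M _ (by simp) (by simp) fun ν => ?_
  obtain ⟨ν', h⟩ := exists_rank_pt_mob (LTblk c) μ ν
  rw [h, rank_pt_LTblk]

theorem sk_LTblk_cong (c : ℕ) : GCong (sk (LTblk c)) (SBlock.M c).toPencil :=
  sk_cong_M _ (by simp) (by simp) fun ν => rank_pt_LTblk c ν

theorem deg_M_M {a b : ℕ} (hab : a < b) :
    GDeg (sp [SBlock.M (a + 1), SBlock.M b]) (sp [SBlock.M a, SBlock.M (b + 1)]) := by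
  refine (sp_pair _ _).trans_deg (GDeg.trans_cong ?_ (sp_pair _ _).symm)
  refine ((sk_LTblk_cong _).symm.gsum (sk_LTblk_cong _).symm).trans_deg ?_
  refine GDeg.trans_cong ?_ ((sk_LTblk_cong _).gsum (sk_LTblk_cong _))
  exact (sk_gsum _ _).symm.trans_deg ((rdegI a b hab).sk.trans_cong (sk_gsum _ _))

theorem deg_H_H (μ : Option ℂ) {b c : ℕ} (hbc : b < c) :
    GDeg (sp [Hb μ (c + 1), Hb μ b]) (sp [Hb μ (b + 1), Hb μ c]) := by
  refine (sp_pair _ _).trans_deg (GDeg.trans_cong ?_ (sp_pair _ _).symm)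
  refine ((sk_mob_nilBlk_cong μ _).symm.gsum (sk_mob_nilBlk_cong μ _).symm).trans_deg ?_
  refine GDeg.trans_cong ?_ ((sk_mob_nilBlk_cong μ _).gsum (sk_mob_nilBlk_cong μ _))
  refine (sk_gsum _ _).symm.trans_deg (GDeg.trans_cong ?_ (sk_gsum _ _))
  rw [← mob_gsum, ← mob_gsum]
  exact ((rdegII c b hbc).mob μ).sk

theorem deg_M_H (μ : Option ℂ) (c d : ℕ) :
    GDeg (sp [SBlock.M (c + 1), Hb μ d]) (sp [SBlock.M c, Hb μ (d + 1)]) := by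
  refine (sp_pair _ _).trans_deg (GDeg.trans_cong ?_ (sp_pair _ _).symm)
  refine ((sk_mob_LTblk_cong μ _).symm.gsum (sk_mob_nilBlk_cong μ _).symm).trans_deg ?_
  refine GDeg.trans_cong ?_ ((sk_mob_LTblk_cong μ _).gsum (sk_mob_nilBlk_cong μ _))
  refine (sk_gsum _ _).symm.trans_deg (GDeg.trans_cong ?_ (sk_gsum _ _))
  rw [← mob_gsum, ← mob_gsum]
  exact ((rdegIII c d).mob μ).sk

theorem le_rank_of_det_submatrix {κ ι : Type} [Fintype ι] [Fintype κ] [DecidableEq ι]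
    [DecidableEq κ] {s : ℕ} (A : Matrix κ ι ℂ) (r : Fin s → κ) (c : Fin s → ι)
    (h : (A.submatrix r c).det ≠ 0) : s ≤ A.rank := by
  have h1 : A.submatrix r c = (1 : Matrix κ κ ℂ).submatrix r id * A *
      (1 : Matrix ι ι ℂ).submatrix id c := by
    ext i j
    simp [Matrix.mul_apply, Matrix.one_apply]
  have h2 : (A.submatrix r c).rank = s := by
    rw [Matrix.rank_of_isUnit _ ((Matrix.isUnit_iff_isUnit_det _).2 (isUnit_iff_ne_zero.2 h)),
      Fintype.card_fin]
  rw [← h2, h1]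
  exact (Matrix.rank_mul_le_left _ _).trans (Matrix.rank_mul_le_right _ _)

/-- The companion matrix with the given last column. -/
def compMat (c : ℕ → ℂ) (k : ℕ) : Matrix (Fin k) (Fin k) ℂ :=
  Matrix.of fun i j => if (j : ℕ) + 1 = k then -c i else if (i : ℕ) = j + 1 then 1 else 0

/-- The regular pencil built from a companion matrix, without the eigenvalue `ν`. -/
def cpencil (ν : ℂ) (c : ℕ → ℂ) (k : ℕ) : GP (Fin k) (Fin k) :=
  (1 + ν • compMat c k, compMat c k)

theorem exists_pt_cpencil (ν : ℂ) (c : ℕ → ℂ) (k : ℕ) (μ : Option ℂ) :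
    ∃ a b : ℂ, pt μ (cpencil ν c k) = a • 1 + b • compMat c k ∧ (b = 0 → a = 1) := by
  cases μ with
  | some μ =>
    refine ⟨1, ν - μ, ?_, fun _ => rfl⟩
    simp only [pt, cpencil, sub_smul, one_smul]
    abel
  | none => exact ⟨0, 1, by simp [pt, cpencil], fun h => by simp at h⟩

theorem det_submatrix_cpencil (c : ℕ → ℂ) (k s : ℕ) (a b : ℂ) (r e : Fin s → Fin k) (i₀ : ℕ)
    (hr : ∀ i, (r i : ℕ) = i₀ + i + 1) (he : ∀ i, (e i : ℕ) = i₀ + i) :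
    ((a • 1 + b • compMat c k).submatrix r e).det = b ^ s := by
  have hval : ∀ i j : Fin s, (a • 1 + b • compMat c k) (r i) (e j) =
      if (i : ℕ) = j then b else if (i : ℕ) + 1 = j then a else 0 := by
    intro i j
    have h1 := hr i
    have h2 := he j
    have h3 : ¬ (e j : ℕ) + 1 = k := by
      have := (r j).2
      rw [hr] at this
      omega
    simp only [compMat, Matrix.add_apply, Matrix.smul_apply, Matrix.of_apply, Matrix.one_apply,
      Fin.ext_iff, h3, if_false, h1, h2, smul_eq_mul]
    split_ifs <;> first | omega | simp
  rw [Matrix.det_of_isUpperTriangular]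
  · simp only [Matrix.submatrix_apply, hval, if_true, Finset.prod_const, Finset.card_univ,
      Fintype.card_fin]
  · intro i j hij
    simp only [id] at hij
    have : (j : ℕ) < i := hij
    rw [Matrix.submatrix_apply, hval, if_neg (by omega), if_neg (by omega)]

theorem le_rank_cpencil (ν : ℂ) (c : ℕ → ℂ) (k : ℕ) (μ : Option ℂ) :
    k ≤ (pt μ (cpencil ν c (k + 1))).rank := by
  obtain ⟨a, b, h, hab⟩ := exists_pt_cpencil ν c (k + 1) μ
  rw [h]
  by_cases hb : b = 0
  · rw [hb, hab hb, one_smul, zero_smul, add_zero, Matrix.rank_one, Fintype.card_fin]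
    omega
  · refine le_rank_of_det_submatrix _ (fun i => ⟨i + 1, by omega⟩) (fun i => ⟨i, by omega⟩) ?_
    rw [det_submatrix_cpencil c (k + 1) k a b _ _ 0 (fun i => by simp) (fun i => by simp)]
    exact pow_ne_zero _ hb

theorem rank_cpencil_self (ν : ℂ) (c : ℕ → ℂ) (k : ℕ) :
    (pt (some ν) (cpencil ν c k)).rank = k := by
  have : pt (some ν) (cpencil ν c k) = 1 := by simp [pt, cpencil]
  rw [this, Matrix.rank_one, Fintype.card_fin]

theorem rank_pt_submatrix {κ ι : Type} [Fintype ι] [Fintype κ] [DecidableEq ι]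
    [DecidableEq κ] (ν : ℂ) (c : ℕ → ℂ) (k s : ℕ) (i₀ : ℕ) (r : κ → Fin k) (e : ι → Fin k)
    (f : Fin s → κ) (f' : Fin s → κ) (g g' : Fin s → ι)
    (h1 : ∀ i, (r (f i) : ℕ) = i₀ + i + 1) (h2 : ∀ i, (e (g i) : ℕ) = i₀ + i)
    (h3 : ∀ i j, r (f' i) = e (g' j) ↔ i = j) (μ : Option ℂ) :
    s ≤ (pt μ (greidx r e (cpencil ν c k))).rank := by
  obtain ⟨a, b, h, hab⟩ := exists_pt_cpencil ν c k μ
  have h' : pt μ (greidx r e (cpencil ν c k)) = (a • 1 + b • compMat c k).submatrix r e := by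
    rw [← h]
    cases μ <;> rfl
  rw [h']
  by_cases hb : b = 0
  · refine le_rank_of_det_submatrix _ f' g' ?_
    have : (((a • 1 + b • compMat c k).submatrix r e).submatrix f' g') = 1 := by
      ext i j
      simp only [hb, hab hb, Matrix.submatrix_apply, one_smul, zero_smul, add_zero,
        Matrix.one_apply, h3]
    rw [this, det_one]
    exact one_ne_zero
  · refine le_rank_of_det_submatrix _ f g ?_
    rw [Matrix.submatrix_submatrix,
      det_submatrix_cpencil c k s a b (r ∘ f) (e ∘ g) i₀ h1 h2]
    exact pow_ne_zero _ hb

/-- A companion pencil degenerates to a sum of two blocks without eigenvalues. -/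
theorem deg_cpencil (ν : ℂ) (c : ℕ → ℂ) (t q : ℕ) :
    GDeg (sk (cpencil ν c (t + q + 1))) (sp [SBlock.M t, SBlock.M q]) := by
  let e₁ : Fin (t + 1) ⊕ Fin q ≃ Fin (t + q + 1) :=
    finSumFinEquiv.trans (finCongr (by omega))
  let e₂ : Fin t ⊕ Fin (q + 1) ≃ Fin (t + q + 1) :=
    finSumFinEquiv.trans (finCongr (by omega))
  let Y := cpencil ν c (t + q + 1)
  let r₁ : Fin (t + 1) → Fin (t + q + 1) := fun i => e₁ (Sum.inl i)
  let r₂ : Fin q → Fin (t + q + 1) := fun i => e₁ (Sum.inr i)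
  let c₁ : Fin t → Fin (t + q + 1) := fun i => e₂ (Sum.inl i)
  let c₂ : Fin (q + 1) → Fin (t + q + 1) := fun i => e₂ (Sum.inr i)
  have v1 : ∀ i, (r₁ i : ℕ) = i := fun i => by simp [r₁, e₁]
  have v2 : ∀ i, (r₂ i : ℕ) = t + 1 + i := fun i => by simp [r₂, e₁]
  have v3 : ∀ i, (c₁ i : ℕ) = i := fun i => by simp [c₁, e₂]
  have v4 : ∀ i, (c₂ i : ℕ) = t + i := fun i => by simp [c₂, e₂]
  let X₁ := greidx r₁ c₁ Y
  let X₂ := greidx r₂ c₂ Y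
  have hX : greidx e₁ e₂ Y =
      (fromBlocks X₁.1 (Y.1.submatrix r₁ c₂) 0 X₂.1, fromBlocks X₁.2 (Y.2.submatrix r₁ c₂) 0 X₂.2) := by
    have hz : ∀ (i : Fin q) (j : Fin t), compMat c (t + q + 1) (e₁ (Sum.inr i)) (e₂ (Sum.inl j)) = 0 := by
      intro i j
      have h1 := v2 i
      have h2 := v3 j
      have h3 := j.2
      simp only [r₂, c₁] at h1 h2
      rw [compMat, Matrix.of_apply, if_neg (by omega), if_neg (by omega)]
    refine Prod.ext ?_ ?_
    · ext i j
      rcases i with i | i <;> rcases j with j | j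
      · rfl
      · rfl
      · have h1 := v2 i
        have h2 := v3 j
        have h3 := j.2
        simp only [r₂, c₁] at h1 h2
        have h4 : e₁ (Sum.inr i) ≠ e₂ (Sum.inl j) := fun h => by
          have := congrArg Fin.val h
          omega
        simp [greidx, Y, cpencil, hz, Matrix.one_apply_ne h4]
      · rfl
    · ext i j
      rcases i with i | i <;> rcases j with j | j
      · rfl
      · rfl
      · simp [greidx, Y, cpencil, hz]
      · rfl
  have h1 : GCong (sk X₁) (SBlock.M t).toPencil := by
    refine sk_cong_M _ (by simp) (by simp) fun μ => le_antisymm ?_ ?_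
    · simpa using Matrix.rank_le_card_width (pt μ X₁)
    · refine rank_pt_submatrix ν c _ t 0 r₁ c₁ (fun i => i.succ) (fun i => i.castSucc) id id
        ?_ ?_ ?_ μ
      · intro i; simp [v1]
      · intro i; simp [v3]
      · intro i j; simp [Fin.ext_iff, v1, v3]
  have h2 : GCong (sk X₂) (SBlock.M q).toPencil := by
    refine (sk_transpose _).trans ?_
    refine sk_cong_M _ (by simp) (by simp) fun μ => ?_
    rw [pt_transpose, Matrix.rank_transpose]
    refine le_antisymm ?_ ?_
    · simpa using Matrix.rank_le_card_height (pt μ X₂)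
    · refine rank_pt_submatrix ν c _ q t r₂ c₂ id id (fun i => i.castSucc) (fun i => i.succ)
        ?_ ?_ ?_ μ
      · intro i; simp [v2]; omega
      · intro i; simp [v4]
      · intro i j; simp [Fin.ext_iff, v2, v4]; omega
  refine GDeg.trans_cong ?_ (sp_pair _ _).symm
  refine (GCong.trans_deg (greidx_req e₁ e₂ Y).sk ?_).trans_cong (h1.gsum h2)
  rw [hX]
  exact (rdeg_blockTriangular X₁ X₂ _ _).sk.trans_cong (sk_gsum _ _)

theorem det_sub_compMat (x : ℂ) (c : ℕ → ℂ) (k : ℕ) :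
    (x • 1 + (-1 : ℂ) • compMat c k).det = x ^ k + ∑ i ∈ Finset.range k, c i * x ^ i := by
  induction k generalizing c with
  | zero => simp
  | succ k ih =>
    rw [Finset.sum_range_succ']
    cases k with
    | zero => simp [compMat]
    | succ k =>
      rw [Matrix.det_succ_row_zero, Fintype.sum_eq_add 0 (Fin.last (k + 1))]
      · have h1 : (x • 1 + (-1 : ℂ) • compMat c (k + 1 + 1)).submatrix Fin.succ
            (Fin.succAbove 0) = x • 1 + (-1 : ℂ) • compMat (fun i => c (i + 1)) (k + 1) := by
          ext i j
          simp [compMat, Matrix.one_apply, Fin.ext_iff]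
        have h2 : ((x • 1 + (-1 : ℂ) • compMat c (k + 1 + 1)).submatrix Fin.succ
            (Fin.succAbove (Fin.last (k + 1)))).det = (-1) ^ (k + 1) := by
          refine det_submatrix_cpencil c _ _ x (-1) _ _ 0 (fun i => by simp) fun i => by simp
        rw [h1, ih, h2]
        have h3 : (x • 1 + (-1 : ℂ) • compMat c (k + 1 + 1)) 0 0 = x := by
          simp [compMat]
        have h4 : (x • 1 + (-1 : ℂ) • compMat c (k + 1 + 1)) 0 (Fin.last (k + 1)) = c 0 := by
          have h : (0 : Fin (k + 1 + 1)) ≠ Fin.last (k + 1) := Fin.ne_of_lt (Fin.last_pos)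
          rw [Matrix.add_apply, Matrix.smul_apply, Matrix.smul_apply, Matrix.one_apply_ne h]
          simp [compMat]
        have h5 : ((-1 : ℂ) ^ (k + 1)) * (-1) ^ (k + 1) = 1 := by
          rw [← mul_pow]; simp
        rw [h3, h4]
        simp only [Fin.val_zero, Fin.val_last, pow_zero, one_mul, mul_one]
        have h6 : (-1 : ℂ) ^ (k + 1) * c 0 * (-1) ^ (k + 1) = c 0 := by
          rw [mul_right_comm, h5, one_mul]
        rw [h6, mul_add, Finset.mul_sum, ← pow_succ', add_assoc]
        congr 2
        refine Finset.sum_congr rfl fun i _ => ?_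
        ring
      · simp [Fin.ext_iff]
      · rintro j ⟨h1, h2⟩
        have h3 : (j : ℕ) ≠ 0 := fun h => h1 (Fin.ext h)
        have h4 : (j : ℕ) ≠ k + 1 := fun h => h2 (Fin.ext h)
        have : (x • 1 + (-1 : ℂ) • compMat c (k + 1 + 1)) 0 j = 0 := by
          rw [Matrix.add_apply, Matrix.smul_apply, Matrix.smul_apply,
            Matrix.one_apply_ne (Ne.symm h1), compMat, Matrix.of_apply, if_neg (by omega),
            if_neg (by simp)]
          simp
        rw [this, mul_zero, zero_mul]

section DetAt

variable {ι κ : Type} [Fintype ι] [Fintype κ] [DecidableEq ι] [DecidableEq κ]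

/-- The determinant of a pencil along a line of parameters. -/
def detAt (ν x : ℂ) (P : GP ι ι) : ℂ := (x • P.1 - (1 + x * ν) • P.2).det

theorem GCong.detAt {P : GP ι ι} {Q : GP κ κ} (h : GCong P Q) (ν : ℂ) :
    ∃ c : ℂ, c ≠ 0 ∧ ∀ x, detAt ν x Q = c * detAt ν x P := by
  have e := Fintype.equivOfCardEq h.card_eq
  obtain ⟨S, T, h1, h2, h3, h4⟩ := h
  let S' : Matrix ι ι ℂ := S.submatrix id e
  let T' : Matrix ι ι ℂ := T.submatrix e id
  have h5 : S' * T' = 1 := by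
    have : S' * T' = S * T := by
      ext i j
      simp only [S', T', Matrix.mul_apply, Matrix.submatrix_apply, id]
      exact Equiv.sum_comp e fun a => S i a * T a j
    rw [this, h1]
  have h6 : S'.det ≠ 0 := fun h => by
    have := congrArg det h5
    rw [det_mul, h, zero_mul, det_one] at this
    exact zero_ne_one this
  refine ⟨S'.det * S'.det, mul_ne_zero h6 h6, fun x => ?_⟩
  have h7 : (x • Q.1 - (1 + x * ν) • Q.2).submatrix e e =
      S'ᵀ * (x • P.1 - (1 + x * ν) • P.2) * S' := by
    rw [← h3, ← h4]
    have : x • (Sᵀ * P.1 * S) - (1 + x * ν) • (Sᵀ * P.2 * S) =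
        Sᵀ * (x • P.1 - (1 + x * ν) • P.2) * S := by
      rw [Matrix.mul_sub, Matrix.sub_mul]
      simp only [Matrix.mul_smul, Matrix.smul_mul]
    rw [this]
    rfl
  rw [_root_.detAt, ← Matrix.det_submatrix_equiv_self e, h7, det_mul, det_mul, det_transpose,
    _root_.detAt]
  ring

theorem detAt_gsum (ν x : ℂ) (P : GP ι ι) (Q : GP κ κ) :
    detAt ν x (gsum P Q) = detAt ν x P * detAt ν x Q := by
  rw [detAt, detAt, detAt, ← det_fromBlocks_zero₂₁ _ 0]
  congr 1
  simp [gsum, Matrix.fromBlocks_smul, sub_eq_add_neg, Matrix.fromBlocks_neg,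
    Matrix.fromBlocks_add]

theorem detAt_sk (ν : ℂ) : ∃ c : ℂ, c ≠ 0 ∧ ∀ (X : GP ι ι) (x : ℂ),
    detAt ν x (sk X) = c * detAt ν x X ^ 2 := by
  refine ⟨(J ι ℂ).det, (isUnit_det_J ι ℂ).ne_zero, fun X x => ?_⟩
  have h1 : (x • (sk X).1 - (1 + x * ν) • (sk X).2) * J ι ℂ =
      fromBlocks (x • X.1 - (1 + x * ν) • X.2) 0 0 (x • X.1 - (1 + x * ν) • X.2)ᵀ := by
    simp only [sk, J, Matrix.fromBlocks_smul, sub_eq_add_neg, Matrix.fromBlocks_neg,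
      Matrix.fromBlocks_add, Matrix.fromBlocks_multiply]
    congr 1 <;> simp [Matrix.transpose_add, Matrix.transpose_smul, add_comm]
  have h2 := congrArg det h1
  rw [det_mul, det_fromBlocks_zero₂₁, det_transpose] at h2
  have h3 := J_det_mul_J_det ι ℂ
  rw [detAt, detAt, sq, ← h2, mul_comm (J ι ℂ).det, mul_assoc, h3, mul_one]

theorem detAt_cpencil (ν x : ℂ) (c : ℕ → ℂ) (k : ℕ) :
    detAt ν x (cpencil ν c k) = x ^ k + ∑ i ∈ Finset.range k, c i * x ^ i := by
  rw [← det_sub_compMat, detAt]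
  congr 1
  simp only [cpencil]
  module

end DetAt

/-- The eigenvalue parameter in the coordinate sending `ν` to infinity. -/
def tau (ν : ℂ) : Option ℂ → ℂ
  | some μ => (μ - ν)⁻¹
  | none => 0

theorem tau_inj {ν : ℂ} {μ μ' : Option ℂ} (h : μ ≠ some ν) (h' : μ' ≠ some ν)
    (e : tau ν μ = tau ν μ') : μ = μ' := by
  cases μ with
  | none =>
    cases μ' with
    | none => rfl
    | some μ' =>
      have : μ' - ν ≠ 0 := sub_ne_zero.2 fun e => h' (by rw [e])
      exact absurd e.symm (inv_ne_zero this)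
  | some μ =>
    have h1 : μ - ν ≠ 0 := sub_ne_zero.2 fun e => h (by rw [e])
    cases μ' with
    | none => exact absurd e (inv_ne_zero h1)
    | some μ' => simpa [tau, sub_left_inj] using e

theorem detAt_Hb {ν : ℂ} {μ : Option ℂ} (hμ : μ ≠ some ν) (h : ℕ) :
    ∃ c : ℂ, c ≠ 0 ∧ ∀ x, detAt ν x (Hb μ h).toPencil = c * ((x - tau ν μ) ^ h) ^ 2 := by
  obtain ⟨c₁, hc₁, h₁⟩ := detAt_sk (ι := Fin h) ν
  cases μ with
  | none =>
    obtain ⟨c₂, hc₂, h₂⟩ := (toPencil_Hb_none_cong h).symm.detAt ν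
    refine ⟨c₂ * c₁, mul_ne_zero hc₂ hc₁, fun x => ?_⟩
    rw [h₂, h₁, mul_assoc]
    congr 3
    rw [detAt, Matrix.det_of_isUpperTriangular]
    · simp [EInfblk, Jmat, tau]
    · intro i j hij
      have hij : (j : ℕ) < i := hij
      simp [EInfblk, Jmat, Matrix.one_apply, Fin.ext_iff, show ¬ (i : ℕ) = j by omega,
        show ¬ (j : ℕ) = i by omega, show ¬ (j : ℕ) = i + 1 by omega]
  | some μ =>
    have hne : μ - ν ≠ 0 := sub_ne_zero.2 fun e => hμ (by rw [e])
    obtain ⟨c₂, hc₂, h₂⟩ := (toPencil_Hb_some_cong h μ).symm.detAt ν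
    refine ⟨c₂ * (c₁ * ((μ - ν) ^ h) ^ 2), mul_ne_zero hc₂ (mul_ne_zero hc₁
      (pow_ne_zero _ (pow_ne_zero _ hne))), fun x => ?_⟩
    have : detAt ν x (Eblk h μ) = (μ - ν) ^ h * (x - tau ν (some μ)) ^ h := by
      rw [detAt, Matrix.det_of_isUpperTriangular]
      · simp only [Eblk, Jmat, tau, Matrix.sub_apply, Matrix.smul_apply, Matrix.of_apply,
          if_true, Matrix.one_apply_eq, Finset.prod_const, Finset.card_univ, Fintype.card_fin]
        rw [← mul_pow]
        congr 1
        simp only [smul_eq_mul]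
        field_simp
        ring
      · intro i j hij
        have hij : (j : ℕ) < i := hij
        simp [Eblk, Jmat, Matrix.one_apply, Fin.ext_iff, show ¬ (i : ℕ) = j by omega,
          show ¬ (j : ℕ) = i by omega, show ¬ (j : ℕ) = i + 1 by omega]
    rw [h₂, h₁, this]
    ring

/-- The roots of the determinant contributed by a block (each counted once instead of twice). -/
def broots (ν : ℂ) : SBlock → Multiset ℂ
  | SBlock.H h μ => Multiset.replicate h (tau ν (some μ))
  | SBlock.K h => Multiset.replicate h (tau ν none)
  | SBlock.M _ => 0

theorem broots_Hb (ν : ℂ) (μ : Option ℂ) (h : ℕ) :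
    broots ν (Hb μ h) = Multiset.replicate h (tau ν μ) := by
  cases μ <;> rfl

/-- The roots of the determinant of a regular sum of blocks. -/
def sroots (ν : ℂ) (l : List SBlock) : Multiset ℂ := (l.map (broots ν)).sum

theorem detAt_sp {ν : ℂ} {l : List SBlock} (hr : rPartS l 0 = 0)
    (hν : ∀ h, Hb (some ν) h ∉ l) : ∃ c : ℂ, c ≠ 0 ∧ ∀ x, detAt ν x (sp l) =
      c * (((sroots ν l).map fun a => Polynomial.X - Polynomial.C a).prod.eval x) ^ 2 := by
  induction l with
  | nil =>
    refine ⟨1, one_ne_zero, fun x => ?_⟩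
    have : detAt ν x (sp []) = 1 := Matrix.det_isEmpty (n := Fin 0)
    simp [this, sroots]
  | cons b l ih =>
    rw [← Multiset.cons_coe] at hr
    rcases b.exists_eq with ⟨a, rfl⟩ | ⟨μ, h, rfl⟩
    · rw [rPartS_cons_M] at hr
      simp at hr
    · rw [rPartS_cons_Hb] at hr
      obtain ⟨c₁, hc₁, h₁⟩ := ih hr fun h hm => hν h (List.mem_cons_of_mem _ hm)
      obtain ⟨c₂, hc₂, h₂⟩ := detAt_Hb (ν := ν) (μ := μ)
        (fun e => hν h (by rw [← e]; exact List.mem_cons_self)) h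
      obtain ⟨c₃, hc₃, h₃⟩ := (sp_cons (Hb μ h) l).symm.detAt ν
      refine ⟨c₃ * (c₂ * c₁), mul_ne_zero hc₃ (mul_ne_zero hc₂ hc₁), fun x => ?_⟩
      rw [h₃, detAt_gsum, h₂, h₁]
      simp only [sroots, List.map_cons, List.sum_cons, broots_Hb, Multiset.map_add,
        Multiset.prod_add, Multiset.map_replicate, Multiset.prod_replicate,
        Polynomial.eval_mul, Polynomial.eval_pow, Polynomial.eval_sub, Polynomial.eval_X,
        Polynomial.eval_C]
      ring

theorem card_sroots {ν : ℂ} {l : List SBlock} (hr : rPartS l 0 = 0) :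
    sizeSum l = 2 * Multiset.card (sroots ν l) := by
  induction l with
  | nil => rfl
  | cons b l ih =>
    rw [← Multiset.cons_coe] at hr
    rcases b.exists_eq with ⟨a, rfl⟩ | ⟨μ, h, rfl⟩
    · rw [rPartS_cons_M] at hr
      simp at hr
    · rw [rPartS_cons_Hb] at hr
      have := ih hr
      simp only [sizeSum, sroots, List.map_cons, List.sum_cons, broots_Hb, Multiset.card_add,
        Multiset.card_replicate, size_Hb] at this ⊢
      omega

theorem count_sroots {ν : ℂ} {l : List SBlock} (hν : ∀ h, Hb (some ν) h ∉ l) {μ : Option ℂ}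
    (hμ : μ ≠ some ν) {E : Finset (Option ℂ)} {N : ℕ} (hb : Bounded l E N) :
    (sroots ν l).count (tau ν μ) = psum (hPart l μ) N := by
  induction l with
  | nil => simp [sroots, hPart_nil, psum_const_zero]
  | cons b l ih =>
    have ih := ih (fun h hm => hν h (List.mem_cons_of_mem _ hm))
      ⟨fun b hm => hb.1 b (List.mem_cons_of_mem _ hm),
        fun b hm => hb.2 b (List.mem_cons_of_mem _ hm)⟩
    simp only [sroots, List.map_cons, List.sum_cons, Multiset.count_add] at ih ⊢
    rw [ih, ← Multiset.cons_coe]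
    rcases b.exists_eq with ⟨a, rfl⟩ | ⟨μ', h, rfl⟩
    · rw [hPart_cons_M]
      simp [broots]
    · rw [broots_Hb, Multiset.count_replicate]
      by_cases e : μ' = μ
      · subst e
        have h1 := (hb.2 _ List.mem_cons_self μ' h rfl).1
        rw [if_pos rfl, hPart_cons_Hb_self, psum_add, psum_ite_lt, min_eq_left h1]
      · rw [hPart_cons_Hb_ne e, if_neg, zero_add]
        exact fun h' => e (tau_inj (fun e' => hν h (by rw [← e']; exact List.mem_cons_self)) hμ h')

theorem IsPartitionFun.exists_indicator {p : ℕ → ℕ} (hp : IsPartitionFun p) (h0 : p 0 ≤ 1) :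
    ∃ a, p = fun i => if i < a then 1 else 0 := by
  obtain ⟨N, hN⟩ := hp.2
  have hex : ∃ a, p a = 0 := ⟨N, hN N le_rfl⟩
  refine ⟨Nat.find hex, funext fun i => ?_⟩
  split_ifs with hi
  · have h1 := Nat.find_min hex hi
    have h2 := hp.anti (Nat.zero_le i)
    omega
  · have h1 := hp.anti (not_lt.1 hi)
    rw [Nat.find_spec hex] at h1
    omega

theorem sroots_eq {ν : ℂ} {l l' : List SBlock} (hr : rPartS l 0 = 0) (hr' : rPartS l' 0 = 0)
    (hν : ∀ h, Hb (some ν) h ∉ l) (hν' : ∀ h, Hb (some ν) h ∉ l') {c : ℂ} (hc : c ≠ 0)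
    (h : ∀ x, detAt ν x (sp l') = c * detAt ν x (sp l)) : sroots ν l = sroots ν l' := by
  obtain ⟨c₁, hc₁, h₁⟩ := detAt_sp hr hν
  obtain ⟨c₂, hc₂, h₂⟩ := detAt_sp hr' hν'
  let f := ((sroots ν l).map fun a => Polynomial.X - Polynomial.C a).prod
  let f' := ((sroots ν l').map fun a => Polynomial.X - Polynomial.C a).prod
  have key : Polynomial.C c₂ * f' ^ 2 = Polynomial.C (c * c₁) * f ^ 2 := by
    refine Polynomial.funext fun x => ?_
    have h3 := h x
    rw [h₁, h₂] at h3
    simp only [Polynomial.eval_mul, Polynomial.eval_C, Polynomial.eval_pow]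
    rw [mul_assoc]
    exact h3
  have h4 := congrArg Polynomial.roots key
  rw [Polynomial.roots_C_mul _ hc₂, Polynomial.roots_C_mul _ (mul_ne_zero hc hc₁),
    Polynomial.roots_pow, Polynomial.roots_pow, Polynomial.roots_multiset_prod_X_sub_C,
    Polynomial.roots_multiset_prod_X_sub_C] at h4
  exact (nsmul_right_injective two_ne_zero h4).symm

/-- A regular sum of blocks with at most one block for each eigenvalue degenerates to a sum of
two blocks without eigenvalues. -/
theorem deg_regular {l : List SBlock} (hl : ∀ b ∈ l, b.valid) (hr : rPartS l 0 = 0)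
    (hh : ∀ μ, hPart l μ 0 ≤ 1) {t q : ℕ} (hsize : sizeSum l = 2 * (t + q + 1)) :
    GDeg (sp l) (sp [SBlock.M t, SBlock.M q]) := by
  obtain ⟨E, N, hb⟩ := exists_bounded l
  obtain ⟨ν, hνE⟩ := Infinite.exists_notMem_finset (Finset.eraseNone E)
  rw [Finset.mem_eraseNone] at hνE
  have hν : ∀ h, Hb (some ν) h ∉ l := fun h hm => hνE (hb.2 _ hm _ h rfl).2
  have hcard : Multiset.card (sroots ν l) = t + q + 1 := by
    have := card_sroots (ν := ν) hr
    omega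
  let f := ((sroots ν l).map fun a => Polynomial.X - Polynomial.C a).prod
  have hfm : f.Monic := Polynomial.monic_multiset_prod_of_monic _ _
    fun a _ => Polynomial.monic_X_sub_C a
  have hfd : f.natDegree = t + q + 1 := by
    rw [Polynomial.natDegree_multiset_prod_X_sub_C_eq_card, hcard]
  let Y := cpencil ν f.coeff (t + q + 1)
  have hY : ∀ x, detAt ν x Y = f.eval x := by
    intro x
    rw [detAt_cpencil, Polynomial.eval_eq_sum_range, hfd, add_comm,
      Finset.sum_range_succ _ (t + q + 1)]
    have : f.coeff (t + q + 1) = 1 := by rw [← hfd]; exact hfm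
    rw [this, one_mul]
  refine GCong.trans_deg ?_ (deg_cpencil ν f.coeff t q)
  obtain ⟨l', hl', hc⟩ := exists_canonical_sk Y
  refine GCong.trans ?_ hc
  have hsize' := hc.sizeSum_eq
  have hrank : ∀ μ, rPartS l' 0 + 2 * hPart l' μ 0 + 2 * (pt μ Y).rank =
      (t + q + 1) + (t + q + 1) := by
    intro μ
    have h1 := solDim_sk_jTest_one Y μ
    rw [← hc.solDim_eq, solDim_sp_jTest, psum_succ, psum_zero, Fintype.card_fin] at h1
    omega
  have hν0 : rPartS l' 0 = 0 ∧ hPart l' (some ν) 0 = 0 := by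
    have h1 := hrank (some ν)
    rw [rank_cpencil_self] at h1
    omega
  have hh' : ∀ μ, hPart l' μ 0 ≤ 1 := fun μ => by
    have h1 := hrank μ
    have h2 := le_rank_cpencil ν f.coeff (t + q) μ
    change _ ≤ (pt μ Y).rank at h2
    omega
  have hν' : ∀ h, Hb (some ν) h ∉ l' := by
    intro h hm
    obtain ⟨h, rfl⟩ : ∃ h', h = h' + 1 := ⟨h - 1, by have := valid_Hb.1 (hl' _ hm); omega⟩
    have h1 := count_Hb l' (some ν) h
    have h2 : 0 < (l' : Multiset SBlock).count (Hb (some ν) (h + 1)) :=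
      Multiset.count_pos.2 hm
    have h3 := (isPartitionFun_hPart l' (some ν)).anti (Nat.zero_le h)
    rw [hν0.2] at h3
    omega
  have hroots : sroots ν l = sroots ν l' := by
    obtain ⟨c₁, hc₁, h₁⟩ := detAt_sp hr hν
    obtain ⟨c₂, hc₂, h₂⟩ := detAt_sk (ι := Fin (t + q + 1)) ν
    obtain ⟨c₃, hc₃, h₃⟩ := hc.symm.detAt ν
    refine sroots_eq hr hν0.1 hν hν' (c := c₃ * c₂ / c₁)
      (div_ne_zero (mul_ne_zero hc₃ hc₂) hc₁) fun x => ?_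
    rw [h₃, h₂, h₁, hY]
    change _ = c₃ * c₂ / c₁ * (c₁ * f.eval x ^ 2)
    field_simp
  refine SameSt.gcong ⟨?_, fun μ => ?_⟩
  · funext i
    have h1 := (isPartitionFun_rPartS l).anti (Nat.zero_le i)
    have h2 := (isPartitionFun_rPartS l').anti (Nat.zero_le i)
    have := hν0.1
    omega
  · by_cases e : μ = some ν
    · subst e
      funext i
      have h1 := (isPartitionFun_hPart l (some ν)).anti (Nat.zero_le i)
      have h2 := (isPartitionFun_hPart l' (some ν)).anti (Nat.zero_le i)
      have h3 : hPart l (some ν) 0 = 0 := by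
        by_contra h0
        obtain ⟨a, ha⟩ := (isPartitionFun_hPart l (some ν)).exists_indicator (hh _)
        have h4 : 0 < a := by
          by_contra h4
          rw [ha] at h0
          exact h0 (if_neg h4)
        have h5 := count_Hb l (some ν) (a - 1)
        rw [ha] at h5
        beta_reduce at h5
        rw [if_neg (by omega), if_pos (by omega)] at h5
        have h6 : 0 < (l : Multiset SBlock).count (Hb (some ν) (a - 1 + 1)) := by omega
        exact hν _ (Multiset.count_pos.1 h6)
      have := hν0.2
      omega
    · obtain ⟨E', N', hb'⟩ := exists_bounded l'
      obtain ⟨a, ha⟩ := (isPartitionFun_hPart l μ).exists_indicator (hh μ)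
      obtain ⟨a', ha'⟩ := (isPartitionFun_hPart l' μ).exists_indicator (hh' μ)
      let M := N + N' + a + a'
      have h1 := count_sroots hν e (hb.mono (Finset.Subset.refl _) (show N ≤ M by omega))
      have h2 := count_sroots hν' e (hb'.mono (Finset.Subset.refl _) (show N' ≤ M by omega))
      rw [hroots, h2, ha, ha', psum_ite_lt, psum_ite_lt] at h1
      have : a = a' := by omega
      rw [ha, ha', this]

/-- Add a coin to column `d`. -/
def addAt (p : ℕ → ℕ) (d : ℕ) : ℕ → ℕ := fun i => if i = d then p i + 1 else p i

/-- Remove a coin from column `c`. -/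
def subAt (p : ℕ → ℕ) (c : ℕ) : ℕ → ℕ := fun i => if i = c then p i - 1 else p i

theorem psum_addAt (p : ℕ → ℕ) (d m : ℕ) :
    psum (addAt p d) m = psum p m + if d < m then 1 else 0 := by
  induction m with
  | zero => rfl
  | succ m ih =>
    rw [psum_succ, psum_succ, ih, addAt]
    split_ifs <;> omega

theorem psum_subAt {p : ℕ → ℕ} {c : ℕ} (hc : 1 ≤ p c) (m : ℕ) :
    psum (subAt p c) m + (if c < m then 1 else 0) = psum p m := by
  induction m with
  | zero => rfl
  | succ m ih =>
    rw [psum_succ, psum_succ, ← ih, subAt]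
    by_cases h : m = c
    · subst h
      simp
      omega
    · split_ifs <;> omega

theorem psum_mono (p : ℕ → ℕ) {m n : ℕ} (h : m ≤ n) : psum p m ≤ psum p n :=
  Finset.sum_le_sum_of_subset (Finset.range_subset_range.2 h)

theorem psum_eq_of_zero {p : ℕ → ℕ} {N m : ℕ} (hp : ∀ i, N ≤ i → p i = 0) (h : N ≤ m) :
    psum p m = psum p N := by
  induction m, h using Nat.le_induction with
  | base => rfl
  | succ m hm ih => rw [psum_succ, ih, hp m hm, add_zero]

theorem psum_le_of_zero {p : ℕ → ℕ} {N : ℕ} (hp : ∀ i, N ≤ i → p i = 0) (m : ℕ) :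
    psum p m ≤ psum p N := by
  rcases le_total m N with h | h
  · exact psum_mono p h
  · exact (psum_eq_of_zero hp h).le

theorem eq_of_psum_eq {p q : ℕ → ℕ} (h : ∀ m, psum p m = psum q m) : p = q := by
  funext i
  have h1 := h (i + 1)
  rw [psum_succ, psum_succ, h i] at h1
  exact Nat.add_left_cancel h1

theorem psum_congr {p q : ℕ → ℕ} {m : ℕ} (h : ∀ i, i < m → p i = q i) : psum p m = psum q m :=
  Finset.sum_congr rfl fun i hi => h i (Finset.mem_range.1 hi)

/-- First difference and first later agreement of the partial sums of comparable partitions. -/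
theorem exists_gap {p q : ℕ → ℕ} {N : ℕ} (h : ∀ m, psum q m ≤ psum p m)
    (hN : ∀ m, N ≤ m → psum p m = psum q m) (hne : p ≠ q) :
    ∃ j e, j + 1 < e ∧ (∀ i, i < j → p i = q i) ∧ q j < p j ∧ p (e - 1) < q (e - 1) ∧
      psum p e = psum q e ∧ ∀ m, j < m → m < e → psum q m < psum p m := by
  have hex : ∃ j, p j ≠ q j := Function.ne_iff.1 hne
  have hlt : ∀ i, i < Nat.find hex → p i = q i := fun i hi => not_not.1 (Nat.find_min hex hi)
  have hj := Nat.find_spec hex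
  set j := Nat.find hex
  have hj' : psum p j = psum q j := psum_congr hlt
  have hjlt : q j < p j := by
    have h1 := h (j + 1)
    rw [psum_succ, psum_succ, hj'] at h1
    omega
  have hex2 : ∃ e, j < e ∧ psum p e = psum q e := ⟨N + j + 1, by omega, hN _ (by omega)⟩
  have he := Nat.find_spec hex2
  have hmin : ∀ m, j < m → m < Nat.find hex2 → psum q m < psum p m := fun m h1 h2 =>
    lt_of_le_of_ne (h m) fun e => Nat.find_min hex2 h2 ⟨h1, e.symm⟩
  set e := Nat.find hex2
  have hje : j + 1 < e := by
    rcases Nat.lt_or_ge (j + 1) e with h1 | h1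
    · exact h1
    · have h2 : e = j + 1 := by omega
      have h3 := he.2
      rw [h2, psum_succ, psum_succ, hj'] at h3
      omega
  refine ⟨j, e, hje, hlt, hjlt, ?_, he.2, hmin⟩
  have h1 := hmin (e - 1) (by omega) (by omega)
  have h2 := he.2
  rw [show e = e - 1 + 1 by omega, psum_succ, psum_succ] at h2
  omega

/-- A step downwards in the dominance order. -/
theorem exists_move_down {p q : ℕ → ℕ} {N : ℕ} (hp : IsPartitionFun p) (hq : IsPartitionFun q)
    (h : ∀ m, psum q m ≤ psum p m) (hN : ∀ m, N ≤ m → psum p m = psum q m) (hne : p ≠ q) :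
    ∃ a k, a < k ∧ (p 0 = q 0 → 1 ≤ a) ∧ p (a + 1) < p a ∧ p k < p (k - 1) ∧
      (k = a + 1 → p k + 2 ≤ p a) ∧ ∀ m, a < m → m ≤ k → psum q m < psum p m := by
  obtain ⟨j, e, hje, hlt, hjlt, he, -, hmin⟩ := exists_gap h hN hne
  have hq' := hq.anti (show j ≤ e - 1 by omega)
  have hex1 : ∃ i, p i < p j := ⟨e - 1, by omega⟩
  have hex2 : ∃ i, p i + 2 ≤ p j := ⟨e - 1, by omega⟩
  have h1 := Nat.find_spec hex1
  have h2 := Nat.find_spec hex2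
  have h3 : ∀ i, i < Nat.find hex1 → p j ≤ p i := fun i hi => not_lt.1 (Nat.find_min hex1 hi)
  have h4 : ∀ i, i < Nat.find hex2 → p j < p i + 2 := fun i hi =>
    not_le.1 (Nat.find_min hex2 hi)
  have h5 : Nat.find hex2 ≤ e - 1 := Nat.find_min' hex2 (by omega)
  have h6 : Nat.find hex1 ≤ Nat.find hex2 := Nat.find_min' hex1 (by omega)
  set a := Nat.find hex1
  set k := Nat.find hex2
  have h7 : j < a := by
    by_contra h7
    have := hp.anti (not_lt.1 h7)
    omega
  refine ⟨a - 1, k, by omega, fun h0 => ?_, ?_, ?_, fun hk => ?_, fun m hm hm' =>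
    hmin m (by omega) (by omega)⟩
  · have : j ≠ 0 := fun e => by rw [e] at hjlt; omega
    omega
  · rw [show a - 1 + 1 = a by omega]
    have := h3 (a - 1) (by omega)
    omega
  · have := h4 (k - 1) (by omega)
    omega
  · have := h3 (a - 1) (by omega)
    omega

/-- A step upwards in the dominance order. -/
theorem exists_move_up {p q : ℕ → ℕ} {N : ℕ} (hq : IsPartitionFun q)
    (h : ∀ m, psum q m ≤ psum p m) (hp : IsPartitionFun p)
    (hN : ∀ m, N ≤ m → psum p m = psum q m) (hne : p ≠ q) :
    ∃ y z, y < z ∧ (1 ≤ y → q y < q (y - 1)) ∧ q (z + 1) < q z ∧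
      ∀ m, y < m → m ≤ z → psum q m < psum p m := by
  obtain ⟨j, e, hje, hlt, hjlt, he, hee, hmin⟩ := exists_gap h hN hne
  refine ⟨j, e - 1, by omega, fun hj => ?_, ?_, fun m h1 h2 => hmin m h1 (by omega)⟩
  · rw [← hlt (j - 1) (by omega)]
    exact hjlt.trans_le (hp.anti (by omega))
  · have h1 := h (e + 1)
    rw [psum_succ, psum_succ, hee] at h1
    have h2 := hp.1 (e - 1)
    rw [show e - 1 + 1 = e by omega] at h2 ⊢
    omega

theorem Bounded.of_cons {b : SBlock} {s : Multiset SBlock} {E : Finset (Option ℂ)} {N : ℕ}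
    (h : Bounded (b ::ₘ s) E N) : Bounded s E N :=
  ⟨fun c hc => h.1 c (Multiset.mem_cons_of_mem hc), fun c hc => h.2 c (Multiset.mem_cons_of_mem hc)⟩

theorem Bounded.rPartS_eq_zero {s : Multiset SBlock} {E : Finset (Option ℂ)} {N : ℕ}
    (h : Bounded s E N) {i : ℕ} (hi : N ≤ i) : rPartS s i = 0 := by
  induction s using Multiset.induction_on with
  | empty => rfl
  | cons b s ih =>
    rcases b.exists_eq with ⟨a, rfl⟩ | ⟨ν, k, rfl⟩
    · have := h.1 _ (Multiset.mem_cons_self _ _) a rfl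
      rw [rPartS_cons_M]
      beta_reduce
      rw [ih h.of_cons, if_neg (by omega)]
    · rw [rPartS_cons_Hb, ih h.of_cons]

theorem Bounded.hPart_eq_zero {s : Multiset SBlock} {E : Finset (Option ℂ)} {N : ℕ}
    (h : Bounded s E N) (μ : Option ℂ) {i : ℕ} (hi : N ≤ i) : hPart s μ i = 0 := by
  induction s using Multiset.induction_on with
  | empty => rfl
  | cons b s ih =>
    rcases b.exists_eq with ⟨a, rfl⟩ | ⟨ν, k, rfl⟩
    · rw [hPart_cons_M, ih h.of_cons]
    · have := (h.2 _ (Multiset.mem_cons_self _ _) ν k rfl).1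
      rw [hPart_cons_Hb]
      beta_reduce
      rw [ih h.of_cons, if_neg (by omega)]

theorem Bounded.hPart_eq_zero' {s : Multiset SBlock} {E : Finset (Option ℂ)} {N : ℕ}
    (h : Bounded s E N) {μ : Option ℂ} (hμ : μ ∉ E) (i : ℕ) : hPart s μ i = 0 := by
  induction s using Multiset.induction_on with
  | empty => rfl
  | cons b s ih =>
    rcases b.exists_eq with ⟨a, rfl⟩ | ⟨ν, k, rfl⟩
    · rw [hPart_cons_M, ih h.of_cons]
    · have := (h.2 _ (Multiset.mem_cons_self _ _) ν k rfl).2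
      rw [hPart_cons_Hb_ne (fun e => hμ (by rwa [e] at this)), ih h.of_cons]

theorem exists_bounded₂ (s t : Multiset SBlock) :
    ∃ E N, none ∈ E ∧ Bounded s E N ∧ Bounded t E N := by
  obtain ⟨E, N, h⟩ := exists_bounded s
  obtain ⟨E', N', h'⟩ := exists_bounded t
  refine ⟨insert none (E ∪ E'), N + N', Finset.mem_insert_self _ _, h.mono ?_ (by omega),
    h'.mono ?_ (by omega)⟩
  · exact Finset.subset_union_left.trans (Finset.subset_insert _ _)
  · exact Finset.subset_union_right.trans (Finset.subset_insert _ _)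

/-- The number of nonzero columns. -/
def plen (p : ℕ → ℕ) : ℕ := sInf {i | p i = 0}

theorem IsPartitionFun.lt_plen {p : ℕ → ℕ} (hp : IsPartitionFun p) {i : ℕ} :
    i < plen p ↔ p i ≠ 0 := by
  obtain ⟨N, hN⟩ := hp.2
  have hne : {i | p i = 0}.Nonempty := ⟨N, hN N le_rfl⟩
  constructor
  · exact fun h h' => Nat.notMem_of_lt_sInf (s := {i | p i = 0}) h h'
  · intro h
    by_contra h'
    have h1 := hp.anti (not_lt.1 h')
    have h2 : p (plen p) = 0 := Nat.sInf_mem hne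
    omega

/-- Remove the lowest row. -/
theorem IsPartitionFun.psum_sub_one {p : ℕ → ℕ} (hp : IsPartitionFun p) (m : ℕ) :
    psum (fun i => p i - 1) m + min (plen p) m = psum p m := by
  rw [← psum_ite_lt, ← psum_add]
  refine psum_congr fun i _ => ?_
  have := hp.lt_plen (i := i)
  split_ifs with h
  · have := this.1 h
    omega
  · have : p i = 0 := not_not.1 fun h' => h (this.2 h')
    omega

theorem exists_perm_pair {l : List SBlock} {b c : SBlock} (hb : b ∈ l) (hc : c ∈ l)
    (h : b = c → 2 ≤ l.count b) : ∃ r, l.Perm (b :: c :: r) := by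
  have h1 : c ∈ l.erase b := by
    by_cases e : b = c
    · have h2 := h e
      rw [← e, ← List.count_pos_iff, List.count_erase_self]
      omega
    · exact (List.mem_erase_of_ne (Ne.symm e)).2 hc
  exact ⟨(l.erase b).erase c, (List.perm_cons_erase hb).trans ((List.perm_cons_erase h1).cons _)⟩

/-- The contribution of a block to the potential, which increases along degenerations. -/
def bpot (n : ℤ) : SBlock → ℤ
  | SBlock.M m => (m : ℤ) ^ 2 + (n + 1) * (3 * n + 3)
  | SBlock.H h _ => h * (3 * n + 3 - h)
  | SBlock.K h => h * (3 * n + 3 - h)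

theorem bpot_Hb (n : ℤ) (μ : Option ℂ) (h : ℕ) : bpot n (Hb μ h) = h * (3 * n + 3 - h) := by
  cases μ <;> rfl

theorem bpot_M (n : ℤ) (m : ℕ) :
    bpot n (SBlock.M m) = (m : ℤ) ^ 2 + (n + 1) * (3 * n + 3) := rfl

theorem size_M (m : ℕ) : (SBlock.M m).size = m + (m + 1) := rfl

/-- A potential which increases along degenerations. -/
def pot (n : ℤ) (l : List SBlock) : ℤ := (l.map (bpot n)).sum

theorem pot_cons (n : ℤ) (b : SBlock) (l : List SBlock) : pot n (b :: l) = bpot n b + pot n l :=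
  List.sum_cons

theorem pot_append (n : ℤ) (l l' : List SBlock) : pot n (l ++ l') = pot n l + pot n l' := by
  rw [pot, List.map_append, List.sum_append]
  rfl

theorem pot_perm (n : ℤ) {l l' : List SBlock} (h : l.Perm l') : pot n l = pot n l' :=
  (h.map _).sum_eq

theorem sizeSum_perm {l l' : List SBlock} (h : l.Perm l') : sizeSum l = sizeSum l' := by
  simpa using (sp_perm h).card_eq

theorem sizeSum_append (l l' : List SBlock) : sizeSum (l ++ l') = sizeSum l + sizeSum l' := by
  simpa using (sp_append l l').card_eq

theorem pot_le (n : ℕ) (l : List SBlock) (h : sizeSum l ≤ n) :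
    pot n l ≤ (n + (n + 1) * (3 * n + 3)) * sizeSum l := by
  induction l with
  | nil => simp [pot, sizeSum]
  | cons b l ih =>
    rw [sizeSum] at h ⊢
    have ih := ih (by omega)
    rw [pot_cons]
    push_cast
    rw [mul_add]
    refine add_le_add ?_ ih
    rcases b.exists_eq with ⟨a, rfl⟩ | ⟨μ, k, rfl⟩
    · have h1 : (a : ℤ) ≤ n := by
        have : a ≤ n := by simp only [SBlock.size] at h; omega
        exact_mod_cast this
      have h2 : (0 : ℤ) ≤ a := by positivity
      have h3 : (0 : ℤ) ≤ n := by positivity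
      simp only [bpot, SBlock.size]
      push_cast
      nlinarith [mul_nonneg h2 h3, mul_nonneg h2 (mul_nonneg h3 h3), mul_nonneg h2 (sub_nonneg.2 h1)]
    · rw [size_Hb, bpot_Hb]
      have h2 : (0 : ℤ) ≤ k := by positivity
      have h3 : (0 : ℤ) ≤ n := by positivity
      push_cast
      nlinarith [mul_nonneg h2 h3, mul_nonneg h2 (mul_nonneg h3 h3), mul_nonneg h2 h2]

/-- A coin move of the partition `R`. -/
theorem exists_coinMove_M (l : List SBlock) (n : ℤ) {j k : ℕ} (hj : 1 ≤ j) (hjk : j < k)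
    (h1 : rPartS l (j + 1) < rPartS l j) (h2 : rPartS l k < rPartS l (k - 1))
    (h3 : k = j + 1 → rPartS l k + 2 ≤ rPartS l j) :
    ∃ l' : List SBlock, rPartS l' = addAt (subAt (rPartS l) j) k ∧
      (∀ μ, hPart l' μ = hPart l μ) ∧ GDeg (sp l) (sp l') ∧ pot n l < pot n l' := by
  obtain ⟨a, rfl⟩ : ∃ a, j = a + 1 := ⟨j - 1, by omega⟩
  obtain ⟨b, rfl⟩ : ∃ b, k = b + 1 := ⟨k - 1, by omega⟩
  have hab : a < b := by omega
  have hc1 := count_M l (a + 1)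
  have hc2 := count_M l b
  rw [Nat.add_sub_cancel] at h2
  rw [Multiset.coe_count] at hc1 hc2
  obtain ⟨r, hp⟩ := exists_perm_pair (l := l) (b := SBlock.M (a + 1)) (c := SBlock.M b)
    (List.count_pos_iff.1 (by omega)) (List.count_pos_iff.1 (by omega)) (fun e => by
      have e : a + 1 = b := SBlock.M.inj e
      have := h3 (by omega)
      rw [show a + 1 + 1 = b + 1 by omega] at hc1
      omega)
  have hs : (l : Multiset SBlock) = SBlock.M (a + 1) ::ₘ SBlock.M b ::ₘ (r : Multiset SBlock) :=
    Multiset.coe_eq_coe.2 hp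
  refine ⟨SBlock.M a :: SBlock.M (b + 1) :: r, ?_, fun μ => ?_, ?_, ?_⟩
  · rw [hs, ← Multiset.cons_coe, ← Multiset.cons_coe]
    simp only [rPartS_cons_M]
    funext i
    simp only [addAt, subAt]
    split_ifs <;> omega
  · rw [hs, ← Multiset.cons_coe, ← Multiset.cons_coe]
    simp only [hPart_cons_M]
  · exact (sp_perm hp).trans_deg (sp_deg_append r (deg_M_M hab))
  · rw [pot_perm n hp]
    simp only [pot_cons, bpot]
    have : (a : ℤ) < b := by exact_mod_cast hab
    push_cast
    nlinarith

theorem exists_virtual_Hb (l : List SBlock) (μ : Option ℂ) (d : ℕ)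
    (h : 1 ≤ d → hPart l μ d < hPart l μ (d - 1)) (n : ℤ) :
    ∃ l' : List SBlock, Hb μ d ∈ l' ∧ SameSt l l' ∧ pot n l' = pot n l ∧
      (∀ b ∈ l, b ∈ l') ∧ GCong (sp l) (sp l') := by
  cases d with
  | zero =>
    have hs : SameSt l (Hb μ 0 :: l : List SBlock) := by
      refine ⟨?_, fun ν => ?_⟩
      · rw [← Multiset.cons_coe, rPartS_cons_Hb]
      · rw [← Multiset.cons_coe, hPart_cons_Hb]
        simp
    exact ⟨Hb μ 0 :: l, List.mem_cons_self, hs, by simp [pot_cons, bpot_Hb],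
      fun b hb => List.mem_cons_of_mem _ hb, hs.gcong⟩
  | succ d =>
    have hc := count_Hb l μ d
    have := h (by omega)
    rw [Nat.add_sub_cancel] at this
    rw [Multiset.coe_count] at hc
    exact ⟨l, List.count_pos_iff.1 (by omega), ⟨rfl, fun _ => rfl⟩, rfl, fun b hb => hb,
      GCong.refl _⟩

/-- A leftward coin move of one of the partitions `J_μ`. -/
theorem exists_coinMove_H (l : List SBlock) (n : ℤ) (μ : Option ℂ) {j k : ℕ} (hjk : j < k)
    (h1 : 1 ≤ j → hPart l μ j < hPart l μ (j - 1)) (h2 : hPart l μ (k + 1) < hPart l μ k) :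
    ∃ l' : List SBlock, rPartS l' = rPartS l ∧ hPart l' μ = addAt (subAt (hPart l μ) k) j ∧
      (∀ ν, ν ≠ μ → hPart l' ν = hPart l ν) ∧ GDeg (sp l) (sp l') ∧ pot n l < pot n l' := by
  obtain ⟨l₀, hm, hsame, hpot, hsub, hcong⟩ := exists_virtual_Hb l μ j h1 n
  have hc := count_Hb l μ k
  rw [Multiset.coe_count] at hc
  obtain ⟨r, hp⟩ := exists_perm_pair (l := l₀) (b := Hb μ (k + 1)) (c := Hb μ j)
    (hsub _ (List.count_pos_iff.1 (by omega))) hm (fun e => by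
      have := (Hb_inj.1 e).2
      omega)
  have hs : (l₀ : Multiset SBlock) = Hb μ (k + 1) ::ₘ Hb μ j ::ₘ (r : Multiset SBlock) :=
    Multiset.coe_eq_coe.2 hp
  refine ⟨Hb μ (j + 1) :: Hb μ k :: r, ?_, ?_, fun ν hν => ?_, ?_, ?_⟩
  · rw [hsame.1, hs, ← Multiset.cons_coe, ← Multiset.cons_coe]
    simp only [rPartS_cons_Hb]
  · rw [hsame.2 μ, hs, ← Multiset.cons_coe, ← Multiset.cons_coe]
    simp only [hPart_cons_Hb_self]
    funext i
    simp only [addAt, subAt]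
    split_ifs <;> omega
  · rw [hsame.2 ν, hs, ← Multiset.cons_coe, ← Multiset.cons_coe]
    simp only [hPart_cons_Hb_ne (Ne.symm hν)]
  · exact (hcong.trans (sp_perm hp)).trans_deg (sp_deg_append r (deg_H_H μ hjk))
  · rw [← hpot, pot_perm n hp]
    simp only [pot_cons, bpot_Hb]
    have : (j : ℤ) < k := by exact_mod_cast hjk
    push_cast
    nlinarith

/-- Moving the last coin of `R` to `J_μ`. -/
theorem exists_coinMove_M_H (l : List SBlock) (n : ℕ) (hn : sizeSum l ≤ n) (μ : Option ℂ)
    {c d : ℕ} (hc : 1 ≤ c) (h1 : rPartS l (c + 1) < rPartS l c)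
    (h2 : 1 ≤ d → hPart l μ d < hPart l μ (d - 1)) :
    ∃ l' : List SBlock, rPartS l' = subAt (rPartS l) c ∧ hPart l' μ = addAt (hPart l μ) d ∧
      (∀ ν, ν ≠ μ → hPart l' ν = hPart l ν) ∧ GDeg (sp l) (sp l') ∧ pot n l < pot n l' := by
  obtain ⟨a, rfl⟩ : ∃ a, c = a + 1 := ⟨c - 1, by omega⟩
  obtain ⟨l₀, hm, hsame, hpot, hsub, hcong⟩ := exists_virtual_Hb l μ d h2 n
  have hc := count_M l (a + 1)
  rw [Multiset.coe_count] at hc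
  obtain ⟨r, hp⟩ := exists_perm_pair (l := l₀) (b := SBlock.M (a + 1)) (c := Hb μ d)
    (hsub _ (List.count_pos_iff.1 (by omega))) hm (fun e => absurd e.symm Hb_ne_M)
  have hs : (l₀ : Multiset SBlock) = SBlock.M (a + 1) ::ₘ Hb μ d ::ₘ (r : Multiset SBlock) :=
    Multiset.coe_eq_coe.2 hp
  refine ⟨SBlock.M a :: Hb μ (d + 1) :: r, ?_, ?_, fun ν hν => ?_, ?_, ?_⟩
  · rw [hsame.1, hs, ← Multiset.cons_coe, ← Multiset.cons_coe]
    simp only [rPartS_cons_M, rPartS_cons_Hb]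
    funext i
    simp only [subAt]
    split_ifs <;> omega
  · rw [hsame.2 μ, hs, ← Multiset.cons_coe, ← Multiset.cons_coe]
    simp only [hPart_cons_M, hPart_cons_Hb_self]
    funext i
    simp only [addAt]
    split_ifs <;> omega
  · rw [hsame.2 ν, hs, ← Multiset.cons_coe, ← Multiset.cons_coe]
    simp only [hPart_cons_M, hPart_cons_Hb_ne (Ne.symm hν)]
  · exact (hcong.trans (sp_perm hp)).trans_deg (sp_deg_append r (deg_M_H μ a d))
  · have hsz : sizeSum l = sizeSum l₀ := by simpa using hcong.card_eq
    rw [← hpot, pot_perm n hp]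
    rw [hsz, sizeSum_perm hp] at hn
    rw [sizeSum, sizeSum, size_Hb, size_M] at hn
    rw [pot_cons, pot_cons, pot_cons, pot_cons, bpot_Hb, bpot_Hb, bpot_M, bpot_M]
    have h1 : (2 * a + 2 * d + 3 : ℤ) ≤ n := by
      have : 2 * a + 2 * d + 3 ≤ n := by omega
      exact_mod_cast this
    push_cast
    nlinarith

theorem rPartS_add (s t : Multiset SBlock) (i : ℕ) :
    rPartS (s + t) i = rPartS s i + rPartS t i := by
  simp [rPartS, mWs, Multiset.filter_add]

theorem hPart_add (s t : Multiset SBlock) (μ : Option ℂ) (i : ℕ) :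
    hPart (s + t) μ i = hPart s μ i + hPart t μ i := by
  simp [hPart, jWs, Multiset.filter_add]

theorem rPartS_map_Hb (L : List (Option ℂ)) (f : Option ℂ → ℕ) :
    rPartS (L.map fun ν => Hb ν (f ν) : List SBlock) = fun _ => 0 := by
  induction L with
  | nil => exact rPartS_nil
  | cons ν L ih => rw [List.map_cons, ← Multiset.cons_coe, rPartS_cons_Hb, ih]

theorem hPart_map_Hb {L : List (Option ℂ)} (hL : L.Nodup) (f : Option ℂ → ℕ) (μ : Option ℂ)
    (i : ℕ) :
    hPart (L.map fun ν => Hb ν (f ν) : List SBlock) μ i = if μ ∈ L ∧ i < f μ then 1 else 0 := by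
  induction L with
  | nil => simp [hPart_nil]
  | cons ν L ih =>
    rw [List.nodup_cons] at hL
    rw [List.map_cons, ← Multiset.cons_coe, hPart_cons_Hb]
    beta_reduce
    rw [ih hL.2]
    by_cases h : ν = μ
    · subst h
      simp [hL.1]
    · simp [h, Ne.symm h]

theorem sizeSum_map_Hb (L : List (Option ℂ)) (f : Option ℂ → ℕ) :
    sizeSum (L.map fun ν => Hb ν (f ν)) = 2 * (L.map f).sum := by
  induction L with
  | nil => rfl
  | cons ν L ih =>
    rw [List.map_cons, sizeSum, ih, size_Hb, List.map_cons, List.sum_cons]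
    ring

theorem pot_map_Hb_le (n : ℕ) (L : List (Option ℂ)) (f : Option ℂ → ℕ) :
    pot n (L.map fun ν => Hb ν (f ν)) ≤ (3 * n + 3) * (L.map f).sum := by
  induction L with
  | nil => simp [pot]
  | cons ν L ih =>
    rw [List.map_cons, pot_cons, bpot_Hb, List.map_cons, List.sum_cons]
    rw [Nat.cast_add, mul_add]
    refine add_le_add ?_ ih
    nlinarith [mul_nonneg (Int.natCast_nonneg (f ν)) (Int.natCast_nonneg (f ν))]

/-- The blocks of largest index, one for each eigenvalue, degenerate to two `M`-blocks. -/
theorem exists_collapse (l : List SBlock) (n : ℕ) (hn : sizeSum l ≤ n) {L : List (Option ℂ)}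
    (hL : L.Nodup) (hpos : ∀ μ ∈ L, 0 < plen (hPart l μ))
    (hsupp : ∀ μ, hPart l μ 0 ≠ 0 → μ ∈ L) {t q : ℕ}
    (hsum : (L.map fun μ => plen (hPart l μ)).sum = t + q + 1) :
    ∃ l' : List SBlock,
      (rPartS l' = fun i => rPartS l i + (if i ≤ t then 1 else 0) + if i ≤ q then 1 else 0) ∧
      (∀ μ, hPart l' μ = fun i => hPart l μ i - 1) ∧ GDeg (sp l) (sp l') ∧
      pot n l < pot n l' := by
  set f : Option ℂ → ℕ := fun μ => plen (hPart l μ) with hf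
  set L₁ : List SBlock := L.map fun ν => Hb ν (f ν) with hL₁
  have hpart := fun μ => isPartitionFun_hPart (l : Multiset SBlock) μ
  have hmem : ∀ b ∈ L₁, b ∈ l := by
    intro b hb
    obtain ⟨μ, hμ, rfl⟩ := List.mem_map.1 hb
    have h1 := hpos μ hμ
    obtain ⟨a, ha⟩ : ∃ a, f μ = a + 1 := ⟨f μ - 1, by simp only [hf]; omega⟩
    have h2 := count_Hb l μ a
    have h3 : hPart l μ a ≠ 0 := (hpart μ).lt_plen.1 (by simp only [hf] at ha; omega)
    have h4 : ¬ hPart l μ (a + 1) ≠ 0 := fun h => by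
      have := (hpart μ).lt_plen.2 h
      simp only [hf] at ha
      omega
    rw [Multiset.coe_count] at h2
    beta_reduce
    rw [ha]
    exact List.count_pos_iff.1 (by omega)
  have hnodup : L₁.Nodup := hL.map_on fun μ hμ ν _ h => by
    have h' : Hb μ (f μ) = Hb ν (f ν) := h
    exact (Hb_inj.1 h').1
  obtain ⟨r, hr⟩ := Multiset.le_iff_exists_add.1
    (Multiset.coe_le.2 (List.subperm_of_subset hnodup hmem))
  obtain ⟨r, rfl⟩ : ∃ r' : List SBlock, (r' : Multiset SBlock) = r := Quot.exists_rep r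
  have hp : l.Perm (L₁ ++ r) := Multiset.coe_eq_coe.1 hr
  have hR : ∀ i, rPartS l i = rPartS r i := by
    intro i
    have : rPartS L₁ i = 0 := congrFun (rPartS_map_Hb L f) i
    rw [hr, rPartS_add, this, zero_add]
  have hH : ∀ μ i, hPart l μ i = (if μ ∈ L ∧ i < f μ then 1 else 0) + hPart r μ i := by
    intro μ i
    rw [← hPart_map_Hb hL f μ i, hr, hPart_add]
  have hsz : sizeSum L₁ = 2 * (t + q + 1) := by rw [hL₁, sizeSum_map_Hb, hsum]
  refine ⟨SBlock.M t :: SBlock.M q :: r, ?_, fun μ => ?_, ?_, ?_⟩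
  · funext i
    rw [hR, ← Multiset.cons_coe, ← Multiset.cons_coe, rPartS_cons_M, rPartS_cons_M]
    simp only [Nat.lt_succ_iff]
    omega
  · funext i
    rw [← Multiset.cons_coe, ← Multiset.cons_coe, hPart_cons_M, hPart_cons_M, hH]
    by_cases h : hPart l μ i = 0
    · have := hH μ i
      omega
    · have := (hpart μ).anti (Nat.zero_le i)
      rw [if_pos ⟨hsupp μ (by omega), (hpart μ).lt_plen.2 h⟩]
      omega
  · refine (sp_perm hp).trans_deg (sp_deg_append (l₁ := L₁) (l₂ := [SBlock.M t, SBlock.M q]) r ?_)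
    refine deg_regular (fun b hb => ?_) (congrFun (rPartS_map_Hb L f) 0) (fun μ => ?_) hsz
    · obtain ⟨μ, hμ, rfl⟩ := List.mem_map.1 hb
      exact valid_Hb.2 (hpos μ hμ)
    · rw [hPart_map_Hb hL]
      split_ifs <;> omega
  · rw [pot_perm n hp, pot_append, pot_cons, pot_cons, bpot_M, bpot_M]
    have h1 : pot n L₁ ≤ (3 * n + 3) * (t + q + 1 : ℕ) := by
      rw [← hsum]
      exact pot_map_Hb_le n L f
    rw [sizeSum_perm hp, sizeSum_append, hsz] at hn
    have h2 : (t + q + 1 : ℤ) ≤ n := by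
      have : t + q + 1 ≤ n := by omega
      exact_mod_cast this
    push_cast at h1
    nlinarith [sq_nonneg (t : ℤ), sq_nonneg (q : ℤ)]

theorem GDeg.sizeSum_eq {l l' : List SBlock} (h : GDeg (sp l) (sp l')) :
    sizeSum l = sizeSum l' := by
  obtain ⟨Q, hQ⟩ := closure_nonempty_iff.1 ⟨_, h⟩
  simpa using GCong.card_eq hQ

/-- `BlockLe`, with the difference of the numbers of `M`-blocks made explicit. -/
structure BlockLeBy (δ : ℕ) (l l' : List SBlock) : Prop where
  size : sizeSum l = sizeSum l'
  zero : rPartS l' 0 = rPartS l 0 + 2 * δ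
  A : ∀ m, psum (rPartS l') m ≤ 2 * (δ * m) + psum (rPartS l) m
  B : ∀ μ m, psum (hPart l μ) m ≤ δ * m + psum (hPart l' μ) m

theorem BlockLeBy.blockLe {δ : ℕ} {l l' : List SBlock} (h : BlockLeBy δ l l') : BlockLe l l' := by
  refine ⟨h.size, fun m => ?_, fun μ m => ?_⟩
  all_goals
    have e : m * rPartS l' 0 = m * rPartS l 0 + 2 * (δ * m) := by rw [h.zero]; ring
  · have := h.A m
    omega
  · have := h.B μ m
    omega

theorem BlockLe.zero_le {l l' : List SBlock} (h : BlockLe l l') : rPartS l 0 ≤ rPartS l' 0 := by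
  obtain ⟨E, N, -, hl, hl'⟩ := exists_bounded₂ (l : Multiset SBlock) l'
  by_contra! hlt
  have h1 := h.A (psum (rPartS l) N + 1)
  have h2 := psum_le_of_zero (p := rPartS l) (fun i hi => hl.rPartS_eq_zero hi) (psum (rPartS l) N + 1)
  have h3 := Nat.mul_le_mul_left (psum (rPartS l) N + 1) (Nat.succ_le_of_lt hlt)
  rw [Nat.mul_succ] at h3
  omega

theorem BlockLe.exists_by {l l' : List SBlock} (h : BlockLe l l') : ∃ δ, BlockLeBy δ l l' := by
  obtain ⟨E, N, -, hl, hl'⟩ := exists_bounded₂ (l : Multiset SBlock) l'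
  have h0 := h.zero_le
  have h1 := sizeSum_eq l E N hl
  have h2 := sizeSum_eq l' E N hl'
  rw [← h.size] at h2
  obtain ⟨δ, hδ⟩ : ∃ δ, rPartS l' 0 = rPartS l 0 + 2 * δ :=
    ⟨(rPartS l' 0 - rPartS l 0) / 2, by omega⟩
  refine ⟨δ, h.size, hδ, fun m => ?_, fun μ m => ?_⟩
  all_goals
    have e : m * rPartS l' 0 = m * rPartS l 0 + 2 * (δ * m) := by rw [hδ]; ring
  · have := h.A m
    omega
  · have := h.B μ m
    omega

theorem BlockLeBy.sum_eq {δ : ℕ} {l l' : List SBlock} (h : BlockLeBy δ l l')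
    {E : Finset (Option ℂ)} {N : ℕ} (hl : Bounded l E N) (hl' : Bounded l' E N) :
    psum (rPartS l) N + ∑ μ ∈ E, psum (hPart l μ) N + δ =
      psum (rPartS l') N + ∑ μ ∈ E, psum (hPart l' μ) N := by
  have h1 := sizeSum_eq l E N hl
  have h2 := sizeSum_eq l' E N hl'
  rw [← h.size, h.zero] at h2
  omega

theorem BlockLe.antisymm {l l' : List SBlock} (h : BlockLe l l') (h' : BlockLe l' l) :
    SameSt l l' := by
  have h0 := le_antisymm h.zero_le h'.zero_le
  refine ⟨eq_of_psum_eq fun m => ?_, fun μ => eq_of_psum_eq fun m => ?_⟩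
  · have h1 := h.A m
    have h2 := h'.A m
    rw [h0] at h1 h2
    omega
  · have h1 := h.B μ m
    have h2 := h'.B μ m
    rw [h0] at h1 h2
    omega

theorem IsPartitionFun.eq_zero_of_plen_le {p : ℕ → ℕ} (hp : IsPartitionFun p) {i : ℕ}
    (hi : plen p ≤ i) : p i = 0 := by
  by_contra h
  have := hp.lt_plen.2 h
  omega

theorem IsPartitionFun.psum_eq {p : ℕ → ℕ} (hp : IsPartitionFun p) {m : ℕ} (hm : plen p ≤ m) :
    psum p m = psum p (plen p) :=
  psum_eq_of_zero (fun _ hi => hp.eq_zero_of_plen_le hi) hm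

theorem IsPartitionFun.psum_le {p : ℕ → ℕ} (hp : IsPartitionFun p) (m : ℕ) :
    psum p m ≤ psum p (plen p) :=
  psum_le_of_zero (fun _ hi => hp.eq_zero_of_plen_le hi) m

theorem psum_lt_of_plen {p q : ℕ → ℕ} {d N : ℕ} (hq : IsPartitionFun q)
    (h : ∀ m, psum p m ≤ psum q m) (hd : ∀ i, d ≤ i → p i = 0) (hN : ∀ i, N ≤ i → p i = 0)
    (hlt : psum p N < psum q N) {m : ℕ} (hm : d < m) : psum p m < psum q m := by
  by_contra! hle
  have h1 := psum_eq_of_zero hd hm.le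
  have h2 := h d
  have h3 := psum_mono q (show d + 1 ≤ m from hm)
  rw [psum_succ] at h3
  have h4 : q d = 0 := by omega
  have h5 := psum_le_of_zero (p := q) (N := d)
    (fun i hi => Nat.eq_zero_of_le_zero (h4 ▸ hq.anti hi)) N
  have h6 := psum_le_of_zero hN d
  omega

/-- The elementary moves on block structures. -/
inductive Move (l l' : List SBlock) : Prop
  | I (j k : ℕ) (hj : 1 ≤ j) (hjk : j < k) (hp : 1 ≤ rPartS l j)
      (hr : rPartS l' = addAt (subAt (rPartS l) j) k) (hh : ∀ μ, hPart l' μ = hPart l μ)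
  | II (μ : Option ℂ) (j k : ℕ) (hjk : j < k) (hp : 1 ≤ hPart l μ k)
      (hr : rPartS l' = rPartS l) (hμ : hPart l' μ = addAt (subAt (hPart l μ) k) j)
      (hh : ∀ ν, ν ≠ μ → hPart l' ν = hPart l ν)
  | III (μ : Option ℂ) (c : ℕ) (hc : 1 ≤ c) (h1 : rPartS l c = 1) (h2 : rPartS l (c + 1) = 0)
      (hr : rPartS l' = subAt (rPartS l) c)
      (hμ : hPart l' μ = addAt (hPart l μ) (plen (hPart l μ)))
      (hh : ∀ ν, ν ≠ μ → hPart l' ν = hPart l ν)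
  | IV (L : List (Option ℂ)) (t q : ℕ) (hL : L.Nodup) (hpos : ∀ μ ∈ L, 0 < plen (hPart l μ))
      (hsupp : ∀ μ, hPart l μ 0 ≠ 0 → μ ∈ L)
      (hsum : (L.map fun μ => plen (hPart l μ)).sum = t + q + 1)
      (hi : ∀ i, rPartS l i ≠ 0 → i ≤ t ∧ i ≤ q) (htq : t ≤ q + 1) (hqt : q ≤ t + 1)
      (hr : rPartS l' = fun i => rPartS l i + (if i ≤ t then 1 else 0) + if i ≤ q then 1 else 0)
      (hh : ∀ μ, hPart l' μ = fun i => hPart l μ i - 1)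

/-- `l''` is obtained from `l` by an elementary move towards `l'`. -/
def Between (n : ℕ) (l l'' l' : List SBlock) : Prop :=
  Move l l'' ∧ GDeg (sp l) (sp l'') ∧ pot n l < pot n l'' ∧ BlockLe l'' l'

theorem BlockLeBy.move_I {δ n : ℕ} {l l' : List SBlock} (h : BlockLeBy δ l l') {j k : ℕ}
    (hj : 1 ≤ j) (hjk : j < k) (h1 : rPartS l (j + 1) < rPartS l j)
    (h2 : rPartS l k < rPartS l (k - 1)) (h3 : k = j + 1 → rPartS l k + 2 ≤ rPartS l j)
    (hs : ∀ m, j < m → m ≤ k → psum (rPartS l') m < 2 * (δ * m) + psum (rPartS l) m) :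
    ∃ l'', Between n l l'' l' := by
  obtain ⟨l'', hr, hh, hdeg, hpot⟩ := exists_coinMove_M l n hj hjk h1 h2 h3
  refine ⟨l'', .I j k hj hjk (by omega) hr hh, hdeg, hpot, BlockLeBy.blockLe (δ := δ) ?_⟩
  refine ⟨hdeg.sizeSum_eq.symm.trans h.size, ?_, fun m => ?_, fun μ m => by rw [hh]; exact h.B μ m⟩
  · rw [h.zero, hr]
    simp only [addAt, subAt]
    rw [if_neg (by omega), if_neg (by omega)]
  · have e1 := psum_subAt (p := rPartS l) (c := j) (by omega) m
    rw [hr, psum_addAt]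
    have h4 := h.A m
    have h5 := hs m
    split_ifs at e1 ⊢ <;> omega

theorem BlockLeBy.move_II {δ n : ℕ} {l l' : List SBlock} (h : BlockLeBy δ l l') (μ : Option ℂ)
    {j k : ℕ} (hjk : j < k) (h1 : 1 ≤ j → hPart l μ j < hPart l μ (j - 1))
    (h2 : hPart l μ (k + 1) < hPart l μ k)
    (hs : ∀ m, j < m → m ≤ k → psum (hPart l μ) m < δ * m + psum (hPart l' μ) m) :
    ∃ l'', Between n l l'' l' := by
  obtain ⟨l'', hr, hμ, hh, hdeg, hpot⟩ := exists_coinMove_H l n μ hjk h1 h2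
  refine ⟨l'', .II μ j k hjk (by omega) hr hμ hh, hdeg, hpot, BlockLeBy.blockLe (δ := δ) ?_⟩
  refine ⟨hdeg.sizeSum_eq.symm.trans h.size, by rw [hr, h.zero], fun m => by rw [hr]; exact h.A m,
    fun ν m => ?_⟩
  by_cases hν : ν = μ
  · subst hν
    have e1 := psum_subAt (p := hPart l ν) (c := k) (by omega) m
    rw [hμ, psum_addAt]
    have h4 := h.B ν m
    have h5 := hs m
    split_ifs at e1 ⊢ <;> omega
  · rw [hh ν hν]
    exact h.B ν m

theorem BlockLeBy.move_III {δ n : ℕ} {l l' : List SBlock} (h : BlockLeBy δ l l')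
    (hn : sizeSum l ≤ n) (μ : Option ℂ) {c : ℕ} (hc : 1 ≤ c) (h1 : rPartS l c = 1)
    (h2 : rPartS l (c + 1) = 0)
    (hs : ∀ m, c < m → psum (rPartS l') m < 2 * (δ * m) + psum (rPartS l) m)
    (hs' : ∀ m, plen (hPart l μ) < m → psum (hPart l μ) m < δ * m + psum (hPart l' μ) m) :
    ∃ l'', Between n l l'' l' := by
  obtain ⟨l'', hr, hμ, hh, hdeg, hpot⟩ := exists_coinMove_M_H l n hn μ (d := plen (hPart l μ)) hc
    (by omega) (fun hd => by
      have hp := isPartitionFun_hPart (l : Multiset SBlock) μ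
      have h3 := hp.eq_zero_of_plen_le le_rfl
      have h4 : hPart l μ (plen (hPart l μ) - 1) ≠ 0 := hp.lt_plen.1 (by omega)
      omega)
  refine ⟨l'', .III μ c hc h1 h2 hr hμ hh, hdeg, hpot, BlockLeBy.blockLe (δ := δ) ?_⟩
  refine ⟨hdeg.sizeSum_eq.symm.trans h.size, ?_, fun m => ?_, fun ν m => ?_⟩
  · rw [h.zero, hr]
    simp only [subAt]
    rw [if_neg (by omega)]
  · have e1 := psum_subAt (p := rPartS l) (c := c) (by omega) m
    rw [hr]
    have h4 := h.A m
    have h5 := hs m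
    split_ifs at e1 <;> omega
  · by_cases hν : ν = μ
    · subst hν
      rw [hμ, psum_addAt]
      have h4 := h.B ν m
      have h5 := hs' m
      split_ifs <;> omega
    · rw [hh ν hν]
      exact h.B ν m

/-- The last nonzero column of `R` loses a coin. -/
theorem BlockLeBy.move_last {δ n : ℕ} {l l' : List SBlock} (h : BlockLeBy δ l l')
    (hn : sizeSum l ≤ n) (hp : 2 ≤ plen (rPartS l))
    (hs : ∀ m, plen (rPartS l) ≤ m → psum (rPartS l') m < 2 * (δ * m) + psum (rPartS l) m)
    (hs' : ∃ μ, ∀ m, plen (hPart l μ) < m → psum (hPart l μ) m < δ * m + psum (hPart l' μ) m) :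
    ∃ l'', Between n l l'' l' := by
  have hr := isPartitionFun_rPartS (l : Multiset SBlock)
  obtain ⟨c, hc⟩ : ∃ c, plen (rPartS l) = c + 1 := ⟨plen (rPartS l) - 1, by omega⟩
  have h1 : rPartS l c ≠ 0 := hr.lt_plen.1 (by omega)
  have h2 : rPartS l (c + 1) = 0 := hr.eq_zero_of_plen_le hc.le
  rcases Nat.lt_or_ge 1 (rPartS l c) with h3 | h3
  · exact h.move_I (j := c) (k := c + 1) (by omega) (by omega) (by omega)
      (by rw [Nat.add_sub_cancel]; omega) (fun _ => by omega) fun m h4 _ => hs m (by omega)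
  · obtain ⟨μ, hμ⟩ := hs'
    exact h.move_III hn μ (c := c) (by omega) (by omega) h2 (fun m hm => hs m (by omega)) hμ

theorem BlockLeBy.exists_between_zero {n : ℕ} {l l' : List SBlock} (h : BlockLeBy 0 l l')
    (hne : ¬ SameSt l l') (hn : sizeSum l ≤ n) : ∃ l'', Between n l l'' l' := by
  obtain ⟨E, N, -, hl, hl'⟩ := exists_bounded₂ (l : Multiset SBlock) l'
  have hr := isPartitionFun_rPartS (l : Multiset SBlock)
  have hr' := isPartitionFun_rPartS (l' : Multiset SBlock)
  have hA : ∀ m, psum (rPartS l') m ≤ psum (rPartS l) m := fun m => by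
    have := h.A m
    omega
  have hB : ∀ μ m, psum (hPart l μ) m ≤ psum (hPart l' μ) m := fun μ m => by
    have := h.B μ m
    omega
  have h0 : rPartS l' 0 = rPartS l 0 := h.zero
  have hsum := h.sum_eq hl hl'
  have hle : ∑ μ ∈ E, psum (hPart l μ) N ≤ ∑ μ ∈ E, psum (hPart l' μ) N :=
    Finset.sum_le_sum fun μ _ => hB μ N
  have hrN : ∀ m, N ≤ m → psum (rPartS l) m = psum (rPartS l) N := fun m hm =>
    psum_eq_of_zero (fun i hi => hl.rPartS_eq_zero hi) hm
  have hrN' : ∀ m, N ≤ m → psum (rPartS l') m = psum (rPartS l') N := fun m hm =>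
    psum_eq_of_zero (fun i hi => hl'.rPartS_eq_zero hi) hm
  have hhN : ∀ μ m, N ≤ m → psum (hPart l μ) m = psum (hPart l μ) N := fun μ m hm =>
    psum_eq_of_zero (fun i hi => hl.hPart_eq_zero μ hi) hm
  have hhN' : ∀ μ m, N ≤ m → psum (hPart l' μ) m = psum (hPart l' μ) N := fun μ m hm =>
    psum_eq_of_zero (fun i hi => hl'.hPart_eq_zero μ hi) hm
  rcases (hA N).eq_or_lt with hS | hS
  · by_cases hrr : rPartS l = rPartS l'
    · have hη : ∃ μ, hPart l' μ ≠ hPart l μ := by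
        by_contra! hη
        exact hne ⟨hrr, fun μ => (hη μ).symm⟩
      obtain ⟨μ, hμ⟩ := hη
      have hμN : psum (hPart l' μ) N = psum (hPart l μ) N := by
        by_cases hμE : μ ∈ E
        · exact ((Finset.sum_eq_sum_iff_of_le fun ν _ => hB ν N).1 (by omega) μ hμE).symm
        · rw [show hPart l' μ = hPart l μ from funext fun i =>
            (hl'.hPart_eq_zero' hμE i).trans (hl.hPart_eq_zero' hμE i).symm]
      obtain ⟨y, z, hyz, h1, h2, h3⟩ := exists_move_up (N := N) (isPartitionFun_hPart l μ) (hB μ)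
        (isPartitionFun_hPart l' μ) (fun m hm => by rw [hhN μ m hm, hhN' μ m hm, hμN]) hμ
      exact h.move_II μ hyz h1 h2 fun m hm hm' => by
        have := h3 m hm hm'
        omega
    · obtain ⟨a, k, hak, h1, h2, h3, h4, h5⟩ := exists_move_down (N := N) hr hr' hA
        (fun m hm => by rw [hrN m hm, hrN' m hm, hS]) hrr
      exact h.move_I (h1 h0.symm) hak h2 h3 h4 fun m hm hm' => by
        have := h5 m hm hm'
        omega
  · refine h.move_last hn ?_ (fun m hm => ?_) ?_
    · by_contra! hp
      have h1 := psum_le_of_zero (p := rPartS l) (N := 1)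
        (fun i hi => hr.eq_zero_of_plen_le (by omega)) N
      have h2 := psum_le_of_zero (p := rPartS l') (fun i hi => hl'.rPartS_eq_zero hi) 1
      rw [psum_succ, psum_zero] at h1 h2
      omega
    · have h1 := hr.psum_eq hm
      have h2 := hr.psum_le N
      have h3 := psum_le_of_zero (p := rPartS l') (fun i hi => hl'.rPartS_eq_zero hi) m
      omega
    · obtain ⟨μ, -, hμ⟩ := Finset.exists_lt_of_sum_lt
        (show ∑ μ ∈ E, psum (hPart l μ) N < ∑ μ ∈ E, psum (hPart l' μ) N by omega)
      refine ⟨μ, fun m hm => ?_⟩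
      have := psum_lt_of_plen (isPartitionFun_hPart l' μ) (hB μ)
        (fun i hi => (isPartitionFun_hPart (l : Multiset SBlock) μ).eq_zero_of_plen_le hi)
        (fun i hi => hl.hPart_eq_zero μ hi) hμ hm
      omega

/-- The total number of coins in the longest rows. -/
theorem BlockLeBy.psum_le {δ : ℕ} {l l' : List SBlock} (h : BlockLeBy δ l l')
    {E : Finset (Option ℂ)} {N : ℕ} (hl : Bounded l E N) (hl' : Bounded l' E N) (m : ℕ) :
    psum (rPartS l') m ≤
      psum (rPartS l) N + δ * ((∑ μ ∈ E, plen (hPart l μ)) + 1) := by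
  have h1 := psum_le_of_zero (p := rPartS l') (fun i hi => hl'.rPartS_eq_zero hi) m
  have h2 := h.sum_eq hl hl'
  have h3 : ∑ μ ∈ E, psum (hPart l μ) N ≤
      ∑ μ ∈ E, (δ * plen (hPart l μ) + psum (hPart l' μ) N) := by
    refine Finset.sum_le_sum fun μ _ => ?_
    have h4 := h.B μ (plen (hPart l μ))
    have h5 := (isPartitionFun_hPart (l : Multiset SBlock) μ).psum_le N
    have h6 := psum_le_of_zero (p := hPart l' μ) (fun i hi => hl'.hPart_eq_zero μ hi)
      (plen (hPart l μ))
    omega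
  rw [Finset.sum_add_distrib, ← Finset.mul_sum] at h3
  rw [mul_add, mul_one]
  omega

theorem Bounded.exists_eigenvalue_list {l : List SBlock} {E : Finset (Option ℂ)} {N : ℕ}
    (hl : Bounded l E N) :
    ∃ L : List (Option ℂ), L.Nodup ∧ (∀ μ ∈ L, 0 < plen (hPart l μ)) ∧
      (∀ μ, hPart l μ 0 ≠ 0 → μ ∈ L) ∧
      (L.map fun μ => plen (hPart l μ)).sum = ∑ μ ∈ E, plen (hPart l μ) := by
  refine ⟨(E.filter fun μ => 0 < plen (hPart l μ)).toList, Finset.nodup_toList _, fun μ hμ => ?_,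
    fun μ hμ => ?_, ?_⟩
  · rw [Finset.mem_toList, Finset.mem_filter] at hμ
    exact hμ.2
  · rw [Finset.mem_toList, Finset.mem_filter]
    refine ⟨?_, (isPartitionFun_hPart (l : Multiset SBlock) μ).lt_plen.2 hμ⟩
    by_contra hE
    exact hμ (hl.hPart_eq_zero' hE 0)
  · rw [Finset.sum_map_toList]
    exact Finset.sum_filter_of_ne fun μ _ h => Nat.pos_of_ne_zero h

theorem BlockLeBy.exists_between_succ {δ n : ℕ} {l l' : List SBlock} (h : BlockLeBy (δ + 1) l l')
    (hn : sizeSum l ≤ n) : ∃ l'', Between n l l'' l' := by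
  obtain ⟨E, N, hE, hl, hl'⟩ := exists_bounded₂ (l : Multiset SBlock) l'
  have hr := isPartitionFun_rPartS (l : Multiset SBlock)
  have hr' := isPartitionFun_rPartS (l' : Multiset SBlock)
  have hh := fun μ => isPartitionFun_hPart (l : Multiset SBlock) μ
  have hS := h.psum_le hl hl'
  obtain ⟨L, hL, hpos, hsupp, hsum⟩ := hl.exists_eigenvalue_list
  rw [← hsum] at hS
  set k := (L.map fun μ => plen (hPart l μ)).sum with hk
  by_cases hIV : 1 ≤ k ∧ plen (rPartS l) ≤ (k - 1) / 2 + 1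
  · obtain ⟨t, q, htq, hqt, hkt⟩ : ∃ t q, t ≤ q ∧ q ≤ t + 1 ∧ k = t + q + 1 :=
      ⟨(k - 1) / 2, k - 1 - (k - 1) / 2, by omega, by omega, by omega⟩
    have hrt : plen (rPartS l) ≤ t + 1 := by omega
    obtain ⟨l'', h1, h2, hdeg, hpot⟩ := exists_collapse l n hn hL hpos hsupp (hk.symm.trans hkt)
    refine ⟨l'', .IV L t q hL hpos hsupp (hk.symm.trans hkt) (fun i hi => ?_) (by omega) hqt h1 h2,
      hdeg, hpot, BlockLeBy.blockLe (δ := δ) ?_⟩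
    · have := hr.lt_plen.2 hi
      omega
    refine ⟨hdeg.sizeSum_eq.symm.trans h.size, ?_, fun m => ?_, fun μ m => ?_⟩
    · rw [h.zero, h1]
      simp only [Nat.zero_le, if_true]
      ring
    · have e : psum (rPartS l'') m = psum (rPartS l) m + min (t + 1) m + min (q + 1) m := by
        rw [h1, psum_add, psum_add, ← psum_ite_lt, ← psum_ite_lt]
        simp only [Nat.lt_succ_iff]
      have h3 := h.A m
      rw [e]
      rw [add_mul, one_mul] at h3
      rcases le_or_gt m (t + 1) with hm | hm
      · omega
      · have h4 := hS m
        have h5 := hr.psum_eq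
          (show plen (rPartS l) ≤ m by omega)
        have h6 := hr.psum_le N
        have h7 := Nat.mul_le_mul_left δ (show k + 1 ≤ 2 * m by omega)
        rw [add_mul, one_mul] at h4
        rw [Nat.mul_left_comm] at h7
        omega
    · have e := (hh μ).psum_sub_one m
      have h3 := h.B μ m
      have h4 := h.B μ (plen (hPart l μ))
      rw [h2]
      rw [add_mul, one_mul] at h3 h4
      rcases le_or_gt m (plen (hPart l μ)) with hm | hm
      · omega
      · have h5 := (hh μ).psum_eq hm.le
        have h6 := psum_mono (hPart l' μ) hm.le
        have h7 := Nat.mul_le_mul_left δ hm.le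
        omega
  · have hp : 2 ≤ plen (rPartS l) ∧ k + 2 ≤ 2 * plen (rPartS l) := by
      by_contra! hp
      have hk0 : k = 0 ∧ plen (rPartS l) ≤ 1 := by omega
      have h1 := psum_le_of_zero (p := rPartS l) (N := 1)
        (fun i hi => hr.eq_zero_of_plen_le (by omega)) N
      have h2 := hS 1
      have h3 := h.zero
      rw [psum_succ, psum_zero] at h1 h2
      rw [hk0.1] at h2
      omega
    refine h.move_last hn hp.1 (fun m hm => ?_) ⟨none, fun m hm => ?_⟩
    · have h1 := hS m
      have h2 := hr.psum_eq hm
      have h3 := hr.psum_le N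
      have h4 := Nat.mul_le_mul_left (δ + 1) (show k + 2 ≤ 2 * m by omega)
      rw [Nat.mul_left_comm] at h4
      have h5 : (δ + 1) * (k + 2) = (δ + 1) * (k + 1) + (δ + 1) := by ring
      omega
    · have h1 := h.B none (plen (hPart l none))
      have h2 := (hh none).psum_eq hm.le
      have h3 := psum_mono (hPart l' none) hm.le
      have h4 := Nat.mul_le_mul_left (δ + 1) (Nat.succ_le_of_lt hm)
      rw [Nat.mul_succ] at h4
      omega

theorem BlockLe.exists_between {n : ℕ} {l l' : List SBlock} (h : BlockLe l l')
    (hne : ¬ SameSt l l') (hn : sizeSum l ≤ n) : ∃ l'', Between n l l'' l' := by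
  obtain ⟨δ, h⟩ := h.exists_by
  cases δ with
  | zero => exact h.exists_between_zero hne hn
  | succ δ => exact h.exists_between_succ hn

theorem BlockLe.gdeg {l l' : List SBlock} (h : BlockLe l l') : GDeg (sp l) (sp l') := by
  obtain ⟨n, hn⟩ : ∃ n, sizeSum l ≤ n := ⟨_, le_rfl⟩
  obtain ⟨B, hB⟩ : ∃ B : ℤ, ∀ l : List SBlock, sizeSum l ≤ n → pot n l ≤ B := by
    refine ⟨(n + (n + 1) * (3 * n + 3)) * n, fun l hl => (pot_le n l hl).trans ?_⟩
    refine mul_le_mul_of_nonneg_left (by exact_mod_cast hl) (by positivity)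
  obtain ⟨d, hd⟩ : ∃ d : ℕ, B - pot n l ≤ d := ⟨(B - pot n l).toNat, Int.self_le_toNat _⟩
  induction d generalizing l with
  | zero =>
    by_cases hs : SameSt l l'
    · exact hs.gcong.deg
    · obtain ⟨l'', -, hdeg, hpot, -⟩ := h.exists_between hs hn
      have := hB l'' (hdeg.sizeSum_eq ▸ hn)
      push_cast at hd
      omega
  | succ d ih =>
    by_cases hs : SameSt l l'
    · exact hs.gcong.deg
    · obtain ⟨l'', -, hdeg, hpot, h'⟩ := h.exists_between hs hn
      exact hdeg.trans (ih h' (hdeg.sizeSum_eq ▸ hn) (by push_cast at hd; omega))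

theorem transpose_skewPair {p q : ℕ} (X : Matrix (Fin p) (Fin q) ℂ) :
    (skewPair X)ᵀ = -skewPair X := by
  have h : (fromBlocks 0 X (-Xᵀ) 0)ᵀ = -fromBlocks 0 X (-Xᵀ) 0 := by
    rw [fromBlocks_transpose, fromBlocks_neg]
    simp
  rw [skewPair, transpose_submatrix, h]
  rfl

theorem isSkew_dsum {p q : ℕ} {P : Pencil p p} {Q : Pencil q q} (hP : P.IsSkew)
    (hQ : Q.IsSkew) : (Pencil.dsum P Q).IsSkew := by
  have h : ∀ (X : Matrix (Fin p) (Fin p) ℂ) (Y : Matrix (Fin q) (Fin q) ℂ), Xᵀ = -X → Yᵀ = -Y →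
      (fromBlocks X 0 0 Y)ᵀ = -fromBlocks X 0 0 Y := fun X Y hX hY => by
    rw [fromBlocks_transpose, fromBlocks_neg]
    simp [hX, hY]
  constructor
  · rw [Pencil.dsum, transpose_submatrix, h _ _ hP.1 hQ.1]
    rfl
  · rw [Pencil.dsum, transpose_submatrix, h _ _ hP.2 hQ.2]
    rfl

theorem isSkew_spencilOfList (l : List SBlock) : (spencilOfList l).IsSkew := by
  induction l with
  | nil => exact ⟨by ext i; exact i.elim0, by ext i; exact i.elim0⟩
  | cons b l ih =>
    refine isSkew_dsum ?_ ih
    cases b <;> exact ⟨transpose_skewPair _, transpose_skewPair _⟩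

/-- The cover relation on block structures. -/
def CoversL (l l' : List SBlock) : Prop :=
  ¬ SameSt l l' ∧ BlockLe l l' ∧
    ∀ l₁ : List SBlock, BlockLe l l₁ → BlockLe l₁ l' → SameSt l₁ l ∨ SameSt l₁ l'

theorem SameSt.symm {s t : Multiset SBlock} (h : SameSt s t) : SameSt t s :=
  ⟨h.1.symm, fun μ => (h.2 μ).symm⟩

theorem GDeg.blockLe_iff {l l' : List SBlock} : GDeg (sp l) (sp l') ↔ BlockLe l l' :=
  ⟨fun h => h.blockLe h.sizeSum_eq, fun h => h.gdeg⟩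

theorem gcong_iff_sameSt {l l' : List SBlock} : GCong (sp l) (sp l') ↔ SameSt l l' :=
  ⟨fun h => (GDeg.blockLe_iff.1 h.deg).antisymm (GDeg.blockLe_iff.1 h.symm.deg), fun h => h.gcong⟩

theorem congruent_iff_sameSt {n : ℕ} {P Q : Pencil n n} {l l' : List SBlock}
    (h : GCong (sp l) P) (h' : GCong (sp l') Q) : P.Congruent Q ↔ SameSt l l' := by
  rw [← gcong_iff_congruent, ← gcong_iff_sameSt]
  exact ⟨fun e => (h.trans e).trans h'.symm, fun e => (h.symm.trans e).trans h'⟩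

theorem orbC_subset_closure_iff_blockLe {n : ℕ} {P Q : Pencil n n} {l l' : List SBlock}
    (h : GCong (sp l) P) (h' : GCong (sp l') Q) :
    Q.orbC ⊆ closure P.orbC ↔ BlockLe l l' := by
  rw [orbC_subset_closure_iff, ← GDeg.blockLe_iff]
  exact ⟨fun e => h.trans_deg (e.trans_cong h'.symm),
    fun e => h.symm.trans_deg (e.trans_cong h')⟩

theorem coversC_iff_coversL {n : ℕ} {P Q : Pencil n n} {l l' : List SBlock}
    (h : GCong (sp l) P) (h' : GCong (sp l') Q) : P.CoversC Q ↔ CoversL l l' := by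
  have hn : sizeSum l = n := by simpa using h.card_eq
  subst hn
  rw [Pencil.CoversC, CoversL, congruent_iff_sameSt h h', orbC_subset_closure_iff_blockLe h h']
  refine and_congr_right' (and_congr_right' ⟨fun hc l₁ h₁ h₂ => ?_, ?_⟩)
  · by_contra! hs
    obtain ⟨R, hR, hRc⟩ : ∃ R : Pencil (sizeSum l) (sizeSum l), R.IsSkew ∧ GCong (sp l₁) R := by
      rw [h₁.size]
      exact ⟨_, isSkew_spencilOfList l₁, GCong.refl _⟩
    refine hc ⟨R, hR, ?_, ?_, ?_, ?_⟩
    · rw [congruent_iff_sameSt hRc h]; exact hs.1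
    · rw [congruent_iff_sameSt hRc h']; exact hs.2
    · rwa [orbC_subset_closure_iff_blockLe h hRc]
    · rwa [orbC_subset_closure_iff_blockLe hRc h']
  · rintro hc ⟨R, hR, hR1, hR2, hR3, hR4⟩
    obtain ⟨l₁, -, hl₁⟩ := exists_canonical hR
    rw [congruent_iff_sameSt hl₁ h] at hR1
    rw [congruent_iff_sameSt hl₁ h'] at hR2
    rw [orbC_subset_closure_iff_blockLe h hl₁] at hR3
    rw [orbC_subset_closure_iff_blockLe hl₁ h'] at hR4
    exact (hc l₁ hR3 hR4).elim hR1 hR2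

theorem psum_two_mul (p : ℕ → ℕ) (m : ℕ) : psum (fun i => 2 * p i) m = 2 * psum p m :=
  (Finset.mul_sum _ _ _).symm

theorem jPartS_eq_iff {s t : Multiset SBlock} {μ ν : Option ℂ} :
    jPartS s μ = jPartS t ν ↔ hPart s μ = hPart t ν := by
  constructor
  · intro h
    funext i
    have h1 := congrFun h i
    rw [jPartS_eq, jPartS_eq] at h1
    omega
  · intro h
    funext i
    rw [jPartS_eq, jPartS_eq, h]

theorem isPartitionFun_jPartS (s : Multiset SBlock) (μ : Option ℂ) :
    IsPartitionFun (jPartS s μ) := by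
  obtain ⟨h1, N, h2⟩ := isPartitionFun_hPart s μ
  refine ⟨fun i => ?_, N, fun i hi => ?_⟩
  · have := h1 i
    rw [jPartS_eq, jPartS_eq]
    omega
  · rw [jPartS_eq, h2 i hi]

theorem psum_move {p : ℕ → ℕ} {j : ℕ} (hj : 1 ≤ p j) (k m : ℕ) :
    psum (addAt (subAt p j) k) m + (if j < m then 1 else 0) =
      psum p m + if k < m then 1 else 0 := by
  rw [psum_addAt, ← psum_subAt hj m]
  omega

theorem move_apply_ne {p : ℕ → ℕ} {j k : ℕ} (hjk : j ≠ k) : addAt (subAt p j) k k = p k + 1 := by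
  simp [addAt, subAt, hjk.symm]

theorem dominates_move {p : ℕ → ℕ} {j k : ℕ} (hj : 1 ≤ p j) (hjk : j < k) :
    Dominates p (addAt (subAt p j) k) := by
  refine ⟨fun m => ?_, k + 1, fun m hm => ?_⟩
  all_goals
    have := psum_move hj k m
    split_ifs at this <;> omega

theorem dominates_move_left {p : ℕ → ℕ} {j k : ℕ} (hk : 1 ≤ p k) (hjk : j < k) :
    Dominates (addAt (subAt p k) j) p := by
  refine ⟨fun m => ?_, k + 1, fun m hm => ?_⟩
  all_goals
    have := psum_move hk j m
    split_ifs at this <;> omega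

theorem Move.not_sameSt {l l' : List SBlock} (h : Move l l') : ¬ SameSt l l' := by
  rintro ⟨h1, h2⟩
  cases h with
  | I j k _ hjk _ hr _ =>
    have := congrFun (h1.trans hr) k
    rw [move_apply_ne hjk.ne] at this
    omega
  | II μ j k hjk _ _ hμ _ =>
    have := congrFun ((h2 μ).trans hμ) j
    rw [move_apply_ne hjk.ne'] at this
    omega
  | III μ c _ hc _ hr _ _ =>
    have := congrFun (h1.trans hr) c
    simp only [subAt, if_true] at this
    omega
  | IV L t q _ _ _ _ _ _ _ hr _ =>
    have := congrFun (h1.trans hr) 0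
    simp only [Nat.zero_le, if_true] at this
    omega

theorem Move.congr_right {l l' l'' : List SBlock} (h : Move l l') (hs : SameSt l' l'') :
    Move l l'' := by
  obtain ⟨h1, h2⟩ := hs
  cases h with
  | I j k hj hjk hp hr hh => exact .I j k hj hjk hp (h1 ▸ hr) fun μ => h2 μ ▸ hh μ
  | II μ j k hjk hp hr hμ hh =>
    exact .II μ j k hjk hp (h1 ▸ hr) (h2 μ ▸ hμ) fun ν hν => h2 ν ▸ hh ν hν
  | III μ c hc h3 h4 hr hμ hh =>
    exact .III μ c hc h3 h4 (h1 ▸ hr) (h2 μ ▸ hμ) fun ν hν => h2 ν ▸ hh ν hν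
  | IV L t q hL hpos hsupp hsum hi htq hqt hr hh =>
    exact .IV L t q hL hpos hsupp hsum hi htq hqt (h1 ▸ hr) fun μ => h2 μ ▸ hh μ

theorem CoversL.move {l l' : List SBlock} (h : CoversL l l') : Move l l' := by
  obtain ⟨l'', hm, hdeg, -, hle⟩ := h.2.1.exists_between h.1 le_rfl
  rcases h.2.2 l'' (GDeg.blockLe_iff.1 hdeg) hle with hs | hs
  · exact absurd hs.symm hm.not_sameSt
  · exact hm.congr_right hs

theorem CoversL.eq_of_rPartS_between {l l' : List SBlock} (h : CoversL l l')
    (h0 : rPartS l' 0 = rPartS l 0) (hh : ∀ μ, hPart l' μ = hPart l μ) {p : ℕ → ℕ}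
    (hp : IsPartitionFun p) (h1 : Dominates (rPartS l) p) (h2 : Dominates p (rPartS l')) :
    p = rPartS l ∨ p = rPartS l' := by
  refine or_iff_not_imp_left.2 fun hne => ?_
  obtain ⟨N, hN⟩ := h1.2
  obtain ⟨a, k, hak, ha, h3, h4, h5, h6⟩ := exists_move_down
    (isPartitionFun_rPartS (l : Multiset SBlock)) hp h1.1 hN (Ne.symm hne)
  have hp0 : rPartS l 0 = p 0 := by
    have h7 := h1.1 1
    have h8 := h2.1 1
    simp only [psum_succ, psum_zero] at h7 h8
    omega
  have ha := ha hp0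
  obtain ⟨l₁, hr, hh₁, hdeg, -⟩ := exists_coinMove_M l 0 ha hak h3 h4 h5
  have hle : ∀ m, psum p m ≤ psum (rPartS l₁) m := fun m => by
    have h7 := psum_move (p := rPartS l) (j := a) (by omega) k m
    have h8 := h6 m
    have h9 := h1.1 m
    rw [hr]
    split_ifs at h7 <;> omega
  have hb : BlockLe l₁ l' := BlockLeBy.blockLe (δ := 0)
    ⟨hdeg.sizeSum_eq.symm.trans h.2.1.size, by
      rw [h0, hr]
      simp only [addAt, subAt]
      rw [if_neg (by omega), if_neg (by omega)]
      rfl,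
      fun m => by
        have h7 := h2.1 m
        have h8 := hle m
        omega,
      fun μ m => by rw [hh₁, hh]; omega⟩
  rcases h.2.2 l₁ (GDeg.blockLe_iff.1 hdeg) hb with hs | hs
  · have := congrFun (hs.1.symm.trans hr) k
    rw [move_apply_ne hak.ne] at this
    omega
  · refine eq_of_psum_eq fun m => le_antisymm ?_ (h2.1 m)
    rw [← hs.1]
    exact hle m

theorem CoversL.eq_of_hPart_between {l l' : List SBlock} (h : CoversL l l') (μ : Option ℂ)
    (hr : rPartS l' = rPartS l) (hh : ∀ ν, ν ≠ μ → hPart l' ν = hPart l ν) {p : ℕ → ℕ}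
    (hp : IsPartitionFun p) (h1 : Dominates p (hPart l μ)) (h2 : Dominates (hPart l' μ) p) :
    p = hPart l μ ∨ p = hPart l' μ := by
  refine or_iff_not_imp_left.2 fun hne => ?_
  obtain ⟨N, hN⟩ := h1.2
  obtain ⟨y, z, hyz, h3, h4, h5⟩ := exists_move_up
    (isPartitionFun_hPart (l : Multiset SBlock) μ) h1.1 hp hN hne
  obtain ⟨l₁, hr₁, hμ₁, hh₁, hdeg, -⟩ := exists_coinMove_H l 0 μ hyz h3 h4
  have hle : ∀ m, psum (hPart l₁ μ) m ≤ psum p m := fun m => by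
    have h7 := psum_move (p := hPart l μ) (j := z) (by omega) y m
    have h8 := h5 m
    have h9 := h1.1 m
    rw [hμ₁]
    split_ifs at h7 <;> omega
  have hb : BlockLe l₁ l' := BlockLeBy.blockLe (δ := 0)
    ⟨hdeg.sizeSum_eq.symm.trans h.2.1.size, by rw [hr, hr₁]; rfl, fun m => by rw [hr, hr₁]; omega,
      fun ν m => by
        by_cases hν : ν = μ
        · subst hν
          have h7 := h2.1 m
          have h8 := hle m
          omega
        · rw [hh₁ ν hν, hh ν hν]
          omega⟩
  rcases h.2.2 l₁ (GDeg.blockLe_iff.1 hdeg) hb with hs | hs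
  · have := congrFun ((hs.2 μ).symm.trans hμ₁) y
    rw [move_apply_ne hyz.ne'] at this
    omega
  · refine eq_of_psum_eq fun m => le_antisymm (h2.1 m) ?_
    rw [← hs.2 μ]
    exact hle m

theorem Dominates.two_mul {p q : ℕ → ℕ} (h : Dominates p q) :
    Dominates (fun i => 2 * p i) fun i => 2 * q i := by
  obtain ⟨h1, N, h2⟩ := h
  refine ⟨fun m => ?_, N, fun m hm => ?_⟩
  all_goals rw [psum_two_mul, psum_two_mul]
  · exact Nat.mul_le_mul_left 2 (h1 m)
  · rw [h2 m hm]

theorem Dominates.of_two_mul {p q : ℕ → ℕ}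
    (h : Dominates (fun i => 2 * p i) fun i => 2 * q i) : Dominates p q := by
  obtain ⟨h1, N, h2⟩ := h
  simp only [psum_two_mul] at h1 h2
  exact ⟨fun m => by have := h1 m; omega, N, fun m hm => by have := h2 m hm; omega⟩

theorem exists_half {p : ℕ → ℕ} (hp : IsPartitionFun p) (he : ∀ i, Even (p i)) :
    ∃ q, IsPartitionFun q ∧ p = fun i => 2 * q i := by
  obtain ⟨h1, N, h2⟩ := hp
  have h3 : p = fun i => 2 * (p i / 2) := funext fun i => (Nat.mul_div_cancel' (he i).two_dvd).symm
  exact ⟨fun i => p i / 2, ⟨fun i => Nat.div_le_div_right (h1 i), N, fun i hi => by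
    simp only [h2 i hi, Nat.zero_div]⟩, h3⟩

theorem CoversL.rules {l l' : List SBlock} (h : CoversL l l') :
    RuleI l l' ∨ RuleII l l' ∨ RuleIII l l' ∨ RuleIV l l' := by
  have hR := isPartitionFun_rPartS (l : Multiset SBlock)
  have hH := isPartitionFun_hPart (l : Multiset SBlock)
  cases h.move with
  | I j k hj hjk hp hr hh =>
    have h0 : rPartS l' 0 = rPartS l 0 := by
      rw [hr]
      simp only [addAt, subAt]
      rw [if_neg (by omega), if_neg (by omega)]
    have hdom : Dominates (rPartS l) (rPartS l') := hr ▸ dominates_move hp hjk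
    have hk : rPartS l' k = rPartS l k + 1 := by rw [hr, move_apply_ne hjk.ne]
    refine .inl ⟨j, hj, ⟨⟨k, hjk, ?_, hk, fun i hij hik => ?_⟩, isPartitionFun_rPartS _, hdom,
      fun he => ?_, fun p hp h1 h2 => h.eq_of_rPartS_between h0 hh hp h1 h2⟩,
      fun μ => jPartS_eq_iff.2 (hh μ)⟩
    · rw [hr]
      simp only [addAt, subAt, if_true]
      rw [if_neg hjk.ne]
      omega
    · rw [hr]
      simp only [addAt, subAt]
      rw [if_neg hik, if_neg hij]
    · rw [he] at hk
      omega
  | II μ j k hjk hp hr hμ hh =>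
    have hdom : Dominates (hPart l' μ) (hPart l μ) := hμ ▸ dominates_move_left hp hjk
    have hj : hPart l' μ j = hPart l μ j + 1 := by rw [hμ, move_apply_ne hjk.ne']
    refine .inr (.inl ⟨μ, ⟨⟨j, k, hjk, even_two_mul _, even_two_mul _, ?_, ?_, fun i hij hik => ?_⟩,
      isPartitionFun_jPartS _ _, hdom.two_mul, fun he => ?_, fun p hp he h1 h2 => ?_⟩,
      fun ν hν => jPartS_eq_iff.2 (hh ν hν), hr⟩)
    · rw [jPartS_eq, jPartS_eq]
      omega
    · rw [jPartS_eq, jPartS_eq, hμ]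
      simp only [addAt, subAt, if_true]
      rw [if_neg hjk.ne']
      omega
    · rw [jPartS_eq, jPartS_eq, hμ]
      simp only [addAt, subAt]
      rw [if_neg hij, if_neg hik]
    · rw [jPartS_eq_iff.1 he] at hj
      omega
    · obtain ⟨q, hq, rfl⟩ := exists_half hp he
      rcases h.eq_of_hPart_between μ hr hh hq h2.of_two_mul h1.of_two_mul with rfl | rfl
      exacts [.inr rfl, .inl rfl]
  | III μ c hc h1 h2 hr hμ hh =>
    refine .inr (.inr (.inl ⟨c, μ, plen (hPart l μ), h1, fun i hi => ?_, ?_, ?_, fun i hi => ?_, ?_,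
      fun ν hν => jPartS_eq_iff.2 (hh ν hν)⟩))
    · exact Nat.eq_zero_of_le_zero (h2 ▸ hR.anti hi)
    · rw [hr]
      funext i
      simp only [subAt, Function.update_apply]
      split_ifs with hi
      · rw [hi, h1]
      · rfl
    · rw [jPartS_eq, (hH μ).eq_zero_of_plen_le le_rfl]
    · have := (hH μ).lt_plen.1 hi
      rw [jPartS_eq]
      omega
    · funext i
      rw [jPartS_eq, hμ]
      simp only [addAt, Function.update_apply]
      split_ifs with hi
      · rw [hi, (hH μ).eq_zero_of_plen_le le_rfl]
      · rw [jPartS_eq]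
  | IV L t q hL hpos hsupp hsum hi htq hqt hr hh =>
    refine .inr (.inr (.inr ⟨L.map fun μ => (μ, plen (hPart l μ)), t, ?_, fun x hx => ?_,
      fun ν hν => ?_, ?_⟩))
    · simpa [Function.comp_def] using hL
    · obtain ⟨μ, hμ, rfl⟩ := List.mem_map.1 hx
      have h1 := hpos μ hμ
      have h2 := (hH μ).lt_plen (i := plen (hPart l μ) - 1)
      refine ⟨h1, ?_, fun i hi => ?_⟩
      · have := h2.1 (by omega)
        rw [jPartS_eq]
        dsimp only
        omega
      · rw [jPartS_eq, (hH μ).eq_zero_of_plen_le hi]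
    · rw [jPartS_eq] at hν
      simpa [Function.comp_def] using hsupp ν (by omega)
    · have hk : ((L.map fun μ => (μ, plen (hPart l μ))).map Prod.snd).sum = t + q + 1 := by
        rw [← hsum, List.map_map]
        rfl
      simp only [hk]
      have hq : t + q + 1 - t - 1 = q := by omega
      rw [hq]
      refine ⟨by omega, fun ν i => ?_, fun i => by rw [hr], hi, fun t' ht' _ => by omega⟩
      rw [jPartS_eq, jPartS_eq, hh]
      dsimp only
      omega

theorem BlockLeBy.coversL {δ : ℕ} {l l' : List SBlock} (h : BlockLeBy δ l l') (hne : ¬ SameSt l l')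
    (H : ∀ (x : List SBlock) (δ₁ δ₂ : ℕ), δ₁ + δ₂ = δ → BlockLeBy δ₁ l x → BlockLeBy δ₂ x l' →
      SameSt x l ∨ SameSt x l') : CoversL l l' := by
  refine ⟨hne, h.blockLe, fun x h1 h2 => ?_⟩
  obtain ⟨δ₁, h1⟩ := h1.exists_by
  obtain ⟨δ₂, h2⟩ := h2.exists_by
  have h3 := h.zero
  have h4 := h1.zero
  have h5 := h2.zero
  exact H x δ₁ δ₂ (by omega) h1 h2

theorem eq_or_eq_addAt {p q : ℕ → ℕ} {d : ℕ} (hq : IsPartitionFun q) (hd : ∀ i, d ≤ i → p i = 0)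
    (h1 : ∀ m, psum p m ≤ psum q m) (h2 : ∀ m, psum q m ≤ psum p m + if d < m then 1 else 0) :
    q = p ∨ q = addAt p d := by
  have h3 : ∀ m, m ≤ d → psum q m = psum p m := fun m hm => by
    have h4 := h1 m
    have h5 := h2 m
    rw [if_neg (by omega)] at h5
    omega
  have h4 := psum_succ q d
  have h5 := h3 d le_rfl
  rcases Nat.eq_zero_or_pos (q d) with h6 | h6
  · refine .inl (eq_of_psum_eq fun m => le_antisymm ?_ (h1 m))
    rcases Nat.le_total m d with hm | hm
    · exact (h3 m hm).le
    · have h7 := psum_le_of_zero (p := q) (N := d)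
        (fun i hi => Nat.eq_zero_of_le_zero (h6 ▸ hq.anti hi)) m
      have h8 := psum_eq_of_zero hd hm
      omega
  · refine .inr (eq_of_psum_eq fun m => ?_)
    rw [psum_addAt]
    rcases Nat.lt_or_ge d m with hm | hm
    · have h7 := psum_mono q (show d + 1 ≤ m from hm)
      have h8 := psum_eq_of_zero hd hm.le
      have h9 := h2 m
      rw [if_pos hm] at h9 ⊢
      omega
    · rw [if_neg (by omega), h3 m hm]
      omega

theorem RuleI.coversL {l l' : List SBlock} (hs : sizeSum l = sizeSum l') (h : RuleI l l') :
    CoversL l l' := by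
  obtain ⟨j, hj, ⟨⟨k, hjk, h1, h2, h3⟩, -, hdom, hne, hmin⟩, hJ⟩ := h
  have hh : ∀ μ, hPart l' μ = hPart l μ := fun μ => jPartS_eq_iff.1 (hJ μ)
  refine BlockLeBy.coversL (δ := 0) ⟨hs, h3 0 (by omega) (by omega), fun m => ?_, fun μ m => ?_⟩
    (fun h => hne h.1) fun x δ₁ δ₂ hδ hx hx' => ?_
  · have := hdom.1 m
    omega
  · rw [hh]
    omega
  · obtain ⟨rfl, rfl⟩ : δ₁ = 0 ∧ δ₂ = 0 := by omega
    have e : ∀ μ, hPart x μ = hPart l μ := fun μ => eq_of_psum_eq fun m => by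
      have h4 := hx.B μ m
      have h5 := hx'.B μ m
      rw [hh] at h5
      omega
    have hA : ∀ m, psum (rPartS x) m ≤ psum (rPartS l) m := fun m => by
      have := hx.A m
      omega
    have hA' : ∀ m, psum (rPartS l') m ≤ psum (rPartS x) m := fun m => by
      have := hx'.A m
      omega
    obtain ⟨N, hN⟩ := hdom.2
    refine (hmin (rPartS x) (isPartitionFun_rPartS _) ⟨hA, N, fun m hm => ?_⟩
      ⟨hA', N, fun m hm => ?_⟩).imp (fun h => ⟨h, e⟩) fun h => ⟨h, fun μ => (e μ).trans (hh μ).symm⟩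
    all_goals
      have h4 := hA m
      have h5 := hA' m
      have h6 := hN m hm
      omega

theorem RuleII.coversL {l l' : List SBlock} (hs : sizeSum l = sizeSum l') (h : RuleII l l') :
    CoversL l l' := by
  obtain ⟨μ, ⟨-, -, hdom, hne, hmin⟩, hJ, hr⟩ := h
  have hh : ∀ ν, ν ≠ μ → hPart l' ν = hPart l ν := fun ν hν => jPartS_eq_iff.1 (hJ ν hν)
  have hd : Dominates (hPart l' μ) (hPart l μ) := hdom.of_two_mul
  refine BlockLeBy.coversL (δ := 0) ⟨hs, by rw [hr]; rfl, fun m => by rw [hr]; omega, fun ν m => ?_⟩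
    (fun h => hne (jPartS_eq_iff.2 (h.2 μ).symm)) fun x δ₁ δ₂ hδ hx hx' => ?_
  · by_cases hν : ν = μ
    · subst hν
      have := hd.1 m
      omega
    · rw [hh ν hν]
      omega
  · obtain ⟨rfl, rfl⟩ : δ₁ = 0 ∧ δ₂ = 0 := by omega
    have e : rPartS x = rPartS l := eq_of_psum_eq fun m => by
      have h4 := hx.A m
      have h5 := hx'.A m
      rw [hr] at h5
      omega
    have hB : ∀ ν m, psum (hPart l ν) m ≤ psum (hPart x ν) m := fun ν m => by
      have := hx.B ν m
      omega
    have hB' : ∀ ν m, psum (hPart x ν) m ≤ psum (hPart l' ν) m := fun ν m => by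
      have := hx'.B ν m
      omega
    have e' : ∀ ν, ν ≠ μ → hPart x ν = hPart l ν := fun ν hν => eq_of_psum_eq fun m =>
      le_antisymm (hh ν hν ▸ hB' ν m) (hB ν m)
    obtain ⟨N, hN⟩ := hd.2
    have h1 : Dominates (hPart l' μ) (hPart x μ) := ⟨hB' μ, N, fun m hm => by
      have h4 := hB μ m
      have h5 := hB' μ m
      have h6 := hN m hm
      omega⟩
    have h2 : Dominates (hPart x μ) (hPart l μ) := ⟨hB μ, N, fun m hm => by
      have h4 := hB μ m
      have h5 := hB' μ m
      have h6 := hN m hm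
      omega⟩
    rcases hmin (jPartS x μ) (isPartitionFun_jPartS _ _) (fun i => even_two_mul _) h1.two_mul
      h2.two_mul with h3 | h3
    all_goals replace h3 := jPartS_eq_iff.1 h3
    · refine .inr ⟨e.trans hr.symm, fun ν => ?_⟩
      by_cases hν : ν = μ
      · exact hν ▸ h3
      · rw [e' ν hν, hh ν hν]
    · refine .inl ⟨e, fun ν => ?_⟩
      by_cases hν : ν = μ
      · exact hν ▸ h3
      · exact e' ν hν

theorem exists_bounded₃ (s t u : Multiset SBlock) :
    ∃ E N, Bounded s E N ∧ Bounded t E N ∧ Bounded u E N := by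
  obtain ⟨E, N, -, h, h'⟩ := exists_bounded₂ s t
  obtain ⟨E', N', h''⟩ := exists_bounded u
  exact ⟨E ∪ E', N + N', h.mono Finset.subset_union_left (by omega),
    h'.mono Finset.subset_union_left (by omega), h''.mono Finset.subset_union_right (by omega)⟩

theorem RuleIII.coversL {l l' : List SBlock} (hs : sizeSum l = sizeSum l') (h : RuleIII l l') :
    CoversL l l' := by
  obtain ⟨c, μ, d, h1, h2, hr, h4, h5, hμ, hJ⟩ := h
  have hR := isPartitionFun_rPartS (l : Multiset SBlock)
  have hh : ∀ ν, ν ≠ μ → hPart l' ν = hPart l ν := fun ν hν => jPartS_eq_iff.1 (hJ ν hν)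
  have hr : rPartS l = addAt (rPartS l') c := by
    funext i
    simp only [hr, addAt, Function.update_apply]
    split_ifs with hi
    · rw [hi, h1]
    · rfl
  have hc0 : ∀ i, c ≤ i → rPartS l' i = 0 := fun i hi => by
    have h6 := congrFun hr i
    simp only [addAt] at h6
    split_ifs at h6 with hic
    · rw [hic, h1] at h6
      rw [hic]
      omega
    · rw [h2 i (by omega)] at h6
      exact h6.symm
  have hμ : hPart l' μ = addAt (hPart l μ) d := by
    funext i
    have h6 := congrFun hμ i
    rw [jPartS_eq] at h4
    simp only [addAt, Function.update_apply, jPartS_eq] at h6 ⊢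
    split_ifs at h6 ⊢ with hi
    · subst hi
      omega
    · omega
  have hd0 : ∀ i, d ≤ i → hPart l μ i = 0 := fun i hi => by
    rw [jPartS_eq] at h4
    have := (isPartitionFun_hPart (l : Multiset SBlock) μ).anti hi
    omega
  have hc : 1 ≤ c := by
    obtain ⟨E, N, -, hl, hl'⟩ := exists_bounded₂ (l : Multiset SBlock) l'
    have h6 := sizeSum_eq l E N hl
    have h7 := sizeSum_eq l' E N hl'
    by_contra h8
    obtain rfl : c = 0 := by omega
    have h9 := hc0 0 le_rfl
    omega
  refine BlockLeBy.coversL (δ := 0) ⟨hs, ?_, fun m => ?_, fun ν m => ?_⟩ (fun h => ?_)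
    fun x δ₁ δ₂ hδ hx hx' => ?_
  · rw [hr]
    simp only [addAt]
    rw [if_neg (by omega)]
    rfl
  · rw [hr, psum_addAt]
    omega
  · by_cases hν : ν = μ
    · subst hν
      rw [hμ, psum_addAt]
      omega
    · rw [hh ν hν]
      omega
  · have h6 := congrFun h.1 c
    rw [h1, hc0 c le_rfl] at h6
    omega
  · obtain ⟨rfl, rfl⟩ : δ₁ = 0 ∧ δ₂ = 0 := by omega
    have e' : ∀ ν, ν ≠ μ → hPart x ν = hPart l ν := fun ν hν => eq_of_psum_eq fun m => by
      have h6 := hx.B ν m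
      have h7 := hx'.B ν m
      rw [hh ν hν] at h7
      omega
    have hrx := eq_or_eq_addAt (isPartitionFun_rPartS (x : Multiset SBlock)) hc0
      (fun m => by have := hx'.A m; omega)
      (fun m => by have := hx.A m; rw [hr, psum_addAt] at this; omega)
    have hhx := eq_or_eq_addAt (isPartitionFun_hPart (x : Multiset SBlock) μ) hd0
      (fun m => by have := hx.B μ m; omega)
      (fun m => by have := hx'.B μ m; rw [hμ, psum_addAt] at this; omega)
    rw [← hr] at hrx
    rw [← hμ] at hhx
    obtain ⟨E, N, hl, hl', hlx⟩ := exists_bounded₃ (l : Multiset SBlock) l' x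
    have hcN : c < N := by
      by_contra h6
      have := hl.rPartS_eq_zero (not_lt.1 h6)
      omega
    have hpN : psum (rPartS l) N = psum (rPartS l') N + 1 := by
      rw [hr, psum_addAt, if_pos hcN]
    have s1 := hx.sum_eq hl hlx
    have s2 := hx'.sum_eq hlx hl'
    rcases hhx with hhx | hhx
    · have e : ∀ ν, hPart x ν = hPart l ν := fun ν => by
        by_cases hν : ν = μ
        · exact hν ▸ hhx
        · exact e' ν hν
      rcases hrx with hrx | hrx
      · simp only [e, hrx] at s1
        omega
      · exact .inl ⟨hrx, e⟩
    · have e : ∀ ν, hPart x ν = hPart l' ν := fun ν => by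
        by_cases hν : ν = μ
        · exact hν ▸ hhx
        · rw [e' ν hν, hh ν hν]
      rcases hrx with hrx | hrx
      · exact .inr ⟨hrx, e⟩
      · simp only [e, hrx] at s2
        omega

theorem BlockLeBy.hPart_eq {l l' : List SBlock} (h : BlockLeBy 0 l l')
    (hr : rPartS l' = rPartS l) (hp : ∀ μ m, m ≤ plen (hPart l μ) →
      psum (hPart l' μ) m ≤ psum (hPart l μ) m) (μ : Option ℂ) : hPart l' μ = hPart l μ := by
  obtain ⟨E, N, -, hl, hl'⟩ := exists_bounded₂ (l : Multiset SBlock) l'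
  have hB : ∀ ν m, psum (hPart l ν) m ≤ psum (hPart l' ν) m := fun ν m => by
    have := h.B ν m
    omega
  by_cases hμ : μ ∈ E
  · have s := h.sum_eq hl hl'
    rw [hr] at s
    have e := (Finset.sum_eq_sum_iff_of_le fun ν (_ : ν ∈ E) => hB ν N).1 (by omega) μ hμ
    refine eq_of_psum_eq fun m => le_antisymm ?_ (hB μ m)
    rcases Nat.le_total m (plen (hPart l μ)) with hm | hm
    · exact hp μ m hm
    · have hP := isPartitionFun_hPart (l : Multiset SBlock) μ
      have h1 := psum_le_of_zero (p := hPart l' μ) (fun i hi => hl'.hPart_eq_zero μ hi) m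
      have h2 := hP.psum_le N
      have h3 := hP.psum_eq hm
      omega
  · funext i
    rw [hl.hPart_eq_zero' hμ, hl'.hPart_eq_zero' hμ]

theorem RuleIV.coversL {l l' : List SBlock} (hs : sizeSum l = sizeSum l') (h : RuleIV l l') :
    CoversL l l' := by
  obtain ⟨ek, t, -, -, -, htk, hJ, hr, hi, hmin⟩ := h
  generalize (ek.map Prod.snd).sum = k at *
  obtain ⟨q, rfl⟩ : ∃ q, k = t + q + 1 := ⟨k - t - 1, by omega⟩
  have hq : t + q + 1 - t - 1 = q := by omega
  rw [hq] at hr hi hmin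
  have hbal : t ≤ q + 1 ∧ q ≤ t + 1 := by
    have := hmin ((t + q) / 2) (by omega) fun i h0 => by
      have := hi i h0
      omega
    omega
  have hp : ∀ μ m, psum (hPart l' μ) m + min (plen (hPart l μ)) m = psum (hPart l μ) m :=
    fun μ m => by
      rw [← (isPartitionFun_hPart (l : Multiset SBlock) μ).psum_sub_one m]
      congr 2
      funext i
      have := hJ μ i
      rw [jPartS_eq, jPartS_eq] at this
      omega
  have hpr : ∀ m, psum (rPartS l') m = psum (rPartS l) m + min (t + 1) m + min (q + 1) m :=
    fun m => by
      rw [← psum_ite_lt (t + 1), ← psum_ite_lt (q + 1), ← psum_add, ← psum_add]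
      simp only [Nat.lt_succ_iff]
      exact psum_congr fun i _ => hr i
  have hR0 : ∀ i, min t q + 1 ≤ i → rPartS l i = 0 := fun i h1 => by
    by_contra h2
    have := hi i h2
    omega
  refine BlockLeBy.coversL (δ := 1) ⟨hs, by rw [hr]; simp, fun m => ?_, fun μ m => ?_⟩ (fun h => ?_)
    fun x δ₁ δ₂ hδ hx hx' => ?_
  · rw [hpr]
    omega
  · have := hp μ m
    omega
  · have h0 := congrFun h.1 0
    rw [hr] at h0
    simp only [Nat.zero_le, if_true] at h0
    omega
  · obtain ⟨rfl, rfl⟩ | ⟨rfl, rfl⟩ : δ₁ = 0 ∧ δ₂ = 1 ∨ δ₁ = 1 ∧ δ₂ = 0 := by omega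
    · have e : rPartS x = rPartS l := eq_of_psum_eq fun m => by
        have h1 := hx.A m
        rcases Nat.le_total m (min t q + 1) with hm | hm
        · have h2 := hx'.A m
          rw [hpr] at h2
          omega
        · have h2 := hx'.A (min t q + 1)
          rw [hpr] at h2
          have h3 := psum_mono (rPartS x) hm
          have h4 := psum_eq_of_zero hR0 hm
          omega
      exact .inl ⟨e, hx.hPart_eq e fun μ m hm => by
        have h1 := hx'.B μ m
        have h2 := hp μ m
        omega⟩
    · have e : ∀ μ, hPart x μ = hPart l' μ := fun μ => eq_of_psum_eq fun m => by
        have h1 := hx'.B μ m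
        have h2 := hp μ m
        rcases Nat.le_total m (plen (hPart l μ)) with hm | hm
        · have h3 := hx.B μ m
          omega
        · have h3 := hx.B μ (plen (hPart l μ))
          have h4 := hp μ (plen (hPart l μ))
          have h5 := psum_mono (hPart x μ) hm
          have h6 := (isPartitionFun_hPart (l : Multiset SBlock) μ).psum_eq hm
          omega
      obtain ⟨E, N, -, hl', hlx⟩ := exists_bounded₂ (l' : Multiset SBlock) x
      have s := hx'.sum_eq hlx hl'
      simp only [e] at s
      refine .inr ⟨eq_of_psum_eq fun m => le_antisymm ?_ (by have := hx'.A m; omega), e⟩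
      rcases Nat.lt_or_ge (min t q + 1) m with hm | hm
      · have h1 : ∀ i, min t q + 2 ≤ i → rPartS l' i = 0 := fun i h2 => by
          rw [hr, hR0 i (by omega), if_neg (by omega), if_neg (by omega)]
        have h2 := psum_eq_of_zero h1 hm
        have h3 := psum_le_of_zero h1 N
        have h4 := psum_le_of_zero (p := rPartS x) (fun i hi => hlx.rPartS_eq_zero hi) m
        omega
      · have h1 := hx.A m
        rw [hpr]
        omega

/-- **Theorem 3.5**: for skew-symmetric pencils `P1`, `P2`, `orbᶜ P1` covers
`orbᶜ P2` if and only if the integer partitions `R`, `L`, `J_μ` of `P2` are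
obtained from those of `P1` by applying exactly one of the coin-move rules
I–IV. -/
theorem coversC_iff_coinRules {n : ℕ} (P1 P2 : Pencil n n)
    (h1 : Pencil.IsSkew P1) (h2 : Pencil.IsSkew P2) :
    Pencil.CoversC P1 P2 ↔
      ∃ s1 s2 : Multiset SBlock, WeakRepresentsC P1 s1 ∧ WeakRepresentsC P2 s2 ∧
        (RuleI s1 s2 ∨ RuleII s1 s2 ∨ RuleIII s1 s2 ∨ RuleIV s1 s2) := by
  constructor
  · intro h
    obtain ⟨l, -, hl⟩ := exists_canonical h1
    obtain ⟨l', -, hl'⟩ := exists_canonical h2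
    exact ⟨l, l', (weakRepresentsC_iff _ _).2 ⟨l, rfl, hl⟩, (weakRepresentsC_iff _ _).2 ⟨l', rfl, hl'⟩,
      ((coversC_iff_coversL hl hl').1 h).rules⟩
  · rintro ⟨s, s', hs, hs', h⟩
    obtain ⟨l, rfl, hl⟩ := (weakRepresentsC_iff _ _).1 hs
    obtain ⟨l', rfl, hl'⟩ := (weakRepresentsC_iff _ _).1 hs'
    have e : sizeSum l = sizeSum l' := by simpa using hl.card_eq.trans hl'.card_eq.symm
    refine (coversC_iff_coversL hl hl').2 ?_
    rcases h with h | h | h | h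
    exacts [h.coversL e, h.coversL e, h.coversL e, h.coversL e]
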